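/- The complex vector space S₁(Γ₁(124); ℂ) of weight 1 cusp forms of level Γ₁(124) has dimension exactly 7 over ℂ (a 4-dimensional space of newforms together with a 3-dimensional space of oldforms coming from level 31). -/

import Mathlib

namespace ThetaQuotient

open Complex ModularForm Asymptotics Filter Topology Polynomial CongruenceSubgroup
open UpperHalfPlane hiding I
open scoped Real UpperHalfPlane MatrixGroups Manifold

/-- The theta constant with real characteristics `x + 1/2`, `y + 1/2`, as a function of `τ`. -/
noncomputable def thetaChar (x y : ℝ) (τ : ℂ) : ℂ :=
  cexp (π * I * ((x + 1 / 2) ^ 2 * τ + y + x * y)) *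
    jacobiTheta₂ ((x + 1 / 2) * τ + y + 1 / 2) τ

lemma jacobiTheta₂_add_one_right (z τ : ℂ) :
    jacobiTheta₂ z (τ + 1) = jacobiTheta₂ (z + 1 / 2) τ := by
  refine tsum_congr fun n ↦ ?_
  simp only [jacobiTheta₂_term]
  obtain ⟨k, hk⟩ := Int.even_mul_succ_self (n - 1)
  rw [Complex.exp_eq_exp_iff_exists_int]
  refine ⟨k, ?_⟩
  have hk' : ((n : ℂ) - 1) * n = k + k := by exact_mod_cast (by simpa using hk)
  linear_combination (π * I) * hk'

lemma thetaChar_add_one (x y : ℝ) (τ : ℂ) :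
    thetaChar x y (τ + 1) = cexp (π * I / 4) * thetaChar x (x + y) τ := by
  have h : ((x : ℂ) + 1 / 2) * (τ + 1) + y + 1 / 2 + 1 / 2 =
      (x + 1 / 2) * τ + (x + y : ℝ) + 1 / 2 + 1 := by push_cast; ring
  rw [thetaChar, thetaChar, jacobiTheta₂_add_one_right, ← mul_assoc, ← Complex.exp_add, h,
    jacobiTheta₂_add_left]
  congr 2
  push_cast
  ring

lemma thetaChar_neg_inv (x y : ℝ) {τ : ℂ} (hτ : τ ≠ 0) :
    thetaChar x y (-1 / τ) =
      -I * (-I * τ) ^ (1 / 2 : ℂ) * thetaChar y (-x) τ := by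
  have hI : -I = cexp (-(π * I / 2)) := by
    rw [Complex.exp_neg, ← div_mul_eq_mul_div, Complex.exp_pi_div_two_mul_I, Complex.inv_I]
  have h0 : (-I * τ) ^ (1 / 2 : ℂ) ≠ 0 := by
    rw [Complex.cpow_def_of_ne_zero (by simp [hτ])]
    exact Complex.exp_ne_zero _
  set r := (-I * τ) ^ (1 / 2 : ℂ)
  set z : ℂ := (y + 1 / 2) * τ + (-x : ℝ) + 1 / 2
  have h1 := jacobiTheta₂_add_left' (z / τ) (-1 / τ)
  have h2 : z / τ + -1 / τ = (x + 1 / 2) * (-1 / τ) + y + 1 / 2 := by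
    simp only [z]; push_cast; field_simp; ring
  rw [h2] at h1
  rw [thetaChar, h1, thetaChar, jacobiTheta₂_functional_equation z τ]
  change _ * (_ * ?_) = _ * r * (_ * (1 / r * _ * ?_))
  generalize jacobiTheta₂ (z / τ) (-1 / τ) = J
  rw [hI]
  have key : cexp (π * I * ((x + 1 / 2) ^ 2 * (-1 / τ) + y + x * y)) *
      cexp (-π * I * (-1 / τ + 2 * (z / τ))) = cexp (-(π * I / 2)) *
        cexp (π * I * ((y + 1 / 2) ^ 2 * τ + (-x : ℝ) + y * (-x : ℝ))) *
          cexp (-π * I * z ^ 2 / τ) := by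
    simp only [← Complex.exp_add]
    congr 1
    simp only [z]
    push_cast
    field_simp
    ring
  rw [← mul_assoc, key]
  field_simp

lemma thetaChar_snd_add_int (x y : ℝ) (m : ℤ) (τ : ℂ) :
    thetaChar x (y + m) τ = cexp (π * I * (m + x * m)) * thetaChar x y τ := by
  have h (z : ℂ) : jacobiTheta₂ (z + m) τ = jacobiTheta₂ z τ := by
    refine tsum_congr fun n ↦ ?_
    simp only [jacobiTheta₂_term]
    rw [Complex.exp_eq_exp_iff_exists_int]
    exact ⟨n * m, by push_cast; ring⟩
  have h1 : ((x : ℂ) + 1 / 2) * τ + (y + m : ℝ) + 1 / 2 =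
      (x + 1 / 2) * τ + y + 1 / 2 + m := by push_cast; ring
  rw [thetaChar, thetaChar, h1, h, ← mul_assoc, ← Complex.exp_add]
  congr 2
  push_cast
  ring

lemma thetaChar_fst_add_one (x : ℝ) (τ : ℂ) :
    thetaChar (x + 1) 0 τ = -thetaChar x 0 τ := by
  have h1 : (((x + 1 : ℝ) : ℂ) + 1 / 2) * τ + (0 : ℝ) + 1 / 2 =
      ((x + 1 / 2) * τ + (0 : ℝ) + 1 / 2) + τ := by push_cast; ring
  rw [thetaChar, thetaChar, h1, jacobiTheta₂_add_left', ← mul_assoc, ← Complex.exp_add,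
    ← neg_mul]
  congr 1
  rw [neg_eq_neg_one_mul (cexp _), ← Complex.exp_pi_mul_I, ← Complex.exp_add,
    Complex.exp_eq_exp_iff_exists_int]
  refine ⟨-1, ?_⟩
  push_cast
  ring

lemma thetaChar_fst_add_int (x : ℝ) (m : ℤ) (τ : ℂ) :
    thetaChar (x + m) 0 τ = (-1) ^ m * thetaChar x 0 τ := by
  induction m with
  | zero => simp
  | succ n ih =>
    push_cast at ih ⊢
    rw [← add_assoc, thetaChar_fst_add_one, ih, zpow_add₀ (by norm_num)]
    simp
  | pred n ih =>
    have := thetaChar_fst_add_one (x + (-n - 1 : ℤ)) τ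
    push_cast at ih this ⊢
    rw [show x + (-(n : ℝ) - 1) + 1 = x + -n by ring, ih] at this
    rw [zpow_sub₀ (by norm_num), zpow_one, div_neg, div_one]
    linear_combination this

lemma differentiableAt_thetaChar (x y : ℝ) {τ : ℂ} (hτ : 0 < τ.im) :
    DifferentiableAt ℂ (thetaChar x y) τ := by
  refine .mul (by fun_prop) ?_
  exact (hasFDerivAt_jacobiTheta₂ _ hτ).differentiableAt.comp τ
    (f := fun t : ℂ ↦ ((x + 1 / 2) * t + y + 1 / 2, t)) (by fun_prop)

lemma eta_add_one (τ : ℂ) : η (τ + 1) = cexp (π * I / 12) * η τ := by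
  have h (n : ℕ) : eta_q n (τ + 1) = eta_q n τ := by
    rw [eta_q_eq_cexp, eta_q_eq_cexp, Complex.exp_eq_exp_iff_exists_int]
    exact ⟨n + 1, by push_cast; ring⟩
  simp only [ModularForm.eta, h, ← mul_assoc, Function.Periodic.qParam, ← Complex.exp_add]
  congr 2
  push_cast
  ring

lemma eta_neg_inv {τ : ℂ} (hτ : 0 < τ.im) :
    η (-1 / τ) = (-I * τ) ^ (1 / 2 : ℂ) * η τ := by
  have h := eta_comp_eq_csqrt_I_inv hτ
  have h0 : τ ≠ 0 := by rintro rfl; simp at hτ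
  simp only [Function.comp, Pi.smul_apply, Pi.mul_apply, smul_eq_mul] at h
  rw [h, ← mul_assoc]
  congr 1
  have h1 : Complex.log (-I * τ) = Complex.log (-I) + Complex.log τ := by
    refine Complex.log_mul (by simp) h0 ?_
    have ha : Complex.arg (-I) = -(π / 2) := Complex.arg_neg_I
    have hb := Complex.arg_nonneg_iff.2 hτ.le
    have hc := Complex.arg_le_pi τ
    rw [ha]
    constructor <;> linarith [Real.pi_pos]
  rw [Complex.sqrt, Complex.sqrt, Complex.cpow_def_of_ne_zero I_ne_zero,
    Complex.cpow_def_of_ne_zero h0, Complex.cpow_def_of_ne_zero (by simp [h0]), h1,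
    ← Complex.exp_neg, ← Complex.exp_add, Complex.log_neg_I, Complex.log_I]
  congr 1
  ring

/-- The product of eleven theta constants, with characteristics given by the rows of `A`,
divided by `η ^ 9`. -/
noncomputable def thetaQuot (A : Matrix (Fin 11) (Fin 2) ℝ) (τ : ℂ) : ℂ :=
  -(∏ i, thetaChar (A i 0) (A i 1) τ) / η τ ^ 9

lemma differentiableAt_thetaQuot (A : Matrix (Fin 11) (Fin 2) ℝ) {τ : ℂ} (hτ : 0 < τ.im) :
    DifferentiableAt ℂ (thetaQuot A) τ := by
  unfold thetaQuot
  refine .div (.neg ?_) (.pow (differentiableAt_eta_of_mem_upperHalfPlaneSet hτ) 9)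
    (pow_ne_zero 9 (eta_ne_zero hτ))
  exact DifferentiableAt.fun_finsetProd fun i _ ↦ differentiableAt_thetaChar _ _ hτ

/-- The real matrix attached to an integral one. -/
def realMat (γ : SL(2, ℤ)) : Matrix (Fin 2) (Fin 2) ℝ := γ.1.map (Int.castRingHom ℝ)

lemma realMat_apply (γ : SL(2, ℤ)) (i j : Fin 2) : realMat γ i j = γ.1 i j := rfl

lemma realMat_one : realMat 1 = 1 := by simp [realMat]

lemma realMat_mul (γ δ : SL(2, ℤ)) : realMat (γ * δ) = realMat γ * realMat δ := by
  simp only [realMat, Matrix.SpecialLinearGroup.coe_mul, Matrix.map_mul]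

lemma thetaQuot_slash_T (A : Matrix (Fin 11) (Fin 2) ℝ) :
    (fun τ : ℍ ↦ thetaQuot A τ) ∣[(1 : ℤ)] ModularGroup.T =
      fun τ : ℍ ↦ thetaQuot (A * realMat ModularGroup.T) τ := by
  ext τ
  rw [SL_slash_apply]
  have h1 : ((ModularGroup.T • τ : ℍ) : ℂ) = τ + 1 := by
    rw [UpperHalfPlane.modular_T_smul]; simp [add_comm]
  simp only [h1, thetaQuot, thetaChar_add_one, eta_add_one, Finset.prod_mul_distrib]
  have h2 (i : Fin 11) : (A * realMat ModularGroup.T) i 0 = A i 0 ∧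
      (A * realMat ModularGroup.T) i 1 = A i 0 + A i 1 := by
    simp [Matrix.mul_apply, Fin.sum_univ_two, realMat_apply, ModularGroup.coe_T]
  simp only [fun i ↦ (h2 i).1, fun i ↦ (h2 i).2]
  have h3 : cexp (π * I / 4) ^ 11 = cexp (π * I / 12) ^ 9 := by
    rw [← Complex.exp_nat_mul, ← Complex.exp_nat_mul, Complex.exp_eq_exp_iff_exists_int]
    exact ⟨1, by push_cast; ring⟩
  have h4 : cexp (π * I / 12) ^ 9 ≠ 0 := pow_ne_zero _ (Complex.exp_ne_zero _)
  have h5 : UpperHalfPlane.denom ModularGroup.T τ = 1 := by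
    simp [ModularGroup.denom_apply, ModularGroup.coe_T]
  rw [mul_pow, Finset.prod_const, Finset.card_univ, Fintype.card_fin, h3, h5, one_zpow, mul_one,
    ← mul_neg, mul_div_mul_left _ _ h4]

lemma thetaQuot_slash_S (A : Matrix (Fin 11) (Fin 2) ℝ) :
    (fun τ : ℍ ↦ thetaQuot A τ) ∣[(1 : ℤ)] ModularGroup.S =
      fun τ : ℍ ↦ thetaQuot (A * realMat ModularGroup.S) τ := by
  ext τ
  rw [SL_slash_apply]
  have h0 : (τ : ℂ) ≠ 0 := τ.ne_zero
  have h1 : ((ModularGroup.S • τ : ℍ) : ℂ) = -1 / τ := by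
    rw [UpperHalfPlane.modular_S_smul]; simp [neg_div]
  simp only [h1, thetaQuot, thetaChar_neg_inv _ _ h0, eta_neg_inv τ.2, Finset.prod_mul_distrib]
  have h2 (i : Fin 11) : (A * realMat ModularGroup.S) i 0 = A i 1 ∧
      (A * realMat ModularGroup.S) i 1 = -A i 0 := by
    simp [Matrix.mul_apply, Fin.sum_univ_two, realMat_apply, ModularGroup.coe_S]
  simp only [fun i ↦ (h2 i).1, fun i ↦ (h2 i).2]
  have h5 : UpperHalfPlane.denom ModularGroup.S τ = τ := by
    simp [ModularGroup.denom_apply, ModularGroup.coe_S]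
  have h6 : (-I * (τ : ℂ)) ≠ 0 := by simp [h0]
  have h7 : ((-I * τ) ^ (1 / 2 : ℂ)) ^ 2 = -I * τ := by
    rw [← Complex.cpow_nat_mul]; simp
  have h8 : (-I * τ : ℂ) ^ (1 / 2 : ℂ) ≠ 0 := fun h ↦ h6 (by rw [← h7, h]; simp)
  have h9 : η τ ≠ 0 := eta_ne_zero τ.2
  rw [h5]
  generalize (-I * τ : ℂ) ^ (1 / 2 : ℂ) = r at *
  simp only [Finset.prod_const, Finset.card_univ, Fintype.card_fin, zpow_neg, zpow_one]
  field_simp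
  have hI : I ^ 11 = -I := by rw [Complex.I_pow_eq_pow_mod]; norm_num
  rw [hI, h7]
  linear_combination (∏ i, thetaChar (A i 1) (-A i 0) τ) * τ * I_sq

lemma thetaQuot_slash (γ : SL(2, ℤ)) (A : Matrix (Fin 11) (Fin 2) ℝ) :
    (fun τ : ℍ ↦ thetaQuot A τ) ∣[(1 : ℤ)] γ = fun τ : ℍ ↦ thetaQuot (A * realMat γ) τ := by
  have hγ : γ ∈ Subgroup.closure {ModularGroup.S, ModularGroup.T} := by
    rw [SpecialLinearGroup.SL2Z_generators]; trivial
  induction hγ using Subgroup.closure_induction generalizing A with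
  | mem x hx =>
    rcases hx with rfl | rfl
    · exact thetaQuot_slash_S A
    · exact thetaQuot_slash_T A
  | one => simp [realMat_one]
  | mul x y _ _ hx hy =>
    rw [SlashAction.slash_mul, hx, hy, Matrix.mul_assoc, realMat_mul]
  | inv x _ hx =>
    have h := hx (A * realMat x⁻¹)
    have h1 : realMat x⁻¹ * realMat x = 1 := by
      rw [← realMat_mul, inv_mul_cancel, realMat_one]
    rw [Matrix.mul_assoc, h1, Matrix.mul_one] at h
    rw [← h, ← SlashAction.slash_mul]
    simp

/-- The general term of the series defining `thetaChar`. -/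
noncomputable def thetaTerm (x y : ℝ) (n : ℤ) (τ : ℂ) : ℂ :=
  cexp (π * I * ((n + 1 / 2 + x) ^ 2 * τ + (2 * n + 1) * y + n + x * y))

lemma norm_thetaTerm (x y : ℝ) (n : ℤ) (τ : ℂ) :
    ‖thetaTerm x y n τ‖ = rexp (-π * (n + 1 / 2 + x) ^ 2 * τ.im) := by
  rw [thetaTerm, Complex.norm_exp]
  congr 1
  have : (π * I * ((n + 1 / 2 + x) ^ 2 * τ + (2 * n + 1) * y + n + x * y) : ℂ) =
      ((π * (n + 1 / 2 + x) ^ 2 : ℝ) : ℂ) * (τ * I) +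
        ((π * ((2 * n + 1) * y + n + x * y) : ℝ) : ℂ) * I := by
    push_cast; ring
  rw [this, Complex.add_re, Complex.re_ofReal_mul, Complex.re_ofReal_mul, Complex.mul_I_re,
    Complex.I_re]
  ring

lemma hasSum_thetaTerm (x y : ℝ) {τ : ℂ} (hτ : 0 < τ.im) :
    HasSum (fun n ↦ thetaTerm x y n τ) (thetaChar x y τ) := by
  refine ((hasSum_jacobiTheta₂_term _ hτ).mul_left _).congr_fun fun n ↦ ?_
  rw [jacobiTheta₂_term, ← Complex.exp_add, thetaTerm]
  congr 1
  ring

lemma exists_norm_thetaChar_sub_sum_le (x y : ℝ) (s : Finset ℤ) {μ : ℝ}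
    (hμ : ∀ n ∉ s, μ ≤ (n + 1 / 2 + x) ^ 2) :
    ∃ C : ℝ, ∀ τ : ℂ, 1 ≤ τ.im →
      ‖thetaChar x y τ - ∑ n ∈ s, thetaTerm x y n τ‖ ≤ C * rexp (-π * μ * τ.im) := by
  have hI : Summable fun n ↦ ‖thetaTerm x y n I‖ :=
    (hasSum_thetaTerm x y (τ := I) (by simp)).summable.norm
  refine ⟨rexp (π * μ) * ∑' n : {n // n ∉ s}, ‖thetaTerm x y n I‖, fun τ hτ ↦ ?_⟩
  have hsum := (hasSum_thetaTerm x y (zero_lt_one.trans_le hτ))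
  rw [← hsum.tsum_eq, ← hsum.summable.sum_add_tsum_subtype_compl s, add_sub_cancel_left]
  have hs : Summable fun n : {n // n ∉ s} ↦ ‖thetaTerm x y n I‖ := hI.subtype _
  have hb (n : {n // n ∉ s}) : ‖thetaTerm x y n τ‖ ≤
      rexp (π * μ) * rexp (-π * μ * τ.im) * ‖thetaTerm x y n I‖ := by
    rw [norm_thetaTerm, norm_thetaTerm, ← Real.exp_add, ← Real.exp_add, Complex.I_im]
    refine Real.exp_le_exp.2 ?_
    have := mul_nonneg Real.pi_pos.le
      (mul_nonneg (sub_nonneg.2 (hμ n n.2)) (sub_nonneg.2 hτ))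
    linarith
  refine (tsum_of_norm_bounded (hs.mul_left _).hasSum hb).trans_eq ?_
  rw [tsum_mul_left]
  ring

lemma coe_smul_eq (γ : SL(2, ℤ)) (τ : ℍ) :
    ((γ • τ : ℍ) : ℂ) = ((γ.1 0 0 : ℂ) * τ + γ.1 0 1) / ((γ.1 1 0 : ℂ) * τ + γ.1 1 1) := by
  rw [UpperHalfPlane.specialLinearGroup_apply]
  simp

lemma thetaQuot_scale_slash (M : Matrix (Fin 11) (Fin 2) ℝ) (γ γ' : SL(2, ℤ)) {N A B D : ℤ}
    (hA : 0 < A) (hD : 0 < D) (h00 : N * γ.1 0 0 = γ'.1 0 0 * A)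
    (h01 : N * γ.1 0 1 = γ'.1 0 0 * B + γ'.1 0 1 * D) (h10 : γ.1 1 0 = γ'.1 1 0 * A)
    (h11 : γ.1 1 1 = γ'.1 1 0 * B + γ'.1 1 1 * D) (τ : ℍ) :
    ((fun τ : ℍ ↦ thetaQuot M (N * τ)) ∣[(1 : ℤ)] γ) τ =
      thetaQuot (M * realMat γ') ((A * τ + B) / D) / D := by
  have him : 0 < (((A : ℂ) * τ + B) / D).im := by
    have h1 : ((A : ℂ) * τ + B) / D = ((A / D : ℝ) : ℂ) * τ + ((B / D : ℝ) : ℂ) := by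
      push_cast; ring
    rw [h1, Complex.add_im, Complex.im_ofReal_mul, Complex.ofReal_im, add_zero]
    have : (0 : ℝ) < A / D := by positivity
    exact mul_pos this τ.2
  have hD' : (D : ℂ) ≠ 0 := by exact_mod_cast hD.ne'
  set τ' : ℍ := ⟨_, him⟩ with hτ'
  have hc : (τ' : ℂ) = (A * τ + B) / D := rfl
  have hden : ∀ (δ : SL(2, ℤ)) (z : ℍ), (δ.1 1 0 : ℂ) * z + δ.1 1 1 ≠ 0 := fun δ z ↦ by
    have := UpperHalfPlane.denom_ne_zero δ z
    rwa [ModularGroup.denom_apply] at this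
  have hden' : (γ.1 1 0 : ℂ) * τ + γ.1 1 1 = D * ((γ'.1 1 0 : ℂ) * τ' + γ'.1 1 1) := by
    rw [hc, h10, h11]; push_cast; field_simp; ring
  have hnum : (N : ℂ) * ((γ.1 0 0 : ℂ) * τ + γ.1 0 1) =
      D * ((γ'.1 0 0 : ℂ) * τ' + γ'.1 0 1) := by
    have e0 : (N : ℂ) * γ.1 0 0 = γ'.1 0 0 * A := by exact_mod_cast h00
    have e1 : (N : ℂ) * γ.1 0 1 = γ'.1 0 0 * B + γ'.1 0 1 * D := by exact_mod_cast h01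
    rw [mul_add, ← mul_assoc, e0, e1, hc]; field_simp; ring
  have hpt : (N : ℂ) * ((γ • τ : ℍ) : ℂ) = ((γ' • τ' : ℍ) : ℂ) := by
    rw [coe_smul_eq, coe_smul_eq, ← mul_div_assoc, hnum, hden', mul_div_mul_left _ _ hD']
  have hmain := congr_fun (thetaQuot_slash γ' M) τ'
  rw [SL_slash_apply] at hmain ⊢
  rw [← hc, ← hmain, ModularGroup.denom_apply, ModularGroup.denom_apply]
  simp only [hpt]
  rw [hden', zpow_neg_one, zpow_neg_one, mul_inv]
  ring

/-- The characteristics `h / 124`. -/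
noncomputable def charMat (h : Fin 11 → ℤ) : Matrix (Fin 11) (Fin 2) ℝ :=
  Matrix.of fun i ↦ ![(h i : ℝ) / 124, 0]

/-- The weight one theta quotient of level `124` attached to `h`. -/
noncomputable def levelQuot (h : Fin 11 → ℤ) (τ : ℍ) : ℂ := thetaQuot (charMat h) (124 * τ)

lemma levelQuot_def (h : Fin 11 → ℤ) :
    levelQuot h = fun τ : ℍ ↦ thetaQuot (charMat h) ((124 : ℤ) * τ) := by
  ext; simp [levelQuot]

lemma charMat_mul_zero (h : Fin 11 → ℤ) (γ : SL(2, ℤ)) (i : Fin 11) :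
    (charMat h * realMat γ) i 0 = h i * γ.1 0 0 / 124 := by
  simp [Matrix.mul_apply, Fin.sum_univ_two, realMat_apply, charMat]
  ring

lemma charMat_mul_one (h : Fin 11 → ℤ) (γ : SL(2, ℤ)) (i : Fin 11) :
    (charMat h * realMat γ) i 1 = h i * γ.1 0 1 / 124 := by
  simp [Matrix.mul_apply, Fin.sum_univ_two, realMat_apply, charMat]
  ring

lemma even_sum_of_sq {h : Fin 11 → ℤ} (hh : (248 : ℤ) ∣ ∑ i, h i ^ 2) : Even (∑ i, h i) := by
  have h1 : ∑ i, h i ^ 2 = ∑ i, h i + 2 * ∑ i, (h i * (h i - 1) / 2) := by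
    rw [Finset.mul_sum, ← Finset.sum_add_distrib]
    refine Finset.sum_congr rfl fun i _ ↦ ?_
    have : (2 : ℤ) ∣ h i * (h i - 1) := (Int.even_mul_pred_self _).two_dvd
    rw [Int.mul_ediv_cancel' this]
    ring
  rw [Int.even_iff]
  omega

lemma levelQuot_slash {h : Fin 11 → ℤ} (hh : (248 : ℤ) ∣ ∑ i, h i ^ 2) (γ : SL(2, ℤ))
    (hγ : (124 : ℤ) ∣ γ.1 1 0) :
    levelQuot h ∣[(1 : ℤ)] γ = levelQuot fun i ↦ γ.1 0 0 * h i := by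
  obtain ⟨c, hc⟩ := hγ
  have hdet := Matrix.det_fin_two γ.1
  rw [γ.2] at hdet
  let γ' : SL(2, ℤ) := ⟨!![γ.1 0 0, 124 * γ.1 0 1; c, γ.1 1 1], by
    rw [Matrix.det_fin_two_of]; rw [hc] at hdet; linarith⟩
  ext τ
  have h1 := thetaQuot_scale_slash (charMat h) γ γ' (N := 124) (A := 124) (B := 0) (D := 1)
    (by norm_num) (by norm_num) (by simp [γ', mul_comm]) (by simp [γ'])
    (by simp [γ', hc, mul_comm]) (by simp [γ']) τ
  rw [levelQuot_def, h1]
  simp only [levelQuot, thetaQuot]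
  push_cast
  rw [add_zero, div_one, div_one]
  congr 2
  have h2 (i : Fin 11) : thetaChar ((charMat h * realMat γ') i 0)
      ((charMat h * realMat γ') i 1) (124 * τ) =
      cexp (π * I * (γ.1 0 1 * h i + γ.1 0 0 * γ.1 0 1 * (h i) ^ 2 / 124)) *
        thetaChar (charMat (fun i ↦ γ.1 0 0 * h i) i 0)
          (charMat (fun i ↦ γ.1 0 0 * h i) i 1) (124 * τ) := by
    have e0 : (charMat h * realMat γ') i 0 = charMat (fun i ↦ γ.1 0 0 * h i) i 0 := by
      rw [charMat_mul_zero]; simp [charMat, γ', mul_comm]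
    have e1 : (charMat h * realMat γ') i 1 =
        charMat (fun i ↦ γ.1 0 0 * h i) i 1 + (γ.1 0 1 * h i : ℤ) := by
      rw [charMat_mul_one]; simp [charMat, γ']; ring
    rw [e0, e1, thetaChar_snd_add_int]
    congr 3
    simp [charMat]
    ring
  rw [Finset.prod_congr rfl fun i _ ↦ h2 i, Finset.prod_mul_distrib, ← Complex.exp_sum,
    ← Finset.mul_sum, Finset.sum_add_distrib, ← Finset.mul_sum, ← Finset.sum_div,
    ← Finset.mul_sum]
  obtain ⟨k, hk⟩ := hh
  obtain ⟨l, hl⟩ := even_sum_of_sq ⟨k, hk⟩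
  have hk' : ∑ i, (h i : ℂ) ^ 2 = 248 * k := by exact_mod_cast hk
  have hl' : ∑ i, (h i : ℂ) = l + l := by exact_mod_cast hl
  rw [hk', hl', Complex.exp_eq_one_iff.2 ⟨γ.1 0 1 * l + γ.1 0 0 * γ.1 0 1 * k, by
    push_cast; ring⟩, one_mul]

lemma levelQuot_add (h t : Fin 11 → ℤ) :
    levelQuot (fun i ↦ h i + 124 * t i) = (-1 : ℂ) ^ (∑ i, t i) • levelQuot h := by
  ext τ
  have h2 (i : Fin 11) : thetaChar (charMat (fun i ↦ h i + 124 * t i) i 0)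
      (charMat (fun i ↦ h i + 124 * t i) i 1) (124 * τ) =
      (-1) ^ t i * thetaChar (charMat h i 0) (charMat h i 1) (124 * τ) := by
    rw [show charMat (fun i ↦ h i + 124 * t i) i 0 = charMat h i 0 + (t i : ℤ) by
      simp [charMat]; ring, show charMat (fun i ↦ h i + 124 * t i) i 1 = 0 by simp [charMat],
      show charMat h i 1 = 0 by simp [charMat], thetaChar_fst_add_int]
  have h3 (s : Finset (Fin 11)) : ∏ i ∈ s, (-1 : ℂ) ^ t i = (-1) ^ ∑ i ∈ s, t i := by
    induction s using Finset.cons_induction with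
    | empty => simp
    | cons a s ha ih => rw [Finset.prod_cons, Finset.sum_cons, ih, zpow_add₀ (by norm_num)]
  simp only [levelQuot, thetaQuot, Pi.smul_apply, smul_eq_mul, h2, Finset.prod_mul_distrib, h3]
  ring

/-- The Euler product `∏ (1 - q ^ n)`. -/
noncomputable def eulerProd (q : ℂ) : ℂ := ∏' n : ℕ, (1 - q ^ (n + 1))

lemma eta_eq_eulerProd (τ : ℂ) :
    η τ = cexp (π * I / 12 * τ) * eulerProd (cexp (2 * π * I * τ)) := by
  simp only [ModularForm.eta, eulerProd, eta_q_eq_pow, Function.Periodic.qParam]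
  congr 2
  push_cast
  ring

lemma eulerProd_pow_inv_sub_one_isBigO (k : ℕ) :
    (fun q ↦ (eulerProd q ^ k)⁻¹ - 1) =O[𝓝 0] fun q ↦ q := by
  have h0 : eulerProd 0 = 1 := by simp [eulerProd]
  have h1 : DifferentiableAt ℂ (fun q ↦ (eulerProd q ^ k)⁻¹) 0 :=
    ((differentiableOn_tprod_one_sub_pow.differentiableAt
      (Metric.ball_mem_nhds 0 one_pos)).pow k).inv (by
        change eulerProd 0 ^ k ≠ 0
        rw [h0, one_pow]; exact one_ne_zero)
  simpa [h0] using h1.isBigO_sub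

lemma exists_norm_thetaQuot_le (M : Matrix (Fin 11) (Fin 2) ℝ) (m : Fin 11 → ℝ)
    (hm : ∀ i (n : ℤ), m i ≤ (n + 1 / 2 + M i 0) ^ 2) :
    ∃ C Y : ℝ, ∀ τ : ℂ, Y ≤ τ.im →
      ‖thetaQuot M τ‖ ≤ C * rexp (-π * (∑ i, m i - 3 / 4) * τ.im) := by
  have h1 (i : Fin 11) : ∃ C : ℝ, ∀ τ : ℂ, 1 ≤ τ.im →
      ‖thetaChar (M i 0) (M i 1) τ‖ ≤ C * rexp (-π * m i * τ.im) := by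
    simpa using exists_norm_thetaChar_sub_sum_le (M i 0) (M i 1) ∅ (μ := m i)
      fun n _ ↦ hm i n
  choose C hC using h1
  obtain ⟨K, hK⟩ := (eulerProd_pow_inv_sub_one_isBigO 9).bound
  obtain ⟨ε, hε, hball⟩ := Metric.eventually_nhds_iff.1 hK
  have hev : ∀ᶠ y : ℝ in atTop, rexp (-(2 * π) * y) < min ε 1 := by
    have : Tendsto (fun y : ℝ ↦ rexp (-(2 * π) * y)) atTop (𝓝 0) :=
      Real.tendsto_exp_atBot.comp (tendsto_id.const_mul_atTop_of_neg (by linarith [Real.pi_pos]))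
    exact this.eventually (gt_mem_nhds (by positivity))
  obtain ⟨Y, hY⟩ := eventually_atTop.1 hev
  refine ⟨(∏ i, C i) * (|K| + 1), max Y 1, fun τ hτ ↦ ?_⟩
  have hτ1 : 1 ≤ τ.im := (le_max_right _ _).trans hτ
  have hq : ‖cexp (2 * π * I * τ)‖ = rexp (-(2 * π) * τ.im) := by
    rw [Complex.norm_exp]; congr 1; simp
  have hqY := hY τ.im ((le_max_left _ _).trans hτ)
  have hb := hball (y := cexp (2 * π * I * τ)) (by
    rw [dist_zero_right, hq]; exact hqY.trans_le (min_le_left _ _))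
  have he : ‖(η τ ^ 9)⁻¹‖ ≤ (|K| + 1) * rexp (π * (3 / 4) * τ.im) := by
    rw [eta_eq_eulerProd, mul_pow, mul_inv, norm_mul, mul_comm, ← Complex.exp_nat_mul,
      ← Complex.exp_neg, Complex.norm_exp]
    have h2 : (-((9 : ℕ) * (π * I / 12 * τ))).re = π * (3 / 4) * τ.im := by
      have : (-((9 : ℕ) * (π * I / 12 * τ))) = ((-(π * (3 / 4)) : ℝ) : ℂ) * (τ * I) := by
        push_cast; ring
      rw [this, Complex.re_ofReal_mul, Complex.mul_I_re]; ring
    rw [h2]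
    gcongr
    have h3 : ‖(eulerProd (cexp (2 * π * I * τ)) ^ 9)⁻¹‖ ≤
        ‖(eulerProd (cexp (2 * π * I * τ)) ^ 9)⁻¹ - 1‖ + 1 := by
      have := norm_add_le ((eulerProd (cexp (2 * π * I * τ)) ^ 9)⁻¹ - 1) 1
      rwa [sub_add_cancel, norm_one] at this
    refine h3.trans (by
      gcongr
      refine hb.trans ?_
      have : ‖cexp (2 * π * I * τ)‖ ≤ 1 := by
        rw [hq]; exact (hqY.trans_le (min_le_right _ _)).le
      calc _ ≤ |K| * ‖cexp (2 * π * I * τ)‖ := by gcongr; exact le_abs_self K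
        _ ≤ |K| * 1 := by gcongr
        _ = _ := mul_one _)
  have hp : ‖∏ i, thetaChar (M i 0) (M i 1) τ‖ ≤
      (∏ i, C i) * rexp (-π * (∑ i, m i) * τ.im) := by
    rw [norm_prod]
    refine (Finset.prod_le_prod (fun _ _ ↦ norm_nonneg _) fun i _ ↦ hC i τ hτ1).trans_eq ?_
    rw [Finset.prod_mul_distrib, ← Real.exp_sum, ← Finset.sum_mul, ← Finset.mul_sum]
  rw [thetaQuot, neg_div, norm_neg, div_eq_mul_inv, norm_mul]
  refine (mul_le_mul hp he (norm_nonneg _) ((norm_nonneg _).trans hp)).trans_eq ?_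
  rw [mul_mul_mul_comm, ← Real.exp_add]
  congr 2
  ring

/-- The quadratic form controlling the order of vanishing of `levelQuot h` at a cusp. -/
def cuspSum (h : Fin 11 → ℤ) (A a : ℤ) : ℤ := ∑ i, (2 * ((h i * a) % A) - A) ^ 2

lemma sq_le_of_emod {A : ℤ} (hA : 0 < A) (k n : ℤ) :
    ((2 * ((k % A : ℤ) : ℝ) - A) / (2 * A)) ^ 2 ≤ (n + 1 / 2 + (k : ℝ) / A) ^ 2 := by
  have hA' : (0 : ℝ) < A := by exact_mod_cast hA
  have h1 : (n : ℝ) + 1 / 2 + (k : ℝ) / A = (2 * k + (2 * n + 1) * A) / (2 * A) := by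
    field_simp
    ring
  rw [h1, div_pow, div_pow]
  refine div_le_div_of_nonneg_right ?_ (by positivity)
  have h2 : (2 * (k % A) - A) ^ 2 ≤ (2 * k + (2 * n + 1) * A) ^ 2 := by
    have h3 := Int.emod_add_mul_ediv k A
    have h4 := Int.emod_nonneg k hA.ne'
    have h5 := Int.emod_lt_of_pos k hA
    set r := k % A
    set t := k / A
    rw [← h3]
    rcases lt_trichotomy (n + t) (-1) with h | h | h
    · nlinarith [mul_nonneg (by linarith : 0 ≤ -(n + t) - 2) hA.le, mul_pos hA hA]
    · have : n = -1 - t := by linarith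
      rw [this]; apply le_of_eq; ring
    · nlinarith [mul_nonneg (by linarith : 0 ≤ n + t) hA.le, mul_pos hA hA]
  exact_mod_cast h2

lemma exists_levelQuot_slash_isBigO (h : Fin 11 → ℤ) (γ : SL(2, ℤ))
    (hγ : ¬ (124 : ℤ) ∣ γ.1 1 0) :
    ∃ A : ℤ, A ∈ ({1, 2, 4, 31, 62} : Finset ℤ) ∧ IsCoprime (γ.1 0 0) A ∧ ∃ κ : ℝ, 0 < κ ∧
      (levelQuot h ∣[(1 : ℤ)] γ) =O[atImInfty]
        fun τ : ℍ ↦ rexp (-κ * (cuspSum h A (γ.1 0 0) - 3 * A ^ 2) * τ.im) := by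
  set a := γ.1 0 0 with ha
  set c := γ.1 1 0 with hc
  obtain ⟨A, hAdef⟩ : ∃ A : ℤ, A = Int.gcd c 124 := ⟨_, rfl⟩
  have hA0 : 0 < A := by
    rw [hAdef]; exact_mod_cast Int.gcd_pos_of_ne_zero_right c (by norm_num)
  obtain ⟨D, hD⟩ : A ∣ 124 := hAdef ▸ Int.gcd_dvd_right c 124
  obtain ⟨c', hc'⟩ : A ∣ c := hAdef ▸ Int.gcd_dvd_left c 124
  have hD0 : 0 < D := by
    by_contra hn
    nlinarith
  have hdet : a * γ.1 1 1 - γ.1 0 1 * c = 1 := by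
    have := Matrix.det_fin_two γ.1
    rw [γ.2] at this
    exact this.symm
  have hac : IsCoprime a c := ⟨γ.1 1 1, -γ.1 0 1, by linarith⟩
  have hAmem : A ∈ ({1, 2, 4, 31, 62} : Finset ℤ) := by
    have h1 : A ≠ 124 := by rintro rfl; exact hγ ⟨c', hc'⟩
    have h2 : A ∣ 124 := ⟨D, hD⟩
    have h3 : A ≤ 124 := Int.le_of_dvd (by norm_num) h2
    clear_value a c
    clear hAdef hc'
    have : ∀ x ∈ Finset.Icc (1 : ℤ) 124, x ≠ 124 → x ∣ 124 →
      x ∈ ({1, 2, 4, 31, 62} : Finset ℤ) := by decide +kernel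
    exact this A (Finset.mem_Icc.2 ⟨hA0, h3⟩) h1 h2
  have hDc : IsCoprime D c' := by
    have := Int.isCoprime_iff_gcd_eq_one.2 (Int.gcd_ediv_gcd_ediv_gcd (i := c) (j := 124)
      (Int.gcd_pos_of_ne_zero_right c (by norm_num)))
    rw [← hAdef, hc', hD, Int.mul_ediv_cancel_left _ hA0.ne',
      Int.mul_ediv_cancel_left _ hA0.ne'] at this
    exact this.symm
  have hac' : IsCoprime a c' := hac.of_isCoprime_of_dvd_right ⟨A, by rw [hc', mul_comm]⟩
  obtain ⟨d0, b0, hbez⟩ := hac'.mul_left hDc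
  let γ' : SL(2, ℤ) := ⟨!![a * D, -b0; c', d0], by
    rw [Matrix.det_fin_two_of]; linarith⟩
  refine ⟨A, hAmem, hac.of_isCoprime_of_dvd_right ⟨c', hc'⟩, ?_⟩
  have hA' : (0 : ℝ) < A := by exact_mod_cast hA0
  have hD' : (0 : ℝ) < D := by exact_mod_cast hD0
  have hAD : (A : ℝ) * D = 124 := by exact_mod_cast hD.symm
  obtain ⟨C, Y, hCY⟩ := exists_norm_thetaQuot_le (charMat h * realMat γ')
    (fun i ↦ ((2 * ((h i * a % A : ℤ) : ℝ) - A) / (2 * A)) ^ 2) fun i n ↦ by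
      have := sq_le_of_emod hA0 (h i * a) n
      convert! this using 3
      rw [charMat_mul_zero, ← hAD]
      simp [γ']
      field_simp
  refine ⟨π / (4 * A * D), by positivity, ?_⟩
  refine IsBigO.of_bound (C / D) ?_
  have hmem : {τ : ℍ | Y * D / A ≤ τ.im} ∈ atImInfty :=
    (atImInfty_mem _).2 ⟨_, fun z hz ↦ hz⟩
  filter_upwards [hmem] with τ hτ
  have h1 := thetaQuot_scale_slash (charMat h) γ γ' (N := 124) (A := A)
    (B := d0 * (124 * γ.1 0 1) + b0 * γ.1 1 1) (D := D) hA0 hD0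
    (by rw [hD, ← ha]; simp [γ']; ring)
    (by
      simp only [γ', Matrix.of_apply, Matrix.cons_val', Matrix.cons_val_zero, Matrix.cons_val_one,
        Matrix.cons_val_fin_one]
      rw [hc'] at hdet
      rw [hD]
      linear_combination (-A * D * γ.1 0 1) * hbez + (-D * b0) * hdet)
    (by rw [← hc, hc']; simp [γ', mul_comm])
    (by
      simp only [γ', Matrix.of_apply, Matrix.cons_val', Matrix.cons_val_zero, Matrix.cons_val_one,
        Matrix.cons_val_fin_one]
      rw [hc'] at hdet
      rw [hD]
      linear_combination (-γ.1 1 1) * hbez + D * d0 * hdet) τ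
  rw [levelQuot_def, h1, norm_div]
  have him : (((A : ℂ) * τ + (d0 * (124 * γ.1 0 1) + b0 * γ.1 1 1 : ℤ)) / D).im = A / D * τ.im := by
    have : ((A : ℂ) * τ + (d0 * (124 * γ.1 0 1) + b0 * γ.1 1 1 : ℤ)) / D = ((A / D : ℝ) : ℂ) * τ +
      ((((d0 * (124 * γ.1 0 1) + b0 * γ.1 1 1 : ℤ) : ℝ) / D : ℝ) : ℂ) := by push_cast; ring
    rw [this, Complex.add_im, Complex.im_ofReal_mul, Complex.ofReal_im, add_zero]
    rfl
  have h2 := hCY (((A : ℂ) * τ + (d0 * (124 * γ.1 0 1) + b0 * γ.1 1 1 : ℤ)) / D) (by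
    rw [him]
    have h3 : Y * D / A ≤ τ.im := hτ
    rw [div_le_iff₀ hA'] at h3
    rw [div_mul_eq_mul_div, le_div_iff₀ hD']
    linarith)
  rw [him] at h2
  rw [Complex.norm_intCast, abs_of_pos hD', Real.norm_eq_abs, Real.abs_exp, div_mul_eq_mul_div]
  gcongr
  refine h2.trans_eq ?_
  congr 2
  simp only [div_pow, ← Finset.sum_div, cuspSum]
  push_cast
  field_simp
  ring

section

/-- The nome `q = exp (2 π i τ)`. -/
noncomputable def nome (τ : ℍ) : ℂ := cexp (2 * π * I * τ)

lemma nome_ne_zero (τ : ℍ) : nome τ ≠ 0 := Complex.exp_ne_zero _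

lemma norm_nome (τ : ℍ) : ‖nome τ‖ = rexp (-(2 * π) * τ.im) := by
  rw [nome, Complex.norm_exp]; congr 1; simp

lemma tendsto_nome : Tendsto nome atImInfty (𝓝 0) := by
  refine (qParam_tendsto_atImInfty one_pos).congr fun τ ↦ ?_
  simp [nome, Function.Periodic.qParam]

/-- `f` agrees with the polynomial `P` in `q` up to an error `O(q ^ L)` at `i∞`. -/
def QApprox (f : ℍ → ℂ) (P : ℂ[X]) (L : ℕ) : Prop :=
  (fun τ ↦ f τ - P.eval (nome τ)) =O[atImInfty] fun τ ↦ nome τ ^ L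

lemma isBigO_eval_nome (P : ℂ[X]) :
    (fun τ ↦ P.eval (nome τ)) =O[atImInfty] fun _ ↦ (1 : ℂ) :=
  ((P.continuous.tendsto 0).comp tendsto_nome).isBigO_one ℂ

lemma isBigO_nome_pow (k : ℕ) : (fun τ ↦ nome τ ^ k) =O[atImInfty] fun _ ↦ (1 : ℂ) :=
  ((tendsto_nome.pow k)).isBigO_one ℂ

lemma qApprox_eval (P : ℂ[X]) (L : ℕ) : QApprox (fun τ ↦ P.eval (nome τ)) P L := by
  simp [QApprox, isBigO_zero]

lemma qApprox_nome_pow (k L : ℕ) : QApprox (fun τ ↦ nome τ ^ k) (X ^ k) L := by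
  simp [QApprox, isBigO_zero]

namespace QApprox

variable {f g : ℍ → ℂ} {P Q : ℂ[X]} {L : ℕ}

lemma isBigO_one (h : QApprox f P L) : f =O[atImInfty] fun _ ↦ (1 : ℂ) := by
  simpa using (IsBigO.trans h (isBigO_nome_pow L)).add (isBigO_eval_nome P)

lemma add (hf : QApprox f P L) (hg : QApprox g Q L) :
    QApprox (fun τ ↦ f τ + g τ) (P + Q) L := by
  refine (IsBigO.add hf hg).congr_left fun τ ↦ ?_
  rw [eval_add]; ring

lemma const_mul (c : ℂ) (hf : QApprox f P L) : QApprox (fun τ ↦ c * f τ) (C c * P) L := by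
  refine (IsBigO.const_mul_left hf c).congr_left fun τ ↦ ?_
  rw [eval_mul, eval_C]; ring

lemma sum {ι : Type*} (s : Finset ι) {f : ι → ℍ → ℂ} {P : ι → ℂ[X]}
    (h : ∀ i ∈ s, QApprox (f i) (P i) L) :
    QApprox (fun τ ↦ ∑ i ∈ s, f i τ) (∑ i ∈ s, P i) L := by
  refine (IsBigO.fun_sum h).congr_left fun τ ↦ ?_
  rw [Finset.sum_sub_distrib, eval_finsetSum]

lemma mul (hf : QApprox f P L) (hg : QApprox g Q L) :
    QApprox (fun τ ↦ f τ * g τ) (P * Q) L := by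
  have h1 := IsBigO.mul hf hg.isBigO_one
  have h2 := IsBigO.mul (isBigO_eval_nome P) hg
  simp only [mul_one, one_mul] at h1 h2
  refine (h1.add h2).congr_left fun τ ↦ ?_
  rw [eval_mul]; ring

lemma prod {ι : Type*} (s : Finset ι) {f : ι → ℍ → ℂ} {P : ι → ℂ[X]}
    (h : ∀ i ∈ s, QApprox (f i) (P i) L) :
    QApprox (fun τ ↦ ∏ i ∈ s, f i τ) (∏ i ∈ s, P i) L := by
  induction s using Finset.cons_induction with
  | empty => simpa using qApprox_eval (1 : ℂ[X]) L
  | cons a s ha ih =>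
    simp only [Finset.prod_cons]
    exact (h a (by simp)).mul (ih fun i hi ↦ h i (by simp [hi]))

lemma mono {L' : ℕ} (hL : L' ≤ L) (h : QApprox f P L) : QApprox f P L' := by
  refine IsBigO.trans h ?_
  obtain ⟨k, rfl⟩ := Nat.exists_eq_add_of_le hL
  simpa [pow_add] using (isBigO_refl (fun τ ↦ nome τ ^ L') atImInfty).mul (isBigO_nome_pow k)

lemma congr_poly (h : QApprox f P L) (hPQ : X ^ L ∣ P - Q) : QApprox f Q L := by
  obtain ⟨R, hR⟩ := hPQ
  have h1 : (fun τ ↦ (P - Q).eval (nome τ)) =O[atImInfty] fun τ ↦ nome τ ^ L := by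
    simpa [hR] using (isBigO_refl (fun τ ↦ nome τ ^ L) atImInfty).mul (isBigO_eval_nome R)
  refine (IsBigO.add h h1).congr_left fun τ ↦ ?_
  rw [eval_sub]; ring

lemma neBot_atImInfty : (atImInfty).NeBot := by
  refine (atImInfty_basis.neBot_iff).2 fun {A} _ ↦ ?_
  exact ⟨⟨(|A| + 1 : ℝ) * I, by simp; positivity⟩, by
    simp only [Set.mem_preimage, Set.mem_Ici, ← UpperHalfPlane.coe_im]
    simp
    linarith [le_abs_self A]⟩

lemma coeff_eq_zero (h : QApprox (fun _ ↦ 0) P L) {n : ℕ} (hn : n < L) : P.coeff n = 0 := by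
  have := neBot_atImInfty
  induction n using Nat.strong_induction_on with
  | _ n ih =>
    have hX : X ^ n ∣ P := X_pow_dvd_iff.2 fun d hd ↦ ih d hd (hd.trans hn)
    obtain ⟨R, rfl⟩ := hX
    rw [coeff_X_pow_mul', if_pos le_rfl, Nat.sub_self, coeff_zero_eq_eval_zero]
    have h1 : (fun τ ↦ R.eval (nome τ)) =O[atImInfty] fun τ ↦ nome τ ^ (L - n) := by
      have h2 := IsBigO.mul (isBigO_refl (fun τ ↦ (nome τ ^ n)⁻¹) atImInfty) h
      refine h2.neg_left.congr' (.of_forall fun τ ↦ ?_) (.of_forall fun τ ↦ ?_)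
      · have := pow_ne_zero n (nome_ne_zero τ)
        simp [this]
      · have := pow_ne_zero n (nome_ne_zero τ)
        simp only
        rw [← Nat.add_sub_of_le hn.le, pow_add, Nat.add_sub_cancel_left]
        field_simp
    have h2 : Tendsto (fun τ ↦ nome τ ^ (L - n)) atImInfty (𝓝 0) := by
      simpa [zero_pow (Nat.sub_pos_of_lt hn).ne'] using tendsto_nome.pow (L - n)
    exact tendsto_nhds_unique ((R.continuous.tendsto 0).comp tendsto_nome) (h1.trans_tendsto h2)

lemma coeff_eq (hf : QApprox f P L) (hg : QApprox f Q L) {n : ℕ} (hn : n < L) :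
    P.coeff n = Q.coeff n := by
  have h := hf.add (hg.const_mul (-1))
  have h1 : QApprox (fun _ ↦ 0) (P + C (-1) * Q) L := by
    simpa using h
  have := h1.coeff_eq_zero hn
  rw [coeff_add, coeff_C_mul] at this
  linear_combination this

end QApprox

lemma isBigO_exp_nome {c : ℝ} {L : ℕ} (h : 2 * π * L ≤ c) :
    (fun τ : ℍ ↦ rexp (-c * τ.im)) =O[atImInfty] fun τ ↦ nome τ ^ L := by
  refine IsBigO.of_bound 1 (.of_forall fun τ ↦ ?_)
  rw [norm_pow, norm_nome, ← Real.exp_nat_mul, Real.norm_eq_abs, Real.abs_exp, one_mul]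
  refine Real.exp_le_exp.2 ?_
  nlinarith [mul_le_mul_of_nonneg_right h τ.im_pos.le]

lemma qApprox_thetaChar (r : ℕ) (hr : r ≤ 124) :
    QApprox (fun τ ↦ -cexp (-(2 * π * I * ((62 - r) ^ 2 / 248 : ℝ) * τ)) *
      thetaChar (r / 124) 0 (124 * τ)) (1 - X ^ r - X ^ (124 - r)) 33 := by
  have hr' : (r : ℝ) ≤ 124 := by exact_mod_cast hr
  have hμ : ∀ n ∉ ({0, -1, -2} : Finset ℤ),
      (((62 - r) ^ 2 + 33 * 248) / 124 ^ 2 : ℝ) ≤ (n + 1 / 2 + r / 124) ^ 2 := fun n hn ↦ by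
    rw [div_le_iff₀ (by norm_num), ← mul_pow]
    have h2 : ((n : ℝ) + 1 / 2 + r / 124) * 124 = 124 * n + 62 + r := by ring
    rw [h2]
    have hr0 : (0 : ℝ) ≤ r := by positivity
    simp only [Finset.mem_insert, Finset.mem_singleton, not_or] at hn
    have h3 : 1 ≤ n ∨ n ≤ -3 := by omega
    rcases h3 with h | h
    · have : (1 : ℝ) ≤ n := by exact_mod_cast h
      nlinarith
    · have : (n : ℝ) ≤ -3 := by exact_mod_cast h
      nlinarith
  obtain ⟨C, hC⟩ := exists_norm_thetaChar_sub_sum_le (r / 124) 0 _ hμ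
  have hb : (fun τ : ℍ ↦ -cexp (-(2 * π * I * ((62 - r) ^ 2 / 248 : ℝ) * τ)) *
      (thetaChar (r / 124) 0 (124 * τ) -
        ∑ n ∈ ({0, -1, -2} : Finset ℤ), thetaTerm (r / 124) 0 n (124 * τ))) =O[atImInfty]
      fun τ : ℍ ↦ rexp (-(2 * π * (33 : ℕ)) * τ.im) := by
    refine IsBigO.of_bound C ?_
    filter_upwards [(atImInfty_mem {τ : ℍ | 1 ≤ τ.im}).2 ⟨1, fun z hz ↦ hz⟩] with τ hτ
    have hτ' : 1 ≤ τ.im := hτ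
    have him : ((124 : ℂ) * τ).im = 124 * τ.im := by
      rw [show (124 : ℂ) = ((124 : ℝ) : ℂ) by norm_num, Complex.im_ofReal_mul]; rfl
    have h1 := hC (124 * τ) (by rw [him]; linarith)
    rw [norm_mul, norm_neg, Complex.norm_exp, Real.norm_eq_abs, Real.abs_exp]
    refine (mul_le_mul_of_nonneg_left h1 (Real.exp_pos _).le).trans_eq ?_
    rw [mul_left_comm, ← Real.exp_add, him]
    congr 2
    have : -(2 * π * I * ((62 - r) ^ 2 / 248 : ℝ) * (τ : ℂ)) =
        ((-(2 * π * ((62 - r) ^ 2 / 248)) : ℝ) : ℂ) * (τ * I) := by push_cast; ring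
    rw [this, Complex.re_ofReal_mul, Complex.mul_I_re, UpperHalfPlane.coe_im]
    push_cast
    ring
  refine ((hb.trans (isBigO_exp_nome le_rfl))).congr_left fun τ ↦ ?_
  rw [mul_sub]
  congr 1
  rw [Finset.sum_insert (by decide), Finset.sum_insert (by decide), Finset.sum_singleton]
  have e (z w : ℂ) (n : ℤ) (h : z = w + n * (2 * π * I)) : cexp z = cexp w :=
    Complex.exp_eq_exp_iff_exists_int.2 ⟨n, h⟩
  have t0 : cexp (-(2 * π * I * ((62 - r) ^ 2 / 248 : ℝ) * τ)) *
      thetaTerm (r / 124) 0 0 (124 * τ) = nome τ ^ r := by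
    rw [thetaTerm, ← Complex.exp_add, nome, ← Complex.exp_nat_mul]
    exact e _ _ 0 (by push_cast; ring)
  have t1 : cexp (-(2 * π * I * ((62 - r) ^ 2 / 248 : ℝ) * τ)) *
      thetaTerm (r / 124) 0 (-1) (124 * τ) = -1 := by
    rw [thetaTerm, ← Complex.exp_add, ← Complex.exp_pi_mul_I]
    exact e _ _ (-1) (by push_cast; ring)
  have t2 : cexp (-(2 * π * I * ((62 - r) ^ 2 / 248 : ℝ) * τ)) *
      thetaTerm (r / 124) 0 (-2) (124 * τ) = nome τ ^ (124 - r) := by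
    rw [thetaTerm, ← Complex.exp_add, nome, ← Complex.exp_nat_mul, Nat.cast_sub hr]
    exact e _ _ (-1) (by push_cast; ring)
  simp only [eval_sub, eval_one, eval_pow, eval_X]
  linear_combination -t0 - t1 - t2

lemma qApprox_eulerProd : QApprox
    (fun τ : ℍ ↦ (eulerProd (nome τ ^ 124) ^ 9)⁻¹) 1 33 := by
  have h1 : Tendsto (fun τ : ℍ ↦ nome τ ^ 124) atImInfty (𝓝 0) := by
    simpa using tendsto_nome.pow 124
  have h2 := (eulerProd_pow_inv_sub_one_isBigO 9).comp_tendsto h1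
  have h3 : (fun τ : ℍ ↦ nome τ ^ 124) =O[atImInfty] fun τ ↦ nome τ ^ 33 := by
    have h4 := (isBigO_refl (fun τ ↦ nome τ ^ 33) atImInfty).mul (isBigO_nome_pow 91)
    simp_rw [← pow_add, mul_one] at h4
    exact h4
  simpa [QApprox, Function.comp_def] using h2.trans h3

/-- The leading part of the `q`-expansion of `q ^ 16 * levelQuot r`. -/
noncomputable def quotPoly (o : ℕ) (r : Fin 11 → ℕ) : ℤ[X] :=
  X ^ o * ∏ i, (1 - X ^ r i - X ^ (124 - r i))

lemma qApprox_levelQuot (o : ℕ) (r : Fin 11 → ℕ) (hr : ∀ i, r i ≤ 124)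
    (ho : (∑ i, (62 - (r i : ℤ)) ^ 2) + 248 * 16 = 3 * 62 ^ 2 + 248 * (o : ℤ)) :
    QApprox (fun τ ↦ nome τ ^ 16 * levelQuot (fun i ↦ r i) τ)
      ((quotPoly o r).map (Int.castRingHom ℂ)) 33 := by
  have h1 := ((qApprox_nome_pow o 33).mul
    (QApprox.prod Finset.univ fun i _ ↦ qApprox_thetaChar (r i) (hr i))).mul qApprox_eulerProd
  rw [mul_one] at h1
  convert! h1 using 2 with τ
  · rw [levelQuot, thetaQuot, Finset.prod_mul_distrib, Finset.prod_neg, ← Complex.exp_sum,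
      eta_eq_eulerProd, show cexp (2 * π * I * (124 * τ)) = nome τ ^ 124 by
        rw [nome, ← Complex.exp_nat_mul]; congr 1; push_cast; ring]
    have h2 (i : Fin 11) : thetaChar (charMat (fun i ↦ (r i : ℤ)) i 0)
        (charMat (fun i ↦ (r i : ℤ)) i 1) (124 * τ) = thetaChar (r i / 124) 0 (124 * τ) := by
      simp [charMat]
    simp only [h2, mul_pow, Finset.card_univ, Fintype.card_fin]
    have h3 : cexp (π * I / 12 * (124 * τ)) ^ 9 * nome τ ^ o *
        cexp (∑ i, -(2 * π * I * ((62 - r i) ^ 2 / 248 : ℝ) * τ)) = nome τ ^ 16 := by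
      rw [nome, ← Complex.exp_nat_mul, ← Complex.exp_nat_mul, ← Complex.exp_nat_mul,
        ← Complex.exp_add, ← Complex.exp_add]
      congr 1
      rw [Finset.sum_neg_distrib, ← Finset.sum_mul, ← Finset.mul_sum]
      have ho' := congrArg (Int.cast : ℤ → ℂ) ho
      push_cast at ho'
      push_cast
      rw [← Finset.sum_div]
      linear_combination (-(2 * π * I) * τ / 248) * ho'
    have h4 : cexp (π * I / 12 * (124 * τ)) ^ 9 ≠ 0 := pow_ne_zero _ (Complex.exp_ne_zero _)
    rw [← h3]
    field_simp
  · simp [quotPoly, Polynomial.map_mul, Polynomial.map_prod]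

end

lemma slash_eq_self_apply {H : ℍ → ℂ} {k : ℤ} {γ : SL(2, ℤ)} (h : H ∣[k] γ = H) (τ : ℍ) :
    H (γ • τ) = ((γ.1 1 0 : ℂ) * τ + γ.1 1 1) ^ k * H τ := by
  have h1 := congr_fun h τ
  rw [SL_slash_apply, ModularGroup.denom_apply] at h1
  have h2 : ((γ.1 1 0 : ℂ) * τ + γ.1 1 1) ≠ 0 := by
    rw [← ModularGroup.denom_apply]; exact UpperHalfPlane.denom_ne_zero _ _
  rw [← h1, zpow_neg]
  field_simp

/-- The translates of a `Γ`-invariant function, indexed by the cosets of `Γ`. -/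
noncomputable def cosetSlash {Γ : Subgroup SL(2, ℤ)} {k : ℤ} {φ : ℍ → ℂ} (h : ∀ γ ∈ Γ, φ ∣[k] γ = φ)
    (q : SL(2, ℤ) ⧸ Γ) : ℍ → ℂ :=
  q.liftOn (fun g ↦ φ ∣[k] g⁻¹) fun a b hab ↦ by
    have hab' : a⁻¹ * b ∈ Γ := QuotientGroup.leftRel_apply.1 hab
    have : a⁻¹ = (a⁻¹ * b) * b⁻¹ := by group
    rw [this, SlashAction.slash_mul, h _ hab']

lemma cosetSlash_slash {Γ : Subgroup SL(2, ℤ)} {k : ℤ} {φ : ℍ → ℂ} (h : ∀ γ ∈ Γ, φ ∣[k] γ = φ)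
    (q : SL(2, ℤ) ⧸ Γ) (γ : SL(2, ℤ)) : cosetSlash h q ∣[k] γ = cosetSlash h (γ⁻¹ • q) := by
  induction q using QuotientGroup.induction_on with
  | H g =>
    change (φ ∣[k] g⁻¹) ∣[k] γ = φ ∣[k] (γ⁻¹ * g)⁻¹
    rw [← SlashAction.slash_mul, mul_inv_rev, inv_inv]

/-- A holomorphic function of weight two and level one with a constant term in its polar
expansion at `i∞` has zero constant term. -/
lemma eq_zero_of_tendsto_sub_sum {H : ℍ → ℂ} (hol : MDiff H) (hS : H ∣[(2 : ℤ)] ModularGroup.S = H)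
    (hT : H ∣[(2 : ℤ)] ModularGroup.T = H) {m : ℕ} {p : ℕ → ℂ} {c : ℂ}
    (hc : Tendsto (fun τ : ℍ ↦ H τ - ∑ k ∈ Finset.range m,
      p k * cexp (2 * π * I * ((k : ℂ) - m) * τ)) atImInfty (𝓝 c)) : c = 0 := by
  have hU : Convex ℝ {z : ℂ | 0 < z.im} := convex_halfSpace_im_gt 0
  have hUo : IsOpen {z : ℂ | 0 < z.im} := isOpen_upperHalfPlaneSet
  obtain ⟨G, hG⟩ := hU.exists_forall_hasDerivWithinAt (UpperHalfPlane.mdifferentiable_iff.1 hol)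
  have hG' (τ : ℍ) : HasDerivAt G (H τ) τ := by
    simpa using (hG τ τ.im_pos).hasDerivAt (hUo.mem_nhds τ.im_pos)
  have key (γ : SL(2, ℤ)) (hγ : H ∣[(2 : ℤ)] γ = H) (z₀ : ℍ) (hz₀ : γ • z₀ = z₀) (τ : ℍ) :
      G ((γ • τ : ℍ) : ℂ) = G τ := by
    have hden (τ : ℍ) : ((γ.1 1 0 : ℂ) * τ + γ.1 1 1) ≠ 0 := by
      rw [← ModularGroup.denom_apply]; exact UpperHalfPlane.denom_ne_zero _ _
    have hdet : (γ.1 0 0 : ℂ) * γ.1 1 1 - γ.1 0 1 * γ.1 1 0 = 1 := by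
      have := γ.det_coe
      rw [Matrix.det_fin_two] at this
      exact_mod_cast this
    have hd (τ : ℍ) : HasDerivAt (fun z : ℂ ↦
        G (((γ.1 0 0 : ℂ) * z + γ.1 0 1) / ((γ.1 1 0 : ℂ) * z + γ.1 1 1)) - G z) 0 τ := by
      have h1 : HasDerivAt (fun z : ℂ ↦
          ((γ.1 0 0 : ℂ) * z + γ.1 0 1) / ((γ.1 1 0 : ℂ) * z + γ.1 1 1))
          ((γ.1 0 0 * ((γ.1 1 0 : ℂ) * τ + γ.1 1 1) - ((γ.1 0 0 : ℂ) * τ + γ.1 0 1) * γ.1 1 0) /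
            ((γ.1 1 0 : ℂ) * τ + γ.1 1 1) ^ 2) τ := by
        have ha (a b : ℂ) : HasDerivAt (fun z : ℂ ↦ a * z + b) a τ := by
          simpa using ((hasDerivAt_id (τ : ℂ)).const_mul a).add_const b
        exact (ha _ _).div (ha _ _) (hden τ)
      have h2 := hG' (γ • τ)
      rw [coe_smul_eq] at h2
      refine ((h2.comp (τ : ℂ) h1).sub (hG' τ)).congr_deriv ?_
      rw [slash_eq_self_apply hγ]
      have h3 : (γ.1 0 0 * ((γ.1 1 0 : ℂ) * τ + γ.1 1 1) -
          ((γ.1 0 0 : ℂ) * τ + γ.1 0 1) * γ.1 1 0) = 1 := by linear_combination hdet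
      rw [h3, zpow_ofNat]
      have := hden τ
      field_simp
      ring
    have h4 := hU.is_const_of_fderivWithin_eq_zero (𝕜 := ℂ) (f := fun z : ℂ ↦
        G (((γ.1 0 0 : ℂ) * z + γ.1 0 1) / ((γ.1 1 0 : ℂ) * z + γ.1 1 1)) - G z)
        (fun z hz ↦ (hd ⟨z, hz⟩).differentiableAt.differentiableWithinAt)
        (fun z hz ↦ by
          rw [fderivWithin_of_isOpen hUo hz]
          have := (hd ⟨z, hz⟩).hasFDerivAt.fderiv
          simpa using! this) τ.im_pos z₀.im_pos
    simp only [← coe_smul_eq, hz₀, sub_self] at h4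
    exact sub_eq_zero.1 h4
  have hperiod (τ : ℍ) : G (τ + 1) = G τ := by
    have h1 := key ModularGroup.S hS UpperHalfPlane.I (by
      ext; rw [coe_smul_eq]; simp [ModularGroup.S])
    have h2 := key (ModularGroup.T * ModularGroup.S)
      (by rw [SlashAction.slash_mul, hT, hS]) ⟨(1 / 2 : ℂ) + (√3 / 2 : ℝ) * I, by simp⟩ (by
      ext
      have e : (ModularGroup.T * ModularGroup.S).1 = !![1, -1; 1, 0] := by decide
      rw [coe_smul_eq, e]
      have h3 : ((√3 : ℝ) : ℂ) ^ 2 = 3 := by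
        rw [← Complex.ofReal_pow, Real.sq_sqrt (by norm_num)]; norm_num
      have h5 : ((1 / 2 : ℂ) + (√3 / 2 : ℝ) * I) ≠ 0 := fun h ↦ by
        have := congrArg Complex.re h
        simp at this
      simp only [Matrix.of_apply, Matrix.cons_val', Matrix.cons_val_zero, Matrix.cons_val_one,
        Matrix.cons_val_fin_one, Int.cast_one, Int.cast_zero, Int.cast_neg, one_mul, add_zero]
      rw [div_eq_iff h5]
      push_cast
      linear_combination (-1 / 4 * I ^ 2) * h3 - 3 / 4 * Complex.I_sq)
    have h3 := h2 (ModularGroup.S⁻¹ • τ)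
    rw [← h1 (ModularGroup.S⁻¹ • τ), mul_smul, smul_inv_smul, UpperHalfPlane.modular_T_smul,
      UpperHalfPlane.coe_vadd, Complex.ofReal_one, add_comm] at h3
    exact h3
  by_contra hc0
  have hc' : 0 < ‖c‖ / 2 := by positivity
  obtain ⟨A, hA⟩ := UpperHalfPlane.atImInfty_mem _ |>.1 (Metric.tendsto_nhds.1 hc _ hc')
  have ha (k : ℕ) (hk : k ∈ Finset.range m) : 2 * π * I * ((k : ℂ) - m) ≠ 0 := by
    refine mul_ne_zero two_pi_I_ne_zero (sub_ne_zero.2 ?_)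
    exact_mod_cast (Finset.mem_range.1 hk).ne
  let K : ℂ → ℂ := fun z ↦ G z - ∑ k ∈ Finset.range m,
    p k / (2 * π * I * ((k : ℂ) - m)) * cexp (2 * π * I * ((k : ℂ) - m) * z) - c * z
  have hK (τ : ℍ) : HasDerivAt K (H τ - ∑ k ∈ Finset.range m,
      p k * cexp (2 * π * I * ((k : ℂ) - m) * τ) - c) τ := by
    have h1 : HasDerivAt (fun z : ℂ ↦ ∑ k ∈ Finset.range m,
        p k / (2 * π * I * ((k : ℂ) - m)) * cexp (2 * π * I * ((k : ℂ) - m) * z))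
        (∑ k ∈ Finset.range m, p k * cexp (2 * π * I * ((k : ℂ) - m) * τ)) τ := by
      refine HasDerivAt.fun_sum fun k hk ↦ ?_
      have h2 : HasDerivAt (fun z : ℂ ↦ 2 * π * I * ((k : ℂ) - m) * z)
          (2 * π * I * ((k : ℂ) - m)) τ := by
        simpa using (hasDerivAt_id (τ : ℂ)).const_mul (2 * π * I * ((k : ℂ) - m))
      refine (h2.cexp.const_mul _).congr_deriv ?_
      rw [mul_comm (cexp _), ← mul_assoc, div_mul_cancel₀ _ (ha k hk)]
    have h3 : HasDerivAt (fun z : ℂ ↦ c * z) c τ := by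
      simpa using (hasDerivAt_id (τ : ℂ)).const_mul c
    exact ((hG' τ).sub h1).sub h3
  have hK1 (τ : ℍ) : K (τ + 1) - K τ = -c := by
    have h1 (k : ℕ) : cexp (2 * π * I * ((k : ℂ) - m) * (τ + 1)) =
        cexp (2 * π * I * ((k : ℂ) - m) * τ) :=
      Complex.exp_eq_exp_iff_exists_int.2 ⟨(k : ℤ) - m, by push_cast; ring⟩
    simp only [K, h1, hperiod]
    ring
  have hV : Convex ℝ {z : ℂ | max A 0 < z.im} := convex_halfSpace_im_gt _
  let τ₀ : ℍ := ⟨(max A 0 + 1 : ℝ) * I, by simp; positivity⟩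
  have hτ₀ : (τ₀ : ℂ).im = max A 0 + 1 := by simp [τ₀]
  have h1 := hV.norm_image_sub_le_of_norm_hasDerivWithin_le (f := K) (f' := fun z ↦
      H (ofComplex z) - ∑ k ∈ Finset.range m, p k * cexp (2 * π * I * ((k : ℂ) - m) * z) - c)
    (C := ‖c‖ / 2) (x := τ₀) (y := τ₀ + 1) (fun z hz ↦ ?_) (fun z hz ↦ ?_)
    (by simp only [Set.mem_ofPred_eq]; linarith)
    (by simp only [Set.mem_ofPred_eq, Complex.add_im, Complex.one_im]; linarith)
  · rw [hK1, norm_neg, add_sub_cancel_left, norm_one, mul_one] at h1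
    linarith
  · have hz' : 0 < z.im := (le_max_right A 0).trans_lt hz
    have := (hK ⟨z, hz'⟩).hasDerivWithinAt (s := {z : ℂ | max A 0 < z.im})
    rw [UpperHalfPlane.ofComplex_apply_of_im_pos hz']
    exact this
  · have hz' : 0 < z.im := (le_max_right A 0).trans_lt hz
    have := hA ⟨z, hz'⟩ ((le_max_left A 0).trans hz.le)
    rw [Set.mem_ofPred_eq, dist_eq_norm] at this
    rw [UpperHalfPlane.ofComplex_apply_of_im_pos hz']
    exact this.le

/-- The residue theorem on `X₀(N)` for a form of weight two with a pole only at `i∞`. -/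
lemma coeff_eq_zero_of_weight_two {N : ℕ} [NeZero N] {φ : ℍ → ℂ} (hol : MDiff φ)
    (hinv : ∀ γ ∈ Gamma0 N, φ ∣[(2 : ℤ)] γ = φ)
    (hcusp : ∀ γ ∉ Gamma0 N, Tendsto (φ ∣[(2 : ℤ)] γ) atImInfty (𝓝 0)) {m : ℕ} {P : ℂ[X]}
    (hP : QApprox (fun τ ↦ nome τ ^ m * φ τ) P (m + 1)) : P.coeff m = 0 := by
  have := Fintype.ofFinite (SL(2, ℤ) ⧸ Gamma0 N)
  have hH (γ : SL(2, ℤ)) : (∑ q, cosetSlash hinv q) ∣[(2 : ℤ)] γ = ∑ q, cosetSlash hinv q := by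
    rw [SlashAction.sum_slash]
    simp only [cosetSlash_slash]
    exact Equiv.sum_comp (MulAction.toPerm γ⁻¹) _
  have hm (q : SL(2, ℤ) ⧸ Gamma0 N) : MDiff (cosetSlash hinv q) := by
    induction q using QuotientGroup.induction_on with
    | H g => exact hol.slash 2 _
  refine eq_zero_of_tendsto_sub_sum (m := m) (p := P.coeff) (.sum fun q _ ↦ hm q) (hH _) (hH _) ?_
  classical
  let q₀ : SL(2, ℤ) ⧸ Gamma0 N := ((1 : SL(2, ℤ)) : SL(2, ℤ) ⧸ Gamma0 N)
  have hq₀ : cosetSlash hinv q₀ = φ := by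
    change φ ∣[(2 : ℤ)] (1 : SL(2, ℤ))⁻¹ = φ
    rw [inv_one, SlashAction.slash_one]
  have hrest : Tendsto (fun τ ↦ ∑ q ∈ Finset.univ.erase q₀, cosetSlash hinv q τ)
      atImInfty (𝓝 0) := by
    rw [← Finset.sum_const_zero (s := Finset.univ.erase q₀)]
    refine tendsto_finsetSum _ fun q hq ↦ ?_
    have hq' := Finset.ne_of_mem_erase hq
    induction q using QuotientGroup.induction_on with
    | H g =>
      refine hcusp g⁻¹ fun hg ↦ hq' ?_
      exact QuotientGroup.eq.2 (by simpa using hg)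
  have hmain : Tendsto (fun τ : ℍ ↦ φ τ - ∑ k ∈ Finset.range m,
      P.coeff k * cexp (2 * π * I * ((k : ℂ) - m) * τ)) atImInfty (𝓝 (P.coeff m)) := by
    have h1 := hP.congr_poly (Q := ∑ k ∈ Finset.range (m + 1), C (P.coeff k) * X ^ k)
      (X_pow_dvd_iff.2 fun d hd ↦ by simp [finsetSum_coeff, hd])
    have h2 := (IsBigO.mul (isBigO_refl (fun τ ↦ (nome τ ^ m)⁻¹) atImInfty) h1).trans_tendsto
      (tendsto_nome.congr fun τ ↦ by
        rw [pow_succ, inv_mul_cancel_left₀ (pow_ne_zero _ (nome_ne_zero τ))])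
    refine (h2.add_const (P.coeff m)).congr' (.of_forall fun τ ↦ ?_) |>.trans (by simp)
    have h3 := pow_ne_zero m (nome_ne_zero τ)
    have h4 (k : ℕ) : cexp (2 * π * I * ((k : ℂ) - m) * τ) = (nome τ ^ m)⁻¹ * nome τ ^ k := by
      rw [nome, ← Complex.exp_nat_mul, ← Complex.exp_nat_mul, ← Complex.exp_neg,
        ← Complex.exp_add]
      congr 1; ring
    simp only [h4, eval_finsetSum, eval_mul, eval_C, eval_pow, eval_X]
    rw [mul_sub, inv_mul_cancel_left₀ h3, Finset.sum_range_succ, mul_add, Finset.mul_sum,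
      mul_left_comm, inv_mul_cancel₀ h3, mul_one]
    simp only [mul_left_comm]
    ring
  refine (zero_add (P.coeff m) ▸ hrest.add hmain).congr fun τ ↦ ?_
  rw [Finset.sum_apply, ← Finset.sum_erase_add _ _ (Finset.mem_univ q₀), hq₀]
  ring

lemma periodic_comp_ofComplex {f : ℍ → ℂ} {k : ℤ} (h : f ∣[k] ModularGroup.T = f) :
    Function.Periodic (f ∘ ofComplex) 1 := fun w ↦ by
  by_cases hw : 0 < w.im
  · have hw' : 0 < (w + 1).im := by simpa using hw
    simp only [Function.comp_apply, ofComplex_apply_of_im_pos hw, ofComplex_apply_of_im_pos hw']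
    have h1 := slash_eq_self_apply h ⟨w, hw⟩
    rw [UpperHalfPlane.modular_T_smul] at h1
    simp only [ModularGroup.coe_T, Matrix.of_apply, Matrix.cons_val', Matrix.cons_val_zero,
      Matrix.cons_val_one, Matrix.cons_val_fin_one, Int.cast_zero, Int.cast_one, zero_mul,
      zero_add, one_zpow, one_mul] at h1
    rw [← h1]
    congr 1
    ext
    simp [add_comm]
  · have hw' : ¬ 0 < (w + 1).im := by simpa using hw
    simp only [Function.comp_apply, ofComplex_apply_of_im_nonpos (not_lt.1 hw),
      ofComplex_apply_of_im_nonpos (not_lt.1 hw')]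

lemma qApprox_qExpansion {f : ℍ → ℂ} {k : ℤ} (hT : f ∣[k] ModularGroup.T = f) (hf : MDiff f)
    (hb : IsBoundedAtImInfty f) (L : ℕ) :
    QApprox f (PowerSeries.trunc L (qExpansion 1 f)) L := by
  have hper : Function.Periodic (f ∘ ofComplex) ((1 : ℝ) : ℂ) := by
    simpa using periodic_comp_ofComplex hT
  have h1 := hasFPowerSeriesOnBall_cuspFunction (c := fun m ↦ (qExpansion 1 f).coeff m) one_pos
    (analyticAt_cuspFunction_zero one_pos hper hf hb)
    (_root_.UpperHalfPlane.hasSum_qExpansion one_pos hper hf hb)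
  have h2 := (h1.hasFPowerSeriesAt.isBigO_sub_partialSum_pow L).comp_tendsto tendsto_nome
  have h3 : ∀ τ, nome τ = Function.Periodic.qParam 1 τ := fun τ ↦ by
    simp [nome, Function.Periodic.qParam]
  refine IsBigO.of_norm_right ?_
  simp only [norm_pow]
  refine h2.congr_left fun τ ↦ ?_
  simp only [Function.comp_apply, zero_add]
  rw [h3, eq_cuspFunction τ one_ne_zero hper, FormalMultilinearSeries.partialSum,
    eval, PowerSeries.eval₂_trunc_eq_sum_range]
  simp [mul_comm]

/-- Weight `k` cusp forms on `Γ₁(N)`, as a space of functions. -/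
def cuspSpace (N : ℕ) (k : ℤ) : Submodule ℂ (ℍ → ℂ) where
  carrier := {f | MDiff f ∧ (∀ γ ∈ Gamma1 N, f ∣[k] γ = f) ∧
    ∀ γ : SL(2, ℤ), Tendsto (f ∣[k] γ) atImInfty (𝓝 0)}
  zero_mem' := ⟨mdifferentiable_const, fun γ _ ↦ SlashAction.zero_slash _ _, fun γ ↦ by
    rw [SlashAction.zero_slash]; exact tendsto_const_nhds⟩
  add_mem' := fun {f g} hf hg ↦ ⟨hf.1.add hg.1, fun γ hγ ↦ by
    rw [SlashAction.add_slash, hf.2.1 γ hγ, hg.2.1 γ hγ], fun γ ↦ by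
    rw [SlashAction.add_slash]; simpa using! (hf.2.2 γ).add (hg.2.2 γ)⟩
  smul_mem' := fun c f hf ↦ ⟨hf.1.const_smul c, fun γ hγ ↦ by
    rw [SL_smul_slash, hf.2.1 γ hγ], fun γ ↦ by
    rw [SL_smul_slash]; simpa using! (hf.2.2 γ).const_smul c⟩

/-- Mathlib's cusp forms on `Γ₁(N)` are the elements of `cuspSpace N k`. -/
noncomputable def cuspFormEquiv (N : ℕ) [NeZero N] (k : ℤ) :
    CuspForm (Gamma1 N) k ≃ₗ[ℂ] cuspSpace N k where
  toFun f := ⟨f, f.holo', fun γ hγ ↦ f.slash_action_eq' _ ⟨γ, hγ, rfl⟩, fun γ ↦ by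
    have hc : IsCusp ((Matrix.SpecialLinearGroup.mapGL ℝ γ : GL (Fin 2) ℝ) •
        (OnePoint.infty : OnePoint ℝ)) 𝒮ℒ :=
      isCusp_SL2Z_iff'.2 ⟨γ, rfl⟩
    exact (OnePoint.isZeroAt_iff_forall_SL2Z hc).1 (f.zero_at_cusps'
      (by rwa [Subgroup.IsArithmetic.isCusp_iff_isCusp_SL2Z])) γ rfl⟩
  map_add' f g := rfl
  map_smul' c f := rfl
  invFun f :=
    { toFun := f.1
      slash_action_eq' := by
        rintro _ ⟨γ, hγ, rfl⟩
        exact f.2.2.1 γ hγ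
      holo' := f.2.1
      zero_at_cusps' := fun {c} hc ↦ (OnePoint.isZeroAt_iff_forall_SL2Z
        (by rwa [Subgroup.IsArithmetic.isCusp_iff_isCusp_SL2Z] at hc)).2 fun γ _ ↦ f.2.2.2 γ }
  left_inv f := rfl
  right_inv f := rfl

lemma prod_slash_SL {ι : Type*} (s : Finset ι) (f : ι → ℍ → ℂ) (k : ℤ) (γ : SL(2, ℤ)) :
    (∏ i ∈ s, f i) ∣[k * s.card] γ = ∏ i ∈ s, (f i ∣[k] γ) := by
  simp only [ModularForm.SL_slash]
  rw [ModularForm.prod_slash]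
  simp

/-- The residues modulo 4 and 31 classifying the cosets of `Γ₀(124)`. -/
def cosetInvariant (a c : ℤ) : Option (ZMod 31) × ZMod 6 :=
  (if (a : ZMod 31) = 0 then none else some (c * (a : ZMod 31)⁻¹),
    if (a : ZMod 4) = 1 ∨ (a : ZMod 4) = 3 then (((c * a : ZMod 4)).val : ZMod 6)
    else if (a * c : ZMod 4) = 0 then 4 else 5)

lemma dvd_of_cosetInvariant_eq {a c a' c' b d b' d' : ℤ} (h1 : a * d - b * c = 1)
    (h2 : a' * d' - b' * c' = 1) (h : cosetInvariant a c = cosetInvariant a' c') :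
    (124 : ℤ) ∣ a * c' - c * a' := by
  obtain ⟨h31, h4⟩ := Prod.ext_iff.1 h
  have e31 : (31 : ℤ) ∣ a * c' - c * a' := by
    refine (ZMod.intCast_zmod_eq_zero_iff_dvd _ 31).1 ?_
    have : Fact (Nat.Prime 31) := ⟨by norm_num⟩
    push_cast
    simp only [cosetInvariant] at h31
    by_cases ha : (a : ZMod 31) = 0 <;> by_cases ha' : (a' : ZMod 31) = 0
    · simp [ha, ha']
    · simp [ha, ha'] at h31
    · simp [ha, ha'] at h31
    · simp only [ha, ha', if_false, Option.some.injEq] at h31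
      field_simp at h31
      linear_combination -h31
  have e4 : (4 : ℤ) ∣ a * c' - c * a' := by
    refine (ZMod.intCast_zmod_eq_zero_iff_dvd _ 4).1 ?_
    have hz (a b c d : ZMod 4) (h : a * d - b * c = 1) : ¬(2 * a = 0 ∧ 2 * c = 0) := fun hac ↦ by
      have : (2 : ZMod 4) = 0 := by linear_combination -2 * h + d * hac.1 - b * hac.2
      exact absurd this (by decide)
    have key : ∀ a c a' c' : ZMod 4, ¬(2 * a = 0 ∧ 2 * c = 0) → ¬(2 * a' = 0 ∧ 2 * c' = 0) →
        (if a = 1 ∨ a = 3 then ((c * a).val : ZMod 6) else if a * c = 0 then 4 else 5) =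
        (if a' = 1 ∨ a' = 3 then ((c' * a').val : ZMod 6) else if a' * c' = 0 then 4 else 5) →
        a * c' - c * a' = 0 := by decide +kernel
    push_cast
    exact key a c a' c' (hz a b c d (by exact_mod_cast congrArg (Int.cast : ℤ → ZMod 4) h1))
      (hz a' b' c' d' (by exact_mod_cast congrArg (Int.cast : ℤ → ZMod 4) h2)) h4
  have : IsCoprime (4 : ℤ) 31 := ⟨8, -1, by norm_num⟩
  simpa using this.mul_dvd e4 e31

lemma card_quotient_Gamma0_le : Nat.card (SL(2, ℤ) ⧸ Gamma0 124) ≤ 192 := by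
  have hinj : Function.Injective fun q : SL(2, ℤ) ⧸ Gamma0 124 ↦
      cosetInvariant (q.out.1 0 0) (q.out.1 1 0) := fun q q' h ↦ by
    have hd (g : SL(2, ℤ)) : g.1 0 0 * g.1 1 1 - g.1 0 1 * g.1 1 0 = 1 := by
      have := g.det_coe
      rwa [Matrix.det_fin_two] at this
    have h1 := dvd_of_cosetInvariant_eq (hd q.out) (hd q'.out) h
    rw [← q.out_eq, ← q'.out_eq]
    refine QuotientGroup.eq.2 (Gamma0_mem.2 ?_)
    have e : (q.out⁻¹ * q'.out).1 1 0 =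
        q.out.1 0 0 * q'.out.1 1 0 - q.out.1 1 0 * q'.out.1 0 0 := by
      rw [Matrix.SpecialLinearGroup.coe_mul, Matrix.SpecialLinearGroup.coe_inv,
        Matrix.adjugate_fin_two, Matrix.mul_apply, Fin.sum_univ_two]
      simp
      ring
    rw [e]
    exact (ZMod.intCast_zmod_eq_zero_iff_dvd _ 124).2 h1
  refine (Nat.card_le_card_of_injective _ hinj).trans ?_
  rw [Nat.card_eq_fintype_card]
  simp [ZMod.card]

/-- Sturm's bound, for forms of level `Γ₀(N)`. -/
lemma eq_zero_of_isBigO_nome_pow {N : ℕ} [NeZero N] {k M : ℕ} {φ : ℍ → ℂ} (hol : MDiff φ)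
    (hinv : ∀ γ ∈ Gamma0 N, φ ∣[(k : ℤ)] γ = φ)
    (hb : ∀ γ : SL(2, ℤ), IsBoundedAtImInfty (φ ∣[(k : ℤ)] γ))
    (hφ : φ =O[atImInfty] fun τ ↦ nome τ ^ M)
    (hM : k * Nat.card (SL(2, ℤ) ⧸ Gamma0 N) < 12 * M) : φ = 0 := by
  have := Fintype.ofFinite (SL(2, ℤ) ⧸ Gamma0 N)
  rw [Nat.card_eq_fintype_card] at hM
  set n := Fintype.card (SL(2, ℤ) ⧸ Gamma0 N) with hn
  have hH (γ : SL(2, ℤ)) : (∏ q, cosetSlash hinv q) ∣[((k * n : ℕ) : ℤ)] γ =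
      ∏ q, cosetSlash hinv q := by
    have h1 := prod_slash_SL Finset.univ (cosetSlash hinv) k γ
    rw [Finset.card_univ, ← hn] at h1
    push_cast
    rw [h1]
    simp only [cosetSlash_slash]
    exact Equiv.prod_comp (MulAction.toPerm γ⁻¹) _
  have hm (q : SL(2, ℤ) ⧸ Gamma0 N) : MDiff (cosetSlash hinv q) := by
    induction q using QuotientGroup.induction_on with
    | H g => exact hol.slash k _
  have hbq (q : SL(2, ℤ) ⧸ Gamma0 N) : IsBoundedAtImInfty (cosetSlash hinv q) := by
    induction q using QuotientGroup.induction_on with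
    | H g => exact hb g⁻¹
  have hbH : IsBoundedAtImInfty (∏ q, cosetSlash hinv q) := by
    simp_rw [IsBoundedAtImInfty, BoundedAtFilter]
    rw [show (1 : ℍ → ℝ) = (fun x ↦ ∏ (q : SL(2, ℤ) ⧸ Gamma0 N), 1) by ext; simp, Finset.prod_fn]
    exact .finsetProd fun q _ ↦ hbq q
  let H : ModularForm 𝒮ℒ ((k * n : ℕ) : ℤ) :=
    { toFun := ∏ q, cosetSlash hinv q
      slash_action_eq' := by
        rintro _ ⟨γ, rfl⟩
        exact hH γ
      holo' := .prod fun q _ ↦ hm q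
      bdd_at_cusps' := fun {c} hc ↦ (OnePoint.isBoundedAt_iff_forall_SL2Z hc).2 fun γ _ ↦ by
        have h1 := hH γ
        rw [ModularForm.SL_slash] at h1
        rw [← h1] at hbH
        exact hbH }
  classical
  let q₀ : SL(2, ℤ) ⧸ Gamma0 N := ((1 : SL(2, ℤ)) : SL(2, ℤ) ⧸ Gamma0 N)
  have hq₀ : cosetSlash hinv q₀ = φ := by
    change φ ∣[(k : ℤ)] (1 : SL(2, ℤ))⁻¹ = φ
    rw [inv_one, SlashAction.slash_one]
  have hO : QApprox (∏ q, cosetSlash hinv q) 0 M := by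
    have h1 : (fun τ ↦ ∏ q ∈ Finset.univ.erase q₀, cosetSlash hinv q τ) =O[atImInfty]
        fun _ ↦ ∏ q ∈ Finset.univ.erase q₀, (1 : ℂ) :=
      .finsetProd fun q _ ↦ (hbq q).trans (isBigO_of_le _ fun _ ↦ by simp)
    refine (hφ.mul h1).congr (fun τ ↦ ?_) fun τ ↦ by simp
    have h2 := Finset.mul_prod_erase _ (cosetSlash hinv · τ) (Finset.mem_univ q₀)
    rw [congr_fun hq₀ τ] at h2
    simpa using h2
  have hH0 : H = 0 := by
    refine ModularForm.sturm_bound_levelOne_nat (lt_of_lt_of_le (b := (M : ℕ∞)) ?_ ?_)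
    · exact_mod_cast (Nat.div_lt_iff_lt_mul (by norm_num)).2 (by linarith)
    · refine PowerSeries.nat_le_order _ _ fun i hi ↦ ?_
      have h1 := (qApprox_qExpansion (hH _) H.holo' hbH M).coeff_eq hO hi
      rwa [PowerSeries.coeff_trunc, if_pos hi, coeff_zero] at h1
  have h0 : ∏ q, cosetSlash hinv q = 0 := congrArg DFunLike.coe hH0
  rw [UpperHalfPlane.prod_eq_zero_iff fun q _ ↦ hm q] at h0
  obtain ⟨q, -, hq⟩ := h0
  induction q using QuotientGroup.induction_on with
  | H g =>
    change φ ∣[(k : ℤ)] g⁻¹ = 0 at hq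
    have := congrArg (· ∣[(k : ℤ)] g) hq
    simpa only [← SlashAction.slash_mul, inv_mul_cancel, SlashAction.slash_one,
      SlashAction.zero_slash] using this

lemma mem_Gamma1_iff {N : ℕ} (g : Gamma0 N) : (g : SL(2, ℤ)) ∈ Gamma1 N ↔ Gamma0Map N g = 1 := by
  rw [Gamma1_mem, ← Gamma1_mem', Gamma1_to_Gamma0_mem]

/-- A generator of `Γ₀(124)` modulo `± Γ₁(124)`. -/
def diamondGen : SL(2, ℤ) := ⟨!![65, 11; 124, 21], by rw [Matrix.det_fin_two_of]; norm_num⟩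

lemma diamondGen_mem : diamondGen ∈ Gamma0 124 := by
  rw [Gamma0_mem]; decide

lemma Gamma0Map_diamondGen : Gamma0Map 124 ⟨diamondGen, diamondGen_mem⟩ = 21 := rfl

lemma diamondGen_pow_mem_Gamma0 (j : ℕ) : diamondGen ^ j ∈ Gamma0 124 := pow_mem diamondGen_mem j

lemma diamondGen_pow_mem_Gamma1 : diamondGen ^ 30 ∈ Gamma1 124 := by
  have h := (mem_Gamma1_iff (⟨diamondGen, diamondGen_mem⟩ ^ 30)).2
  rw [Subgroup.coe_pow] at h
  refine h ?_
  rw [map_pow, Gamma0Map_diamondGen]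
  decide

lemma slash_neg_one (f : ℍ → ℂ) (γ : SL(2, ℤ)) : f ∣[(1 : ℤ)] (-γ) = -(f ∣[(1 : ℤ)] γ) := by
  ext τ
  rw [Pi.neg_apply, SL_slash_apply, SL_slash_apply, ModularGroup.SL_neg_smul,
    ModularGroup.denom_apply, ModularGroup.denom_apply]
  have h (a b : ℤ) : ((-a : ℤ) : ℂ) * τ + (-b : ℤ) = -(a * τ + b) := by push_cast; ring
  change f (γ • τ) * (((-γ.1 1 0 : ℤ) : ℂ) * τ + (-γ.1 1 1 : ℤ)) ^ (-1 : ℤ) = _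
  rw [h, zpow_neg_one, zpow_neg_one, inv_neg, mul_neg]

lemma slash_conj_eq {N : ℕ} {f : ℍ → ℂ} {k : ℤ} (hf : ∀ γ ∈ Gamma1 N, f ∣[k] γ = f)
    {g : SL(2, ℤ)} (hg : g ∈ Gamma0 N) {γ : SL(2, ℤ)} (hγ : γ ∈ Gamma1 N) :
    (f ∣[k] g) ∣[k] γ = f ∣[k] g := by
  have h1 : g * γ * g⁻¹ ∈ Gamma1 N := by
    have hγ0 := Gamma1_in_Gamma0 _ hγ
    have h2 := (mem_Gamma1_iff ⟨γ, hγ0⟩).1 hγ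
    let a : Gamma0 N := ⟨g, hg⟩
    let b : Gamma0 N := ⟨γ, hγ0⟩
    have h3 := (mem_Gamma1_iff (a * b * a⁻¹)).2
    rw [Subgroup.coe_mul, Subgroup.coe_mul, Subgroup.coe_inv] at h3
    refine h3 ?_
    rw [map_mul, map_mul, h2, mul_one, ← map_mul, mul_inv_cancel, map_one]
  rw [← SlashAction.slash_mul, ← inv_mul_cancel_right (g * γ) g, SlashAction.slash_mul, hf _ h1]

lemma slash_pow_of_eigen {f : ℍ → ℂ} {ζ : ℂ} {g : SL(2, ℤ)} (h : f ∣[(1 : ℤ)] g = ζ • f) (j : ℕ) :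
    f ∣[(1 : ℤ)] (g ^ j) = ζ ^ j • f := by
  induction j with
  | zero => simp
  | succ j ih => rw [pow_succ, SlashAction.slash_mul, ih, SL_smul_slash, h, smul_smul, pow_succ]

/-- An eigenfunction of `diamondGen` is an eigenfunction of all of `Γ₀(124)`. -/
lemma exists_slash_eq_of_mem_Gamma0 {γ : SL(2, ℤ)} (hγ : γ ∈ Gamma0 124) :
    ∃ (j : ℕ) (s : ℂ), s ^ 2 = 1 ∧ ∀ (f : ℍ → ℂ) (ζ : ℂ), (∀ γ ∈ Gamma1 124, f ∣[(1 : ℤ)] γ = f) →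
      f ∣[(1 : ℤ)] diamondGen = ζ • f → f ∣[(1 : ℤ)] γ = (s * ζ ^ j) • f := by
  have key : ∀ d : ZMod 124, (∃ e, e * d = 1) → ∃ j : Fin 30,
      d = 21 ^ (j : ℕ) ∨ d = -21 ^ (j : ℕ) := by decide +kernel
  have hpos {γ : SL(2, ℤ)} {j : ℕ} (hγ : γ ∈ Gamma0 124) (hd : Gamma0Map 124 ⟨γ, hγ⟩ = 21 ^ j)
      (f : ℍ → ℂ) (ζ : ℂ) (hf : ∀ γ ∈ Gamma1 124, f ∣[(1 : ℤ)] γ = f)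
      (hv : f ∣[(1 : ℤ)] diamondGen = ζ • f) : f ∣[(1 : ℤ)] γ = ζ ^ j • f := by
    have h1 : γ * (diamondGen ^ j)⁻¹ ∈ Gamma1 124 := by
      refine (mem_Gamma1_iff (⟨γ, hγ⟩ * (⟨diamondGen, diamondGen_mem⟩ ^ j)⁻¹)).2 ?_
      rw [map_mul, hd, ← Gamma0Map_diamondGen, ← map_pow, ← map_mul, mul_inv_cancel, map_one]
    rw [← inv_mul_cancel_right γ (diamondGen ^ j), SlashAction.slash_mul, hf _ h1,
      slash_pow_of_eigen hv]
  obtain ⟨j, hj⟩ := key (Gamma0Map 124 ⟨γ, hγ⟩) ⟨Gamma0Map 124 ⟨γ, hγ⟩⁻¹, by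
    rw [← map_mul, inv_mul_cancel, map_one]⟩
  rcases hj with hj | hj
  · exact ⟨j, 1, one_pow 2, fun f ζ hf hv ↦ by rw [one_mul, hpos hγ hj f ζ hf hv]⟩
  · refine ⟨j, -1, neg_one_sq, fun f ζ hf hv ↦ ?_⟩
    have hγ' : -γ ∈ Gamma0 124 := by
      rw [Gamma0_mem] at hγ ⊢
      simpa using hγ
    have hd : Gamma0Map 124 ⟨-γ, hγ'⟩ = 21 ^ (j : ℕ) := by
      rw [← neg_neg (21 ^ (j : ℕ)), ← hj]
      simp [Gamma0Map]
    rw [← neg_neg γ, slash_neg_one, hpos hγ' hd f ζ hf hv, neg_one_mul]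
    exact (_root_.neg_smul _ _).symm

/-- The component of `f` on which `diamondGen` acts as `ζ⁻¹`, up to a factor. -/
noncomputable def eigenProj (ζ : ℂ) (f : ℍ → ℂ) : ℍ → ℂ :=
  ∑ j ∈ Finset.range 30, ζ ^ j • (f ∣[(1 : ℤ)] (diamondGen ^ j))

lemma eigenProj_slash_diamondGen {ζ : ℂ} (hζ : ζ ^ 30 = 1) {f : ℍ → ℂ}
    (hf : f ∣[(1 : ℤ)] (diamondGen ^ 30) = f) :
    eigenProj ζ f ∣[(1 : ℤ)] diamondGen = ζ⁻¹ • eigenProj ζ f := by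
  have hζ0 : ζ ≠ 0 := fun h ↦ by simp [h] at hζ
  rw [eq_inv_smul_iff₀ hζ0, eigenProj, SlashAction.sum_slash, Finset.smul_sum]
  have h1 (j : ℕ) : ζ • ((ζ ^ j • (f ∣[(1 : ℤ)] (diamondGen ^ j))) ∣[(1 : ℤ)] diamondGen) =
      ζ ^ (j + 1) • (f ∣[(1 : ℤ)] (diamondGen ^ (j + 1))) := by
    rw [SL_smul_slash, smul_smul, ← pow_succ', ← SlashAction.slash_mul, ← pow_succ]
  simp only [h1]
  have h2 := Finset.sum_range_succ (fun j ↦ ζ ^ j • (f ∣[(1 : ℤ)] (diamondGen ^ j))) 30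
  rw [Finset.sum_range_succ', hf, hζ, pow_zero, pow_zero, SlashAction.slash_one] at h2
  exact add_right_cancel h2

lemma eigenProj_slash_of_mem_Gamma1 {f : ℍ → ℂ} (hf : ∀ γ ∈ Gamma1 124, f ∣[(1 : ℤ)] γ = f) (ζ : ℂ)
    {γ : SL(2, ℤ)} (hγ : γ ∈ Gamma1 124) : eigenProj ζ f ∣[(1 : ℤ)] γ = eigenProj ζ f := by
  rw [eigenProj, SlashAction.sum_slash]
  refine Finset.sum_congr rfl fun j _ ↦ ?_
  rw [SL_smul_slash, slash_conj_eq hf (diamondGen_pow_mem_Gamma0 j) hγ]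

lemma mdifferentiable_eigenProj {f : ℍ → ℂ} (hf : MDiff f) (ζ : ℂ) : MDiff (eigenProj ζ f) :=
  .sum fun j _ ↦ (hf.slash 1 _).const_smul (ζ ^ j)

lemma eigenProj_apply (ζ : ℂ) (f : ℍ → ℂ) (τ : ℍ) : eigenProj ζ f τ =
    ∑ j ∈ Finset.range 30, ζ ^ j * (f ∣[(1 : ℤ)] (diamondGen ^ j)) τ := by
  simp [eigenProj, Finset.sum_apply]

lemma eigenProj_mem {f : ℍ → ℂ} (hf : f ∈ cuspSpace 124 1) (ζ : ℂ) :
    eigenProj ζ f ∈ cuspSpace 124 1 :=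
  sum_mem fun j _ ↦ Submodule.smul_mem _ _ ⟨hf.1.slash 1 _,
    fun _ hγ ↦ slash_conj_eq hf.2.1 (diamondGen_pow_mem_Gamma0 j) hγ,
    fun γ ↦ by rw [← SlashAction.slash_mul]; exact hf.2.2 _⟩

/-- A cusp form is determined by its eigencomponents. -/
lemma eq_zero_of_eigenProj {f : ℍ → ℂ} (h : ∀ ζ : ℂ, ζ ^ 30 = 1 → eigenProj ζ f = 0) : f = 0 := by
  obtain ⟨ω, hω⟩ : ∃ ω : ℂ, IsPrimitiveRoot ω 30 :=
    ⟨_, Complex.isPrimitiveRoot_exp 30 (by norm_num)⟩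
  have h1 : ∑ i ∈ Finset.range 30, eigenProj (ω ^ i) f = 0 :=
    Finset.sum_eq_zero fun i _ ↦ h _ (by rw [← pow_mul, mul_comm, pow_mul, hω.pow_eq_one, one_pow])
  simp only [eigenProj] at h1
  rw [Finset.sum_comm] at h1
  simp only [← Finset.sum_smul] at h1
  rw [Finset.sum_range_succ', Finset.sum_eq_zero fun j hj ↦ ?_] at h1
  · simpa using h1
  · have hj' : ω ^ (j + 1) ≠ 1 := hω.pow_ne_one_of_pos_of_lt (by omega)
      (by have := Finset.mem_range.1 hj; omega)
    have h2 : ∑ i ∈ Finset.range 30, (ω ^ i) ^ (j + 1) = 0 := by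
      have h3 := geom_sum_eq hj' 30
      rw [← pow_mul, mul_comm, pow_mul, hω.pow_eq_one, one_pow, sub_self, zero_div] at h3
      rw [← h3]
      exact Finset.sum_congr rfl fun i _ ↦ by rw [← pow_mul, ← pow_mul, mul_comm]
    rw [h2, zero_smul]

/-- Sturm's bound for eigenforms of weight one. -/
lemma eq_zero_of_isBigO_of_eigen {f : ℍ → ℂ} {ζ : ℂ} (hf : f ∈ cuspSpace 124 1) (hζ : ζ ^ 30 = 1)
    (hv : f ∣[(1 : ℤ)] diamondGen = ζ • f) (hO : f =O[atImInfty] fun τ ↦ nome τ ^ 17) : f = 0 := by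
  have hprod (γ : SL(2, ℤ)) : (f ^ 60) ∣[((60 : ℕ) : ℤ)] γ = (f ∣[(1 : ℤ)] γ) ^ 60 := by
    simpa using prod_slash_SL (Finset.range 60) (fun _ ↦ f) 1 γ
  have h60 : f ^ 60 = 0 := by
    refine eq_zero_of_isBigO_nome_pow (N := 124) (k := 60) (M := 1020) ?_ (fun γ hγ ↦ ?_)
      (fun γ ↦ ?_) ?_ ?_
    · exact hf.1.pow 60
    · obtain ⟨j, s, hs, h⟩ := exists_slash_eq_of_mem_Gamma0 hγ
      rw [hprod, h f ζ hf.2.1 hv, _root_.smul_pow, mul_pow, show s ^ 60 = (s ^ 2) ^ 30 by ring, hs,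
        ← pow_mul, show j * 60 = 30 * (2 * j) by ring, pow_mul, hζ]
      simp
    · rw [hprod]
      exact ((hf.2.2 γ).pow 60).isBigO_one ℝ
    · exact (hO.pow 60).congr_right fun τ ↦ by rw [← pow_mul]
    · have := card_quotient_Gamma0_le
      omega
  ext τ
  simpa using congr_fun h60 τ

section

/-- The exponents of the `j`-th translate of the theta quotient `h`, reduced modulo 124. -/
def transl (h : Fin 11 → ℕ) (j : ℕ) (i : Fin 11) : ℕ := 65 ^ j * h i % 124

/-- The exponent of the sign picked up by reducing the `j`-th translate modulo 124. -/
def signExp (h : Fin 11 → ℕ) (j : ℕ) : ℕ := ∑ i, 65 ^ j * h i / 124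

/-- The order at `i∞` of the `j`-th translate, shifted by 16. -/
def shiftedOrder (h : Fin 11 → ℕ) (j : ℕ) : ℕ :=
  ((∑ i, (62 - (transl h j i : ℤ)) ^ 2 + 248 * 16 - 3 * 62 ^ 2) / 248).toNat

/-- `X ^ r`, as a polynomial modulo `X ^ 21`. -/
noncomputable def truncPow (r : ℕ) : ℤ[X] := if r < 21 then X ^ r else 0

/-- The expansion of `q ^ 16` times the `j`-th translate of the theta quotient `h`,
modulo `q ^ 21`. -/
noncomputable def translPoly (h : Fin 11 → ℕ) (j : ℕ) : ℤ[X] :=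
  C ((-1) ^ signExp h j) *
    (X ^ shiftedOrder h j * ∏ i, (1 - truncPow (transl h j i) - truncPow (124 - transl h j i)))

/-- Theta quotients of weight one on `Γ₁(124)` with poles of order at most 16, only at cusps
over `i∞`. -/
def IsAdmissible (h : Fin 11 → ℕ) : Prop :=
  248 ∣ ∑ i, h i ^ 2 ∧
  (∀ j < 30, (∑ i, (62 - (transl h j i : ℤ)) ^ 2) + 248 * 16 =
    3 * 62 ^ 2 + 248 * (shiftedOrder h j : ℤ)) ∧
  ∀ A ∈ ([1, 2, 4, 31, 62] : List ℕ), ∀ a < A, a.Coprime A →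
    3 * (A : ℤ) ^ 2 ≤ cuspSum (fun i ↦ h i) A a

/-- The admissible theta quotients vanishing at the cusps not over `i∞`. -/
def IsStrictlyAdmissible (h : Fin 11 → ℕ) : Prop :=
  IsAdmissible h ∧ ∀ A ∈ ([1, 2, 4, 31, 62] : List ℕ), ∀ a < A, a.Coprime A →
    3 * (A : ℤ) ^ 2 < cuspSum (fun i ↦ h i) A a

/-- The theta quotient with exponents `h`. -/
noncomputable abbrev quotForm (h : Fin 11 → ℕ) : ℍ → ℂ := levelQuot fun i ↦ (h i : ℤ)

lemma X_pow_dvd_X_pow_sub_truncPow (r : ℕ) : X ^ 21 ∣ X ^ r - truncPow r := by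
  rw [truncPow]
  split_ifs with h
  · simp
  · simpa using pow_dvd_pow X (not_lt.1 h)

lemma dvd_prod_sub_prod {R ι : Type*} [CommRing R] {d : R} (s : Finset ι) {f g : ι → R}
    (h : ∀ i ∈ s, d ∣ f i - g i) : d ∣ ∏ i ∈ s, f i - ∏ i ∈ s, g i := by
  rw [← Ideal.mem_span_singleton, ← Ideal.Quotient.mk_eq_mk_iff_sub_mem, map_prod, map_prod]
  exact Finset.prod_congr rfl fun i hi ↦ (Ideal.Quotient.mk_eq_mk_iff_sub_mem _ _).2
    (Ideal.mem_span_singleton.2 (h i hi))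

lemma X_pow_dvd_quotPoly_sub (o : ℕ) (r : Fin 11 → ℕ) :
    X ^ 21 ∣ quotPoly o r - X ^ o * ∏ i, (1 - truncPow (r i) - truncPow (124 - r i)) := by
  rw [quotPoly, ← mul_sub]
  refine Dvd.dvd.mul_left (dvd_prod_sub_prod _ fun i _ ↦ ?_) _
  have := dvd_add (X_pow_dvd_X_pow_sub_truncPow (r i)) (X_pow_dvd_X_pow_sub_truncPow (124 - r i))
  rw [← dvd_neg] at this
  convert this using 1
  ring

lemma levelQuot_eq_transl (h : Fin 11 → ℕ) (j : ℕ) :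
    levelQuot (fun i ↦ 65 ^ j * (h i : ℤ)) =
      (-1 : ℂ) ^ signExp h j • levelQuot fun i ↦ (transl h j i : ℤ) := by
  have h1 := levelQuot_add (fun i ↦ (transl h j i : ℤ)) fun i ↦ ((65 ^ j * h i / 124 : ℕ) : ℤ)
  rw [← Nat.cast_sum, zpow_natCast] at h1
  rw [signExp, ← h1]
  congr 1
  ext i
  rw [transl]
  exact_mod_cast (Nat.mod_add_div _ _).symm

variable {h : Fin 11 → ℕ}

lemma sum_sq_dvd (hh : 248 ∣ ∑ i, h i ^ 2) : (248 : ℤ) ∣ ∑ i, (h i : ℤ) ^ 2 := by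
  exact_mod_cast hh

lemma quotForm_slash_diamondGen_pow (hh : 248 ∣ ∑ i, h i ^ 2) (j : ℕ) :
    quotForm h ∣[(1 : ℤ)] (diamondGen ^ j) = levelQuot fun i ↦ 65 ^ j * (h i : ℤ) := by
  induction j with
  | zero => simp
  | succ j ih =>
    rw [pow_succ, SlashAction.slash_mul, ih, levelQuot_slash ?_ _ (by decide)]
    · congr 1
      ext i
      change 65 * _ = _
      ring
    · simp only [mul_pow, ← Finset.mul_sum]
      exact (sum_sq_dvd hh).mul_left _

lemma quotForm_slash_of_mem_Gamma1 (hh : 248 ∣ ∑ i, h i ^ 2) {γ : SL(2, ℤ)}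
    (hγ : γ ∈ Gamma1 124) : quotForm h ∣[(1 : ℤ)] γ = quotForm h := by
  obtain ⟨ha, -, hc⟩ := (Gamma1_mem _ _).1 hγ
  rw [levelQuot_slash (sum_sq_dvd hh) _ ((ZMod.intCast_zmod_eq_zero_iff_dvd _ 124).1 hc)]
  obtain ⟨t, ht⟩ : (124 : ℤ) ∣ γ.1 0 0 - 1 := by
    refine (ZMod.intCast_zmod_eq_zero_iff_dvd _ 124).1 ?_
    push_cast
    exact sub_eq_zero.2 ha
  have h1 := levelQuot_add (fun i ↦ (h i : ℤ)) fun i ↦ t * h i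
  rw [← Finset.mul_sum, ((even_sum_of_sq (sum_sq_dvd hh)).mul_left t).neg_one_zpow, one_smul] at h1
  rw [quotForm, ← h1]
  congr 1
  ext i
  linear_combination (h i : ℤ) * ht

lemma mdifferentiable_quotForm : MDiff (quotForm h) := by
  rw [UpperHalfPlane.mdifferentiable_iff]
  intro τ hτ
  have h1 : DifferentiableAt ℂ (fun τ : ℂ ↦ thetaQuot (charMat fun i ↦ (h i : ℤ)) (124 * τ)) τ := by
    refine (differentiableAt_thetaQuot _ ?_).comp τ (differentiableAt_id.const_mul _)
    simpa [Complex.mul_im] using hτ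
  refine (h1.congr_of_eventuallyEq ?_).differentiableWithinAt
  filter_upwards [isOpen_upperHalfPlaneSet.mem_nhds hτ] with z hz
  simp [quotForm, levelQuot, ofComplex_apply_of_im_pos hz]

lemma qApprox_quotForm_slash (hh : IsAdmissible h) {j : ℕ} (hj : j < 30) :
    QApprox (fun τ ↦ nome τ ^ 16 * (quotForm h ∣[(1 : ℤ)] (diamondGen ^ j)) τ)
      ((translPoly h j).map (Int.castRingHom ℂ)) 21 := by
  have h1 := (qApprox_levelQuot (shiftedOrder h j) (transl h j)
    (fun i ↦ (Nat.mod_lt _ (by norm_num)).le) (hh.2.1 j hj)).mono (L' := 21) (by norm_num)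
  have h2 := map_dvd (Polynomial.mapRingHom (Int.castRingHom ℂ))
    (X_pow_dvd_quotPoly_sub (shiftedOrder h j) (transl h j))
  have h3 := (h1.congr_poly (by simpa using h2)).const_mul ((-1) ^ signExp h j)
  rw [quotForm_slash_diamondGen_pow hh.1, levelQuot_eq_transl]
  convert h3 using 1
  · ext τ
    simp only [Pi.smul_apply, smul_eq_mul]
    ring
  · simp [translPoly]

lemma cuspSum_emod (h : Fin 11 → ℤ) (A a : ℤ) : cuspSum h A (a % A) = cuspSum h A a := by
  simp [cuspSum, Int.mul_emod]

lemma cuspSum_of_forall {p : ℤ → ℤ → Prop} {h : Fin 11 → ℤ}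
    (hp : ∀ A ∈ ([1, 2, 4, 31, 62] : List ℕ), ∀ a < A, a.Coprime A →
      p (3 * (A : ℤ) ^ 2) (cuspSum h A a)) {A a : ℤ}
    (hA : A ∈ ({1, 2, 4, 31, 62} : Finset ℤ)) (ha : IsCoprime a A) :
    p (3 * A ^ 2) (cuspSum h A a) := by
  obtain ⟨B, rfl, hB⟩ : ∃ B : ℕ, A = B ∧ B ∈ ([1, 2, 4, 31, 62] : List ℕ) := by
    simp only [Finset.mem_insert, Finset.mem_singleton] at hA
    rcases hA with rfl | rfl | rfl | rfl | rfl
    exacts [⟨1, rfl, by simp⟩, ⟨2, rfl, by simp⟩, ⟨4, rfl, by simp⟩, ⟨31, rfl, by simp⟩,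
      ⟨62, rfl, by simp⟩]
  have hB0 : (0 : ℤ) < B := by
    have : ∀ B ∈ ([1, 2, 4, 31, 62] : List ℕ), 0 < B := by decide
    exact_mod_cast this B hB
  have h1 := Int.emod_nonneg a hB0.ne'
  have h2 := Int.emod_lt_of_pos a hB0
  have h3 : IsCoprime (a % B) (B : ℤ) := by
    rw [Int.emod_def, sub_eq_add_neg, ← mul_neg]
    exact ha.add_mul_left_left _
  rw [← cuspSum_emod]
  lift a % B to ℕ using h1 with b
  exact hp B hB b (by exact_mod_cast h2) (Nat.isCoprime_iff_coprime.1 h3)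

lemma quotForm_slash_isBigO_one (hh : IsAdmissible h) {γ : SL(2, ℤ)} (hγ : γ ∉ Gamma0 124) :
    (quotForm h ∣[(1 : ℤ)] γ) =O[atImInfty] fun _ ↦ (1 : ℝ) := by
  rw [Gamma0_mem, ZMod.intCast_zmod_eq_zero_iff_dvd] at hγ
  obtain ⟨A, hA, hA', κ, hκ, hO⟩ := exists_levelQuot_slash_isBigO (fun i ↦ (h i : ℤ)) γ hγ
  refine hO.trans (IsBigO.of_bound 1 (.of_forall fun τ ↦ ?_))
  have h1 : (3 * A ^ 2 : ℝ) ≤ cuspSum (fun i ↦ (h i : ℤ)) A (γ.1 0 0) := by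
    exact_mod_cast cuspSum_of_forall (p := (· ≤ ·)) hh.2.2 hA hA'
  rw [Real.norm_eq_abs, Real.abs_exp, norm_one, one_mul, Real.exp_le_one_iff]
  have := mul_nonneg (mul_nonneg hκ.le (sub_nonneg.2 h1)) τ.im_pos.le
  linarith

lemma quotForm_slash_tendsto (hh : IsStrictlyAdmissible h) {γ : SL(2, ℤ)} (hγ : γ ∉ Gamma0 124) :
    Tendsto (quotForm h ∣[(1 : ℤ)] γ) atImInfty (𝓝 0) := by
  rw [Gamma0_mem, ZMod.intCast_zmod_eq_zero_iff_dvd] at hγ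
  obtain ⟨A, hA, hA', κ, hκ, hO⟩ := exists_levelQuot_slash_isBigO (fun i ↦ (h i : ℤ)) γ hγ
  have h1 : (3 * A ^ 2 : ℝ) < cuspSum (fun i ↦ (h i : ℤ)) A (γ.1 0 0) := by
    exact_mod_cast cuspSum_of_forall (p := (· < ·)) hh.2 hA hA'
  refine hO.trans_tendsto (Real.tendsto_exp_atBot.comp ?_)
  exact Tendsto.const_mul_atTop_of_neg
    (by have := mul_pos hκ (sub_pos.2 h1); linarith) tendsto_comap

end

section

/-- The value at `ζ` of this polynomial is the coefficient of `q ^ k` in `q ^ 16` times the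
`ζ`-projection of the theta quotient `h`. -/
noncomputable def coefPoly (h : Fin 11 → ℕ) (k : ℕ) : ℤ[X] :=
  ∑ j ∈ Finset.range 30, C ((translPoly h j).coeff k) * X ^ j

/-- The expansion of `q ^ 16` times the `ζ`-projection of the theta quotient `h`. -/
noncomputable def eigenPoly (ζ : ℂ) (h : Fin 11 → ℕ) : ℂ[X] :=
  ∑ j ∈ Finset.range 30, C (ζ ^ j) * (translPoly h j).map (Int.castRingHom ℂ)

lemma aeval_coefPoly (ζ : ℂ) (h : Fin 11 → ℕ) (k : ℕ) :
    aeval ζ (coefPoly h k) = ∑ j ∈ Finset.range 30, ((translPoly h j).coeff k : ℂ) * ζ ^ j := by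
  simp [coefPoly]

lemma coeff_eigenPoly (ζ : ℂ) (h : Fin 11 → ℕ) (k : ℕ) :
    (eigenPoly ζ h).coeff k = aeval ζ (coefPoly h k) := by
  rw [eigenPoly, aeval_coefPoly, finsetSum_coeff]
  exact Finset.sum_congr rfl fun j _ ↦ by rw [coeff_C_mul, coeff_map, mul_comm, eq_intCast]

variable {h : Fin 11 → ℕ}

lemma qApprox_eigenProj_quotForm (hh : IsAdmissible h) (ζ : ℂ) :
    QApprox (fun τ ↦ nome τ ^ 16 * eigenProj ζ (quotForm h) τ) (eigenPoly ζ h) 21 := by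
  convert QApprox.sum (Finset.range 30) fun j hj ↦
    (qApprox_quotForm_slash hh (Finset.mem_range.1 hj)).const_mul (ζ ^ j) using 1
  · ext τ
    rw [eigenProj_apply, Finset.mul_sum]
    exact Finset.sum_congr rfl fun j _ ↦ by ring
  · rfl

lemma eigenProj_slash (ζ : ℂ) (f : ℍ → ℂ) (γ : SL(2, ℤ)) : eigenProj ζ f ∣[(1 : ℤ)] γ =
    fun τ ↦ ∑ j ∈ Finset.range 30, ζ ^ j * (f ∣[(1 : ℤ)] (diamondGen ^ j * γ)) τ := by
  ext τ
  rw [eigenProj, SlashAction.sum_slash, Finset.sum_apply]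
  refine Finset.sum_congr rfl fun j _ ↦ ?_
  rw [SL_smul_slash, ← SlashAction.slash_mul, Pi.smul_apply, smul_eq_mul]

lemma diamondGen_pow_mul_notMem (j : ℕ) {γ : SL(2, ℤ)} (hγ : γ ∉ Gamma0 124) :
    diamondGen ^ j * γ ∉ Gamma0 124 := fun h' ↦
  hγ ((Subgroup.mul_mem_cancel_left _ (diamondGen_pow_mem_Gamma0 j)).1 h')

lemma eigenProj_quotForm_slash_isBigO_one (hh : IsAdmissible h) (ζ : ℂ) {γ : SL(2, ℤ)}
    (hγ : γ ∉ Gamma0 124) :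
    (eigenProj ζ (quotForm h) ∣[(1 : ℤ)] γ) =O[atImInfty] fun _ ↦ (1 : ℝ) := by
  rw [eigenProj_slash]
  exact IsBigO.fun_sum fun j _ ↦
    (quotForm_slash_isBigO_one hh (diamondGen_pow_mul_notMem j hγ)).const_mul_left _

lemma eigenProj_quotForm_slash_tendsto (hh : IsStrictlyAdmissible h) (ζ : ℂ) {γ : SL(2, ℤ)}
    (hγ : γ ∉ Gamma0 124) :
    Tendsto (eigenProj ζ (quotForm h) ∣[(1 : ℤ)] γ) atImInfty (𝓝 0) := by
  rw [eigenProj_slash]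
  simpa using tendsto_finsetSum (Finset.range 30) fun j _ ↦
    (quotForm_slash_tendsto hh (diamondGen_pow_mul_notMem j hγ)).const_mul (ζ ^ j)

/-- The coefficient of `q ^ n` in the expansion of `f` at `i∞`. -/
noncomputable def qCoeff (n : ℕ) (f : ℍ → ℂ) : ℂ := (qExpansion 1 f).coeff n

variable {f : ℍ → ℂ}

lemma T_mem_Gamma1 (N : ℕ) : ModularGroup.T ∈ Gamma1 N := by
  rw [Gamma1_mem]; simp [ModularGroup.T]

lemma qApprox_of_mem_cuspSpace (hf : f ∈ cuspSpace 124 1) (L : ℕ) :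
    QApprox f (PowerSeries.trunc L (qExpansion 1 f)) L := by
  refine qApprox_qExpansion (hf.2.1 _ (T_mem_Gamma1 _)) hf.1 ?_ L
  have := hf.2.2 1
  rw [SlashAction.slash_one] at this
  exact this.isBigO_one ℝ

lemma qCoeff_eq (hf : f ∈ cuspSpace 124 1) {P : ℂ[X]} {L : ℕ} (hP : QApprox f P L) {n : ℕ}
    (hn : n < L) : qCoeff n f = P.coeff n := by
  rw [← (qApprox_of_mem_cuspSpace hf L).coeff_eq hP hn, PowerSeries.coeff_trunc, if_pos hn, qCoeff]

lemma qCoeff_zero (hf : f ∈ cuspSpace 124 1) : qCoeff 0 f = 0 := by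
  have h1 := hf.2.2 1
  rw [SlashAction.slash_one] at h1
  have := QApprox.neBot_atImInfty
  have h2 := (qApprox_of_mem_cuspSpace hf 1).trans_tendsto (by simpa using tendsto_nome)
  have h3 : Tendsto (fun τ ↦ (PowerSeries.trunc 1 (qExpansion 1 f)).eval (nome τ)) atImInfty
      (𝓝 ((PowerSeries.trunc 1 (qExpansion 1 f)).eval 0)) :=
    ((Polynomial.continuous _).tendsto 0).comp tendsto_nome
  have h4 := h2.add h3
  simp only [sub_add_cancel, zero_add] at h4
  have h5 := tendsto_nhds_unique h4 h1
  rw [← coeff_zero_eq_eval_zero, PowerSeries.coeff_trunc, if_pos one_pos] at h5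
  exact h5

lemma qCoeff_add {g : ℍ → ℂ} (hf : f ∈ cuspSpace 124 1) (hg : g ∈ cuspSpace 124 1) (n : ℕ) :
    qCoeff n (f + g) = qCoeff n f + qCoeff n g := by
  have hf' := qApprox_of_mem_cuspSpace hf (n + 1)
  have hg' := qApprox_of_mem_cuspSpace hg (n + 1)
  rw [qCoeff_eq hf hf' n.lt_succ_self, qCoeff_eq hg hg' n.lt_succ_self,
    qCoeff_eq (add_mem hf hg) (hf'.add hg') n.lt_succ_self, coeff_add]

lemma qCoeff_smul (hf : f ∈ cuspSpace 124 1) (c : ℂ) (n : ℕ) :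
    qCoeff n (c • f) = c * qCoeff n f := by
  have hf' := qApprox_of_mem_cuspSpace hf (n + 1)
  rw [qCoeff_eq hf hf' n.lt_succ_self, qCoeff_eq (Submodule.smul_mem _ c hf) (hf'.const_mul c)
    n.lt_succ_self, coeff_C_mul]

/-- The relation between the coefficients of an eigenform coming from the residue theorem for its
product with a theta quotient. -/
lemma sum_qCoeff_mul_eq_zero {ζ : ℂ} (hζ : ζ ^ 30 = 1) (hf : f ∈ cuspSpace 124 1)
    (hv : f ∣[(1 : ℤ)] diamondGen = ζ • f) (hh : IsAdmissible h) :
    ∑ n ∈ Finset.Icc 1 16, aeval ζ (coefPoly h (16 - n)) * qCoeff n f = 0 := by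
  have hζ0 : ζ ≠ 0 := fun h ↦ by simp [h] at hζ
  set g := eigenProj ζ (quotForm h) with hg
  have hq (γ : SL(2, ℤ)) (hγ : γ ∈ Gamma1 124) := quotForm_slash_of_mem_Gamma1 hh.1 hγ
  have hgv : g ∣[(1 : ℤ)] diamondGen = ζ⁻¹ • g :=
    eigenProj_slash_diamondGen hζ (hq _ diamondGen_pow_mem_Gamma1)
  have hmul (γ : SL(2, ℤ)) : (f * g) ∣[(2 : ℤ)] γ = (f ∣[(1 : ℤ)] γ) * (g ∣[(1 : ℤ)] γ) :=
    mul_slash_SL2 1 1 γ f g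
  have h1 := coeff_eq_zero_of_weight_two (N := 124) (φ := f * g) (m := 16)
    (P := PowerSeries.trunc 17 (qExpansion 1 f) * eigenPoly ζ h)
    (hf.1.mul (mdifferentiable_eigenProj mdifferentiable_quotForm ζ)) ?_ ?_ ?_
  · rw [coeff_mul, Finset.Nat.sum_antidiagonal_eq_sum_range_succ_mk, Finset.sum_range_succ'] at h1
    simp only [coeff_eigenPoly] at h1
    rw [PowerSeries.coeff_trunc, if_pos (by norm_num), ← qCoeff.eq_1, qCoeff_zero hf, zero_mul,
      add_zero] at h1
    rw [← h1, Finset.range_eq_Ico, Finset.sum_Ico_add' (fun n ↦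
      (PowerSeries.trunc 17 (qExpansion 1 f)).coeff n * aeval ζ (coefPoly h (16 - n))) 0 16 1]
    refine Finset.sum_congr (by rfl) fun n hn ↦ ?_
    rw [PowerSeries.coeff_trunc, if_pos (by simp at hn; omega), ← qCoeff.eq_1, mul_comm]
  · intro γ hγ
    obtain ⟨j, s, hs, hjs⟩ := exists_slash_eq_of_mem_Gamma0 hγ
    rw [hmul, hjs f ζ hf.2.1 hv, hjs g ζ⁻¹ (fun _ ↦ eigenProj_slash_of_mem_Gamma1 hq ζ) hgv,
      smul_mul_smul_comm]
    convert one_smul ℂ _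
    rw [mul_mul_mul_comm, ← mul_pow, mul_inv_cancel₀ hζ0, one_pow, mul_one, ← sq, hs]
  · intro γ hγ
    rw [hmul]
    have h2 := (eigenProj_quotForm_slash_isBigO_one hh ζ hγ)
    exact (hf.2.2 γ).zero_mul_isBoundedUnder_le h2.isBoundedUnder_le
  · have h2 := (qApprox_of_mem_cuspSpace hf 17).mul
      ((qApprox_eigenProj_quotForm hh ζ).mono (L' := 17) (by norm_num))
    convert h2 using 2 with τ
    simp only [Pi.mul_apply]
    ring

end

section

/-- A list of eleven exponents, as a function. -/
def exps (l : List ℕ) (i : Fin 11) : ℕ := l.getD i 0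

/-- The coefficient of `X ^ k` in the product of the `1 - X ^ r` for `r` in a list. -/
def prodCoef : List ℕ → ℕ → ℤ
  | [], k => if k = 0 then 1 else 0
  | r :: l, k => prodCoef l k - if r ≤ k then prodCoef l (k - r) else 0

/-- The exponents `r` or `124 - r` less than 21, for `r` in a list. -/
def smallExps : List ℕ → List ℕ
  | [] => []
  | r :: l => if r < 21 then r :: smallExps l else
      if 124 - r < 21 then (124 - r) :: smallExps l else smallExps l

/-- List version of `transl`. -/
def translList (l : List ℕ) (j : ℕ) : List ℕ := l.map fun a ↦ 65 ^ j * a % 124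

/-- List version of `shiftedOrder`. -/
def listOrder (l : List ℕ) : ℕ :=
  (((l.map fun a : ℕ ↦ (62 - (a : ℤ)) ^ 2).sum + 248 * 16 - 3 * 62 ^ 2) / 248).toNat

/-- The coefficient of `X ^ k` in `translPoly (exps l) j`. -/
def translCoef (l : List ℕ) (j k : ℕ) : ℤ :=
  (if (l.map fun a ↦ 65 ^ j * a / 124).sum % 2 = 0 then 1 else -1) *
    if listOrder (translList l j) ≤ k then
      prodCoef (smallExps (translList l j)) (k - listOrder (translList l j)) else 0

/-- A linear combination of coefficients of the translates. -/
def rowSum (w : ℕ → ℤ) (l : List ℕ) (k : ℕ) : ℤ :=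
  ((List.range 30).map fun j ↦ w j * translCoef l j k).sum

lemma coeff_prod_one_sub_X_pow (l : List ℕ) (k : ℕ) :
    (l.map fun r ↦ (1 - X ^ r : ℤ[X])).prod.coeff k = prodCoef l k := by
  induction l generalizing k with
  | nil => simp [prodCoef, coeff_one]
  | cons r l ih =>
    rw [List.map_cons, List.prod_cons, sub_mul, one_mul, coeff_sub, coeff_X_pow_mul', prodCoef,
      ih, ih]

lemma prod_one_sub_truncPow (l : List ℕ) :
    (l.map fun r ↦ 1 - truncPow r - truncPow (124 - r)).prod =
      ((smallExps l).map fun r ↦ (1 - X ^ r : ℤ[X])).prod := by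
  induction l with
  | nil => rfl
  | cons r l ih =>
    rw [List.map_cons, List.prod_cons, ih, smallExps]
    by_cases h : r < 21
    · have h' : ¬ 124 - r < 21 := by omega
      simp [truncPow, h, h']
    · by_cases h' : 124 - r < 21 <;> simp [truncPow, h, h']

variable {l : List ℕ}

lemma ofFn_exps {α : Type*} (hl : l.length = 11) (g : ℕ → α) :
    List.ofFn (fun i ↦ g (exps l i)) = l.map g := by
  refine List.ext_getElem (by simp [hl]) fun i h1 h2 ↦ ?_
  simp only [List.length_map] at h2
  rw [List.getElem_ofFn, List.getElem_map, exps, List.getD_eq_getElem _ _ h2]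

lemma sum_exps {α : Type*} [AddCommMonoid α] (hl : l.length = 11) (g : ℕ → α) :
    ∑ i, g (exps l i) = (l.map g).sum := by
  rw [← ofFn_exps hl, List.sum_ofFn]

lemma prod_exps {α : Type*} [CommMonoid α] (hl : l.length = 11) (g : ℕ → α) :
    ∏ i, g (exps l i) = (l.map g).prod := by
  rw [← ofFn_exps hl, List.prod_ofFn]

lemma coeff_translPoly (hl : l.length = 11) (j k : ℕ) :
    (translPoly (exps l) j).coeff k = translCoef l j k := by
  have h1 : shiftedOrder (exps l) j = listOrder (translList l j) := by
    simp only [shiftedOrder, transl, listOrder, translList, List.map_map]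
    rw [sum_exps hl (fun a ↦ (62 - ((65 ^ j * a % 124 : ℕ) : ℤ)) ^ 2)]
    rfl
  have h2 : ∏ i, (1 - truncPow (transl (exps l) j i) - truncPow (124 - transl (exps l) j i)) =
      ((smallExps (translList l j)).map fun r ↦ (1 - X ^ r : ℤ[X])).prod := by
    rw [← prod_one_sub_truncPow, translList, List.map_map]
    exact prod_exps hl fun a ↦ 1 - truncPow (65 ^ j * a % 124) - truncPow (124 - 65 ^ j * a % 124)
  have h3 : ((-1) ^ signExp (exps l) j : ℤ) =
      if (l.map fun a ↦ 65 ^ j * a / 124).sum % 2 = 0 then 1 else -1 := by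
    rw [signExp, sum_exps hl (fun a ↦ 65 ^ j * a / 124)]
    generalize (l.map fun a ↦ 65 ^ j * a / 124).sum = n
    rcases Nat.mod_two_eq_zero_or_one n with h | h
    · simp [h, (Nat.even_iff.2 h).neg_one_pow]
    · simp [h, (Nat.odd_iff.2 h).neg_one_pow]
  rw [translPoly, coeff_C_mul, coeff_X_pow_mul', h1, h2, h3, translCoef]
  simp only [coeff_prod_one_sub_X_pow]

lemma rowSum_eq (hl : l.length = 11) (w : ℕ → ℤ) (k : ℕ) :
    rowSum w l k = ∑ j ∈ Finset.range 30, w j * (translPoly (exps l) j).coeff k := by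
  simp only [coeff_translPoly hl]
  rfl

lemma eval_coefPoly (hl : l.length = 11) (r : ℤ) (k : ℕ) :
    (coefPoly (exps l) k).eval r = rowSum (r ^ ·) l k := by
  simp [coefPoly, rowSum_eq hl, eval_finsetSum, mul_comm]

section Modular

variable {m p : ℕ} [Fact p.Prime] {r : ℤ} {ξ : ℂ}

/-- A polynomial not vanishing modulo `p` at a primitive `m`-th root of unity modulo `p` does not
vanish at any complex primitive `m`-th root of unity. -/
lemma aeval_ne_zero_of_eval (hm : 0 < m) (hr : IsPrimitiveRoot (r : ZMod p) m)
    (hξ : IsPrimitiveRoot ξ m) {P : ℤ[X]} (hP : ((P.eval r : ℤ) : ZMod p) ≠ 0) :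
    aeval ξ P ≠ 0 := fun h ↦ by
  have h1 : cyclotomic m ℤ ∣ P := by
    rw [cyclotomic_eq_minpoly hξ hm]
    exact minpoly.isIntegrallyClosed_dvd (hξ.isIntegral hm) h
  have h2 : eval (r : ZMod p) (cyclotomic m (ZMod p)) = 0 := hr.isRoot_cyclotomic hm
  rw [← map_cyclotomic_int, eval_intCast_map] at h2
  obtain ⟨Q, rfl⟩ := h1
  rw [eval_mul, Int.cast_mul] at hP
  exact hP (by rw [show ((eval r (cyclotomic m ℤ) : ℤ) : ZMod p) = 0 from h2, zero_mul])

/-- A homogeneous linear system over `ℤ[ξ]` with an inverse modulo `p` has only the zero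
solution. -/
lemma eq_zero_of_modular_inverse (hm : 0 < m) (hr : IsPrimitiveRoot (r : ZMod p) m)
    (hξ : IsPrimitiveRoot ξ m) {s : ℕ} {M : Matrix (Fin s) (Fin s) ℤ[X]}
    {B D : Matrix (Fin s) (Fin s) ℤ} (hD : ∀ i c, (M i c).eval r % p = D i c)
    (hB : ∀ i c, (∑ k, B i k * D k c) % p = if i = c then 1 else 0) {x : Fin s → ℂ}
    (hx : ∀ i, ∑ c, aeval ξ (M i c) * x c = 0) : x = 0 := by
  have hp : 1 < p := (Fact.out : p.Prime).one_lt
  refine Matrix.eq_zero_of_mulVec_eq_zero (M := M.map (aeval ξ)) ?_ (funext hx)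
  have h1 : (M.map (aeval ξ)).det = aeval ξ M.det := ((aeval ξ).map_det M).symm
  rw [h1]
  refine aeval_ne_zero_of_eval hm hr hξ fun h ↦ ?_
  let φ : ℤ[X] →+* ZMod p := (Int.castRingHom (ZMod p)).comp (evalRingHom r)
  have h2 : (φ.mapMatrix M).det = 0 := by rw [← RingHom.map_det]; exact h
  have h3 : B.map (Int.castRingHom (ZMod p)) * φ.mapMatrix M = 1 := by
    ext i c
    have h4 := congrArg (Int.cast (R := ZMod p)) (hB i c)
    rw [Matrix.mul_apply, Matrix.one_apply]
    have h5 (a : ℤ) : ((a % p : ℤ) : ZMod p) = a := by simp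
    rw [h5] at h4
    push_cast at h4
    rw [← h4]
    refine Finset.sum_congr rfl fun k _ ↦ ?_
    rw [← hD, h5]
    rfl
  have h4 := congrArg Matrix.det h3
  rw [Matrix.det_mul, h2, mul_zero, Matrix.det_one] at h4
  exact zero_ne_one h4

end Modular

end

section

instance : DecidablePred IsAdmissible := fun h ↦ by
  unfold IsAdmissible; infer_instance

instance : DecidablePred IsStrictlyAdmissible := fun h ↦ by
  unfold IsStrictlyAdmissible; infer_instance

/-- Exponents of the theta quotients used to bound the space of cusp forms from above. -/
def relationExps : Fin 16 → List ℕ := ![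
    [10, 19, 20, 25, 25, 34, 44, 49, 50, 54, 62],
    [9, 11, 15, 20, 27, 31, 46, 51, 53, 61, 62],
    [1, 15, 21, 22, 35, 37, 39, 43, 44, 61, 62],
    [1, 13, 20, 26, 42, 43, 44, 45, 48, 56, 62],
    [5, 14, 19, 22, 36, 50, 51, 55, 56, 58, 62],
    [12, 14, 19, 26, 26, 32, 45, 46, 47, 51, 62],
    [7, 14, 16, 17, 21, 25, 35, 41, 55, 57, 62],
    [1, 9, 11, 23, 37, 44, 45, 46, 53, 55, 62],
    [6, 18, 20, 37, 42, 44, 47, 51, 57, 62, 62],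
    [5, 11, 13, 23, 47, 49, 52, 57, 61, 62, 62],
    [11, 26, 27, 36, 36, 38, 41, 42, 49, 62, 62],
    [1, 13, 17, 21, 29, 30, 31, 43, 60, 61, 62],
    [1, 7, 31, 36, 37, 38, 45, 47, 49, 57, 62],
    [3, 6, 19, 25, 36, 39, 49, 55, 57, 61, 62],
    [6, 18, 25, 28, 34, 37, 49, 52, 57, 62, 62],
    [16, 20, 23, 28, 34, 39, 40, 51, 53, 62, 62]]

set_option maxRecDepth 100000 in
lemma isAdmissible_relationExps (i : Fin 16) :
    (relationExps i).length = 11 ∧ IsAdmissible (exps (relationExps i)) := by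
  revert i; decide +kernel

variable {f : ℍ → ℂ} {ξ : ℂ}

lemma eq_zero_of_qCoeff {ζ : ℂ} (hζ : ζ ^ 30 = 1) (hf : f ∈ cuspSpace 124 1)
    (hv : f ∣[(1 : ℤ)] diamondGen = ζ • f) (h : ∀ n ∈ Finset.Icc 1 16, qCoeff n f = 0) : f = 0 := by
  refine eq_zero_of_isBigO_of_eigen hf hζ hv ?_
  have h1 : QApprox f 0 17 := (qApprox_of_mem_cuspSpace hf 17).congr_poly <| by
    rw [sub_zero, X_pow_dvd_iff]
    intro n hn
    rw [PowerSeries.coeff_trunc, if_pos hn, ← qCoeff.eq_1]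
    rcases n.eq_zero_or_pos with rfl | h0
    · exact qCoeff_zero hf
    · exact h n (Finset.mem_Icc.2 ⟨h0, by omega⟩)
  simpa [QApprox] using h1

lemma isPrimitiveRoot_zmod {m : ℕ} {r : ℤ} (hm : 0 < m)
    (h : (r : ZMod 31) ^ m = 1 ∧ ∀ l < m, 0 < l → (r : ZMod 31) ^ l ≠ 1) :
    IsPrimitiveRoot (r : ZMod 31) m :=
  .mk_of_lt _ hm h.1 fun l h0 hl ↦ h.2 l hl h0

instance : Fact (Nat.Prime 31) := ⟨by norm_num⟩

/-- An eigenform is determined by the coefficients at which the matrix of residue relations is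
not known to be nonsingular modulo 31. -/
lemma eq_zero_of_modular_relations {m s : ℕ} (hm : 0 < m) (hm' : m ∣ 30)
    (hξ : IsPrimitiveRoot ξ m) {r : ℤ}
    (hr : (r : ZMod 31) ^ m = 1 ∧ ∀ l < m, 0 < l → (r : ZMod 31) ^ l ≠ 1)
    {H : Fin s → List ℕ} (hH : ∀ i, (H i).length = 11 ∧ IsAdmissible (exps (H i)))
    {N : Fin s → ℕ} (hN : N.Injective) (hN' : ∀ c, N c ∈ Finset.Icc 1 16)
    {B D : Fin s → Fin s → ℤ}
    (hD : ∀ i, (fun c ↦ rowSum (r ^ ·) (H i) (16 - N c) % 31) = D i)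
    (hB : ∀ i, (fun c ↦ (∑ k, B i k * D k c) % 31) = fun c ↦ if i = c then 1 else 0)
    (hf : f ∈ cuspSpace 124 1) (hv : f ∣[(1 : ℤ)] diamondGen = ξ • f)
    (h : ∀ n ∈ Finset.Icc 1 16, (∀ c, N c ≠ n) → qCoeff n f = 0) : f = 0 := by
  have hξ' : ξ ^ 30 = 1 := by
    obtain ⟨k, hk⟩ := hm'
    rw [hk, pow_mul, hξ.pow_eq_one, one_pow]
  have h1 : (fun c ↦ qCoeff (N c) f) = 0 := by
    refine eq_zero_of_modular_inverse (p := 31) hm (isPrimitiveRoot_zmod hm hr) hξ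
      (M := fun i c ↦ coefPoly (exps (H i)) (16 - N c)) (B := B) (D := D) (fun i c ↦ ?_)
      (fun i c ↦ congrFun (hB i) c) fun i ↦ ?_
    · rw [eval_coefPoly (hH i).1]
      exact congrFun (hD i) c
    · rw [← sum_qCoeff_mul_eq_zero hξ' hf hv (hH i).2,
        ← Finset.sum_image (g := N) (s := Finset.univ)
          (f := fun n ↦ aeval ξ (coefPoly (exps (H i)) (16 - n)) * qCoeff n f) hN.injOn]
      refine Finset.sum_subset (fun n hn ↦ ?_) fun n hn hn' ↦ ?_
      · obtain ⟨c, -, rfl⟩ := Finset.mem_image.1 hn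
        exact hN' c
      · rw [h n hn fun c hc ↦ hn' (hc ▸ Finset.mem_image_of_mem _ (Finset.mem_univ c)), mul_zero]
  refine eq_zero_of_qCoeff hξ' hf hv fun n hn ↦ ?_
  by_cases hc : ∃ c, N c = n
  · obtain ⟨c, rfl⟩ := hc
    exact congrFun h1 c
  · exact h n hn fun c hc' ↦ hc ⟨c, hc'⟩

/-- The matrix of residue relations for eigenvalues of order 1, modulo 31. -/
def relationMatrix1 : Fin 16 → Fin 16 → ℤ := ![
    ![29, 0, 1, 1, 1, 0, 30, 30, 0, 0, 30, 1, 0, 0, 1, 30],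
    ![1, 30, 1, 1, 0, 0, 30, 1, 29, 0, 30, 29, 0, 0, 1, 0],
    ![1, 0, 1, 0, 30, 30, 0, 2, 0, 0, 0, 30, 0, 1, 30, 30],
    ![0, 1, 1, 0, 30, 0, 0, 0, 1, 0, 30, 30, 0, 0, 0, 1],
    ![30, 0, 28, 0, 2, 2, 2, 29, 1, 30, 0, 0, 1, 30, 0, 0],
    ![2, 0, 2, 1, 29, 30, 0, 1, 0, 0, 2, 30, 0, 0, 0, 30],
    ![30, 0, 29, 30, 1, 2, 3, 30, 30, 1, 1, 0, 0, 0, 0, 0],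
    ![29, 1, 1, 2, 0, 0, 0, 0, 0, 1, 1, 0, 30, 30, 0, 30],
    ![1, 3, 0, 0, 0, 28, 0, 0, 3, 0, 1, 2, 0, 0, 29, 30],
    ![5, 30, 29, 0, 1, 30, 29, 0, 0, 0, 0, 0, 1, 1, 30, 0],
    ![30, 0, 29, 0, 0, 2, 0, 29, 1, 1, 2, 0, 0, 1, 0, 0],
    ![28, 0, 3, 4, 30, 2, 30, 2, 30, 0, 0, 0, 0, 0, 0, 0],
    ![1, 1, 1, 0, 30, 0, 0, 0, 2, 0, 0, 0, 30, 1, 0, 0],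
    ![1, 30, 0, 1, 1, 1, 29, 30, 0, 0, 0, 0, 30, 0, 1, 0],
    ![30, 1, 30, 0, 0, 1, 1, 0, 2, 30, 0, 0, 0, 0, 30, 0],
    ![30, 30, 3, 2, 0, 29, 2, 0, 30, 0, 1, 2, 0, 0, 30, 30]]

/-- The inverse of `relationMatrix1` modulo 31. -/
def relationInverse1 : Fin 16 → Fin 16 → ℤ := ![
    ![7, 14, 28, 10, 3, 26, 24, 15, 15, 25, 3, 30, 24, 20, 8, 12],
    ![30, 21, 9, 13, 1, 26, 6, 11, 25, 11, 29, 19, 25, 7, 14, 5],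
    ![10, 30, 26, 14, 13, 12, 1, 8, 17, 9, 16, 25, 1, 13, 12, 3],
    ![10, 14, 25, 26, 20, 23, 7, 15, 0, 23, 30, 4, 19, 9, 1, 15],
    ![19, 10, 23, 10, 26, 23, 26, 25, 2, 30, 11, 11, 18, 13, 5, 11],
    ![15, 9, 22, 1, 9, 6, 15, 4, 1, 11, 20, 27, 22, 25, 30, 15],
    ![9, 27, 22, 27, 11, 27, 5, 17, 3, 26, 2, 23, 9, 11, 13, 11],
    ![11, 6, 8, 9, 21, 13, 10, 8, 12, 8, 22, 5, 22, 30, 19, 19],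
    ![11, 4, 16, 6, 9, 7, 9, 21, 27, 26, 13, 30, 6, 8, 3, 17],
    ![26, 12, 7, 20, 25, 24, 15, 16, 27, 4, 16, 5, 14, 30, 21, 13],
    ![19, 8, 20, 28, 8, 15, 29, 6, 17, 28, 27, 11, 1, 29, 23, 13],
    ![11, 4, 14, 25, 24, 17, 25, 18, 0, 5, 30, 10, 24, 18, 18, 27],
    ![25, 6, 30, 11, 12, 27, 19, 10, 30, 18, 20, 9, 16, 3, 6, 13],
    ![6, 5, 20, 3, 3, 3, 27, 21, 14, 13, 19, 10, 4, 22, 2, 1],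
    ![2, 9, 24, 9, 29, 11, 4, 4, 24, 0, 11, 7, 29, 27, 21, 6],
    ![29, 29, 6, 0, 4, 10, 2, 9, 12, 17, 10, 20, 11, 1, 17, 26]]

set_option maxRecDepth 100000 in
lemma eq_zero_of_order_one (hξ : IsPrimitiveRoot ξ 1) (hf : f ∈ cuspSpace 124 1)
    (hv : f ∣[(1 : ℤ)] diamondGen = ξ • f) : f = 0 := by
  refine eq_zero_of_modular_relations (by norm_num) (by norm_num) hξ (r := 1) (by decide)
    (H := relationExps) isAdmissible_relationExps
    (N := (fun c ↦ c + 1)) (by decide) (by decide)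
    (B := relationInverse1) (D := relationMatrix1)
    (by decide +kernel) (by decide +kernel) hf hv fun n hn hc ↦ ?_
  rw [Finset.mem_Icc] at hn
  exact absurd (Nat.sub_add_cancel hn.1) (hc ⟨n - 1, by omega⟩)

/-- The matrix of residue relations for eigenvalues of order 5, modulo 31. -/
def relationMatrix5 : Fin 16 → Fin 16 → ℤ := ![
    ![13, 25, 2, 1, 16, 0, 30, 30, 14, 24, 15, 8, 0, 4, 2, 29],
    ![4, 27, 8, 8, 0, 0, 15, 2, 21, 0, 29, 7, 0, 0, 16, 0],
    ![2, 30, 4, 0, 1, 15, 1, 6, 0, 0, 0, 27, 0, 16, 27, 29],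
    ![27, 17, 1, 19, 27, 0, 0, 0, 2, 0, 25, 23, 0, 3, 0, 8],
    ![30, 0, 25, 0, 18, 2, 4, 22, 2, 29, 0, 0, 1, 15, 0, 0],
    ![4, 28, 1, 8, 27, 27, 17, 8, 0, 0, 8, 23, 0, 0, 0, 15],
    ![11, 0, 25, 15, 8, 17, 19, 30, 29, 2, 16, 0, 0, 0, 0, 0],
    ![4, 4, 4, 3, 0, 0, 0, 0, 0, 8, 4, 0, 23, 29, 0, 15],
    ![16, 25, 0, 5, 15, 18, 0, 0, 16, 0, 1, 9, 0, 0, 28, 15],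
    ![3, 27, 30, 0, 28, 27, 19, 0, 0, 0, 0, 19, 9, 4, 29, 0],
    ![30, 5, 14, 7, 0, 3, 23, 19, 16, 2, 5, 30, 15, 1, 0, 30],
    ![17, 12, 22, 2, 29, 6, 15, 9, 30, 19, 0, 0, 0, 0, 0, 0],
    ![16, 17, 12, 1, 14, 0, 0, 14, 18, 0, 16, 27, 30, 1, 0, 0],
    ![1, 22, 7, 2, 28, 16, 19, 27, 0, 0, 8, 0, 29, 0, 8, 0],
    ![30, 28, 30, 18, 16, 27, 4, 0, 5, 29, 0, 0, 19, 0, 27, 0],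
    ![23, 13, 28, 8, 0, 23, 30, 0, 27, 0, 4, 3, 0, 0, 23, 30]]

/-- The inverse of `relationMatrix5` modulo 31. -/
def relationInverse5 : Fin 16 → Fin 16 → ℤ := ![
    ![20, 28, 29, 7, 6, 0, 1, 19, 26, 5, 23, 29, 22, 19, 5, 21],
    ![18, 29, 4, 11, 26, 10, 6, 15, 21, 26, 6, 5, 12, 19, 15, 15],
    ![22, 25, 15, 22, 8, 4, 15, 24, 15, 12, 18, 17, 26, 29, 4, 16],
    ![23, 23, 11, 17, 7, 0, 29, 27, 8, 25, 14, 12, 12, 3, 7, 21],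
    ![11, 22, 17, 11, 25, 1, 14, 9, 15, 5, 12, 2, 6, 12, 2, 23],
    ![28, 7, 8, 9, 27, 22, 3, 5, 2, 1, 21, 1, 26, 29, 6, 11],
    ![6, 21, 23, 23, 16, 3, 24, 11, 17, 5, 2, 19, 12, 1, 12, 0],
    ![4, 29, 7, 7, 1, 13, 29, 19, 0, 27, 7, 7, 7, 13, 24, 11],
    ![6, 9, 6, 16, 23, 8, 25, 28, 5, 3, 17, 30, 10, 6, 23, 20],
    ![30, 13, 29, 9, 1, 10, 24, 6, 13, 18, 19, 18, 8, 27, 23, 29],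
    ![15, 4, 10, 22, 26, 25, 5, 4, 25, 28, 19, 30, 7, 23, 14, 18],
    ![19, 8, 25, 6, 24, 7, 2, 29, 15, 13, 2, 22, 18, 2, 6, 10],
    ![9, 28, 13, 17, 17, 18, 29, 11, 25, 3, 1, 25, 17, 26, 15, 2],
    ![9, 26, 26, 26, 14, 18, 4, 29, 5, 26, 14, 0, 7, 28, 11, 5],
    ![5, 6, 26, 6, 5, 5, 15, 1, 2, 21, 24, 26, 16, 24, 4, 20],
    ![15, 17, 0, 25, 10, 19, 15, 26, 5, 17, 7, 19, 2, 22, 27, 13]]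

set_option maxRecDepth 100000 in
lemma eq_zero_of_order_five (hξ : IsPrimitiveRoot ξ 5) (hf : f ∈ cuspSpace 124 1)
    (hv : f ∣[(1 : ℤ)] diamondGen = ξ • f) : f = 0 := by
  refine eq_zero_of_modular_relations (by norm_num) (by norm_num) hξ (r := 16) (by decide)
    (H := relationExps) isAdmissible_relationExps
    (N := (fun c ↦ c + 1)) (by decide) (by decide)
    (B := relationInverse5) (D := relationMatrix5)
    (by decide +kernel) (by decide +kernel) hf hv fun n hn hc ↦ ?_
  rw [Finset.mem_Icc] at hn
  exact absurd (Nat.sub_add_cancel hn.1) (hc ⟨n - 1, by omega⟩)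

/-- The matrix of residue relations for eigenvalues of order 6, modulo 31. -/
def relationMatrix6 : Fin 16 → Fin 16 → ℤ := ![
    ![21, 11, 30, 1, 30, 0, 1, 25, 6, 11, 1, 25, 0, 25, 6, 6],
    ![22, 6, 6, 30, 0, 0, 1, 6, 2, 0, 25, 24, 0, 0, 5, 0],
    ![1, 24, 5, 0, 15, 25, 12, 27, 0, 0, 0, 26, 0, 1, 30, 25],
    ![0, 30, 1, 0, 25, 0, 0, 0, 25, 0, 10, 26, 0, 0, 0, 5],
    ![30, 0, 7, 0, 21, 7, 26, 24, 5, 25, 0, 0, 26, 26, 0, 0],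
    ![0, 6, 0, 12, 0, 26, 0, 1, 0, 0, 0, 30, 0, 0, 0, 6],
    ![1, 0, 0, 30, 1, 5, 26, 6, 30, 14, 5, 0, 0, 0, 0, 0],
    ![27, 5, 30, 24, 7, 0, 0, 0, 0, 6, 6, 0, 1, 1, 0, 30],
    ![30, 25, 0, 20, 26, 11, 1, 0, 5, 0, 5, 26, 0, 0, 25, 6],
    ![28, 30, 24, 0, 13, 5, 2, 0, 0, 0, 0, 15, 15, 26, 6, 0],
    ![26, 5, 11, 0, 19, 25, 1, 7, 25, 26, 0, 4, 4, 1, 0, 6],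
    ![19, 4, 28, 4, 5, 20, 26, 4, 1, 0, 0, 0, 0, 0, 0, 0],
    ![1, 19, 29, 4, 28, 0, 0, 27, 24, 0, 11, 12, 25, 6, 0, 0],
    ![1, 26, 30, 6, 1, 30, 11, 30, 0, 0, 24, 0, 1, 0, 26, 0],
    ![5, 25, 30, 24, 27, 3, 25, 0, 0, 1, 0, 0, 12, 0, 25, 0],
    ![9, 6, 26, 0, 24, 5, 7, 0, 6, 0, 25, 26, 0, 0, 26, 25]]

/-- The inverse of `relationMatrix6` modulo 31. -/
def relationInverse6 : Fin 16 → Fin 16 → ℤ := ![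
    ![20, 27, 11, 12, 13, 24, 28, 8, 17, 30, 6, 13, 0, 7, 6, 13],
    ![28, 14, 9, 10, 18, 6, 3, 29, 5, 25, 29, 23, 1, 7, 8, 16],
    ![2, 3, 22, 15, 28, 16, 3, 18, 27, 4, 29, 30, 12, 0, 17, 15],
    ![25, 17, 11, 30, 28, 16, 13, 9, 17, 1, 29, 20, 10, 18, 19, 22],
    ![3, 18, 29, 5, 10, 11, 10, 17, 6, 30, 11, 21, 1, 8, 26, 24],
    ![21, 11, 0, 6, 16, 8, 20, 17, 4, 30, 22, 3, 27, 14, 27, 21],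
    ![28, 15, 11, 27, 11, 6, 30, 7, 2, 3, 4, 27, 5, 10, 29, 9],
    ![26, 6, 2, 9, 17, 3, 23, 27, 22, 1, 3, 3, 15, 21, 29, 24],
    ![7, 12, 20, 14, 14, 20, 13, 27, 9, 25, 29, 2, 1, 2, 25, 16],
    ![2, 15, 13, 23, 8, 9, 10, 5, 2, 6, 16, 2, 8, 3, 30, 24],
    ![3, 26, 20, 7, 18, 19, 8, 14, 10, 4, 10, 0, 14, 13, 22, 10],
    ![3, 1, 0, 16, 8, 10, 20, 22, 20, 17, 26, 2, 21, 13, 12, 17],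
    ![29, 21, 25, 9, 12, 27, 18, 25, 27, 22, 24, 11, 14, 28, 29, 13],
    ![14, 27, 23, 23, 15, 16, 8, 8, 12, 4, 1, 21, 4, 20, 29, 12],
    ![29, 6, 21, 19, 28, 13, 26, 0, 30, 30, 29, 25, 7, 26, 2, 8],
    ![8, 12, 10, 24, 5, 1, 13, 18, 26, 11, 23, 22, 18, 19, 15, 8]]

set_option maxRecDepth 100000 in
lemma eq_zero_of_order_six (hξ : IsPrimitiveRoot ξ 6) (hf : f ∈ cuspSpace 124 1)
    (hv : f ∣[(1 : ℤ)] diamondGen = ξ • f) : f = 0 := by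
  refine eq_zero_of_modular_relations (by norm_num) (by norm_num) hξ (r := 26) (by decide)
    (H := relationExps) isAdmissible_relationExps
    (N := (fun c ↦ c + 1)) (by decide) (by decide)
    (B := relationInverse6) (D := relationMatrix6)
    (by decide +kernel) (by decide +kernel) hf hv fun n hn hc ↦ ?_
  rw [Finset.mem_Icc] at hn
  exact absurd (Nat.sub_add_cancel hn.1) (hc ⟨n - 1, by omega⟩)

/-- The matrix of residue relations for eigenvalues of order 10, modulo 31. -/
def relationMatrix10 : Fin 16 → Fin 16 → ℤ := ![
    ![19, 23, 23, 1, 27, 0, 1, 1, 12, 15, 4, 16, 0, 13, 23, 23],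
    ![29, 29, 15, 15, 0, 0, 4, 23, 24, 0, 8, 12, 0, 0, 4, 0],
    ![8, 24, 2, 0, 11, 4, 22, 25, 0, 0, 0, 29, 0, 4, 29, 8],
    ![14, 3, 1, 2, 2, 0, 0, 0, 8, 0, 23, 15, 0, 30, 0, 16],
    ![30, 0, 4, 0, 19, 0, 16, 16, 8, 8, 0, 0, 30, 27, 0, 0],
    ![0, 3, 0, 16, 0, 29, 0, 23, 0, 0, 0, 15, 0, 0, 0, 27],
    ![21, 0, 25, 0, 16, 26, 20, 30, 23, 8, 4, 0, 0, 0, 0, 0],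
    ![21, 2, 29, 7, 0, 0, 0, 0, 0, 15, 29, 0, 16, 8, 0, 27],
    ![27, 20, 0, 20, 5, 12, 27, 0, 16, 0, 1, 17, 0, 0, 22, 27],
    ![12, 29, 0, 0, 14, 2, 18, 0, 0, 0, 0, 21, 21, 29, 23, 0],
    ![30, 8, 3, 16, 2, 22, 11, 14, 4, 23, 1, 7, 28, 1, 0, 9],
    ![6, 2, 10, 4, 8, 25, 27, 15, 1, 29, 0, 0, 0, 0, 0, 0],
    ![4, 3, 30, 7, 28, 0, 0, 4, 27, 0, 28, 13, 1, 30, 0, 0],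
    ![1, 22, 17, 23, 17, 27, 14, 29, 0, 0, 19, 0, 8, 0, 15, 0],
    ![1, 17, 30, 24, 0, 22, 2, 0, 14, 8, 0, 0, 25, 0, 2, 0],
    ![16, 21, 10, 27, 0, 27, 24, 0, 29, 0, 2, 9, 0, 0, 15, 1]]

/-- The inverse of `relationMatrix10` modulo 31. -/
def relationInverse10 : Fin 16 → Fin 16 → ℤ := ![
    ![7, 0, 13, 2, 21, 12, 6, 9, 15, 1, 22, 29, 25, 7, 11, 21],
    ![16, 0, 2, 20, 23, 2, 10, 20, 14, 18, 10, 27, 21, 7, 17, 1],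
    ![26, 17, 25, 2, 5, 10, 23, 20, 10, 2, 19, 9, 2, 1, 0, 27],
    ![12, 8, 27, 27, 22, 27, 4, 10, 6, 11, 3, 27, 24, 29, 20, 27],
    ![18, 27, 13, 23, 12, 23, 0, 24, 29, 5, 1, 19, 26, 21, 8, 29],
    ![27, 28, 20, 15, 18, 3, 10, 10, 29, 15, 5, 23, 27, 13, 18, 1],
    ![10, 15, 30, 28, 7, 18, 30, 6, 25, 3, 19, 23, 7, 4, 12, 6],
    ![26, 0, 13, 19, 16, 20, 4, 17, 25, 17, 27, 5, 2, 2, 9, 22],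
    ![20, 0, 30, 27, 4, 21, 3, 1, 12, 28, 25, 2, 4, 18, 14, 19],
    ![26, 2, 1, 20, 9, 24, 15, 8, 30, 24, 2, 26, 25, 28, 10, 17],
    ![17, 13, 24, 15, 9, 13, 21, 30, 4, 17, 28, 1, 4, 28, 7, 12],
    ![21, 1, 1, 21, 9, 15, 4, 1, 23, 16, 19, 20, 29, 29, 24, 26],
    ![22, 11, 17, 21, 21, 9, 14, 2, 15, 20, 18, 22, 26, 12, 21, 18],
    ![7, 5, 11, 0, 22, 15, 4, 1, 29, 3, 27, 22, 13, 26, 7, 29],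
    ![4, 2, 27, 6, 24, 11, 22, 16, 1, 13, 0, 23, 5, 0, 23, 18],
    ![19, 14, 23, 9, 5, 0, 10, 12, 2, 14, 11, 19, 17, 18, 24, 30]]

set_option maxRecDepth 100000 in
lemma eq_zero_of_order_ten (hξ : IsPrimitiveRoot ξ 10) (hf : f ∈ cuspSpace 124 1)
    (hv : f ∣[(1 : ℤ)] diamondGen = ξ • f) : f = 0 := by
  refine eq_zero_of_modular_relations (by norm_num) (by norm_num) hξ (r := 27) (by decide)
    (H := relationExps) isAdmissible_relationExps
    (N := (fun c ↦ c + 1)) (by decide) (by decide)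
    (B := relationInverse10) (D := relationMatrix10)
    (by decide +kernel) (by decide +kernel) hf hv fun n hn hc ↦ ?_
  rw [Finset.mem_Icc] at hn
  exact absurd (Nat.sub_add_cancel hn.1) (hc ⟨n - 1, by omega⟩)

/-- The matrix of residue relations for eigenvalues of order 15, modulo 31. -/
def relationMatrix15 : Fin 16 → Fin 16 → ℤ := ![
    ![2, 1, 4, 1, 8, 0, 30, 6, 5, 15, 23, 19, 0, 25, 7, 24],
    ![17, 3, 19, 2, 0, 0, 23, 7, 25, 0, 24, 4, 0, 0, 9, 0],
    ![4, 21, 18, 0, 24, 17, 13, 5, 0, 0, 0, 13, 0, 8, 15, 24],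
    ![9, 28, 1, 9, 3, 0, 0, 0, 7, 0, 4, 21, 0, 15, 0, 10],
    ![30, 0, 9, 0, 29, 26, 11, 4, 20, 24, 0, 0, 5, 22, 0, 0],
    ![14, 14, 18, 22, 17, 13, 21, 9, 0, 0, 5, 29, 0, 0, 0, 17],
    ![6, 0, 27, 29, 2, 2, 28, 6, 27, 12, 9, 0, 0, 0, 0, 0],
    ![5, 18, 16, 8, 25, 0, 0, 0, 0, 19, 28, 0, 29, 27, 0, 23],
    ![8, 27, 0, 1, 14, 14, 10, 0, 5, 0, 5, 20, 0, 0, 22, 17],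
    ![18, 15, 9, 0, 10, 13, 13, 0, 0, 0, 0, 25, 4, 18, 24, 0],
    ![26, 27, 1, 25, 0, 9, 27, 1, 14, 20, 22, 12, 3, 1, 0, 1],
    ![21, 24, 30, 24, 11, 17, 22, 11, 30, 8, 0, 0, 0, 0, 0, 0],
    ![8, 10, 13, 19, 4, 0, 0, 5, 18, 0, 22, 9, 6, 25, 0, 0],
    ![1, 10, 14, 7, 22, 8, 24, 15, 0, 0, 12, 0, 27, 0, 10, 0],
    ![26, 23, 30, 11, 2, 10, 28, 0, 4, 27, 0, 0, 14, 0, 3, 0],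
    ![6, 14, 27, 20, 28, 18, 12, 0, 3, 0, 28, 8, 0, 0, 21, 6]]

/-- The inverse of `relationMatrix15` modulo 31. -/
def relationInverse15 : Fin 16 → Fin 16 → ℤ := ![
    ![4, 10, 18, 11, 6, 23, 4, 11, 26, 27, 16, 1, 27, 24, 19, 20],
    ![25, 27, 2, 28, 30, 2, 22, 16, 19, 5, 19, 26, 5, 7, 28, 21],
    ![29, 2, 16, 18, 7, 19, 0, 17, 23, 12, 12, 14, 7, 3, 25, 12],
    ![20, 5, 6, 19, 13, 7, 4, 24, 0, 0, 9, 13, 17, 6, 9, 30],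
    ![4, 23, 5, 3, 8, 23, 16, 12, 5, 8, 4, 12, 20, 12, 26, 19],
    ![24, 27, 17, 29, 12, 22, 14, 0, 14, 17, 24, 22, 10, 20, 27, 2],
    ![26, 24, 28, 12, 14, 8, 14, 2, 5, 23, 3, 14, 11, 9, 28, 29],
    ![20, 6, 23, 29, 13, 16, 25, 18, 23, 11, 13, 19, 30, 4, 29, 1],
    ![8, 29, 28, 10, 4, 6, 1, 7, 2, 3, 5, 29, 7, 9, 26, 6],
    ![2, 9, 19, 5, 4, 22, 4, 5, 9, 23, 26, 6, 12, 4, 23, 3],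
    ![15, 27, 14, 25, 21, 12, 23, 19, 19, 1, 2, 15, 15, 13, 25, 12],
    ![28, 6, 10, 17, 26, 26, 5, 12, 5, 26, 9, 29, 19, 25, 2, 15],
    ![9, 20, 27, 7, 1, 5, 23, 29, 26, 12, 7, 27, 4, 6, 10, 11],
    ![28, 9, 7, 5, 27, 15, 18, 10, 5, 9, 14, 27, 12, 23, 12, 23],
    ![27, 4, 14, 17, 19, 14, 28, 0, 17, 25, 26, 21, 23, 20, 14, 10],
    ![12, 14, 6, 24, 22, 12, 3, 30, 29, 27, 11, 2, 29, 6, 0, 22]]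

set_option maxRecDepth 100000 in
lemma eq_zero_of_order_fifteen (hξ : IsPrimitiveRoot ξ 15) (hf : f ∈ cuspSpace 124 1)
    (hv : f ∣[(1 : ℤ)] diamondGen = ξ • f) : f = 0 := by
  refine eq_zero_of_modular_relations (by norm_num) (by norm_num) hξ (r := 9) (by decide)
    (H := relationExps) isAdmissible_relationExps
    (N := (fun c ↦ c + 1)) (by decide) (by decide)
    (B := relationInverse15) (D := relationMatrix15)
    (by decide +kernel) (by decide +kernel) hf hv fun n hn hc ↦ ?_
  rw [Finset.mem_Icc] at hn
  exact absurd (Nat.sub_add_cancel hn.1) (hc ⟨n - 1, by omega⟩)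

/-- The matrix of residue relations for eigenvalues of order 30, modulo 31. -/
def relationMatrix30 : Fin 16 → Fin 16 → ℤ := ![
    ![15, 10, 29, 1, 15, 0, 1, 5, 30, 9, 16, 9, 0, 13, 21, 21],
    ![12, 11, 22, 23, 0, 0, 16, 21, 10, 0, 10, 24, 0, 0, 28, 0],
    ![2, 3, 7, 0, 20, 18, 16, 16, 0, 0, 0, 24, 0, 16, 27, 10],
    ![20, 21, 1, 21, 20, 0, 0, 0, 10, 0, 24, 17, 0, 28, 0, 14],
    ![30, 0, 30, 0, 15, 27, 12, 28, 19, 10, 0, 0, 6, 3, 0, 0],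
    ![0, 8, 0, 28, 0, 24, 0, 30, 0, 0, 0, 23, 0, 0, 0, 13],
    ![12, 0, 10, 25, 8, 10, 30, 26, 29, 0, 28, 0, 0, 0, 0, 0],
    ![21, 7, 27, 9, 29, 0, 0, 0, 0, 22, 11, 0, 8, 2, 0, 15],
    ![15, 14, 0, 19, 21, 1, 4, 0, 11, 0, 25, 10, 0, 0, 4, 13],
    ![22, 27, 2, 0, 3, 7, 12, 0, 0, 0, 0, 20, 5, 24, 21, 0],
    ![6, 20, 2, 27, 10, 4, 30, 19, 18, 12, 15, 18, 9, 1, 0, 27],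
    ![0, 24, 11, 16, 19, 1, 3, 13, 1, 19, 0, 0, 0, 0, 0, 0],
    ![16, 0, 19, 18, 29, 0, 0, 5, 16, 0, 7, 2, 5, 26, 0, 0],
    ![1, 7, 3, 21, 8, 15, 25, 27, 0, 0, 10, 0, 2, 0, 17, 0],
    ![25, 9, 30, 18, 20, 28, 20, 0, 8, 2, 0, 0, 24, 0, 20, 0],
    ![0, 9, 7, 12, 8, 7, 24, 0, 11, 0, 20, 11, 0, 0, 17, 5]]

/-- The inverse of `relationMatrix30` modulo 31. -/
def relationInverse30 : Fin 16 → Fin 16 → ℤ := ![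
    ![12, 10, 6, 25, 9, 15, 29, 18, 3, 14, 13, 17, 0, 30, 6, 19],
    ![22, 3, 13, 18, 22, 12, 30, 14, 0, 6, 22, 4, 16, 13, 25, 5],
    ![24, 24, 1, 2, 11, 20, 25, 25, 8, 16, 28, 22, 27, 5, 22, 8],
    ![18, 6, 27, 17, 23, 22, 3, 27, 14, 0, 10, 22, 7, 23, 13, 22],
    ![10, 14, 5, 27, 4, 0, 17, 21, 20, 23, 27, 4, 16, 26, 0, 27],
    ![25, 16, 11, 29, 8, 27, 30, 29, 13, 11, 24, 4, 8, 29, 13, 23],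
    ![9, 30, 2, 10, 17, 0, 0, 9, 29, 9, 24, 13, 5, 1, 4, 2],
    ![1, 3, 4, 23, 4, 1, 28, 11, 18, 28, 19, 15, 4, 30, 1, 5],
    ![27, 29, 23, 4, 25, 4, 1, 8, 13, 2, 1, 26, 2, 0, 17, 10],
    ![5, 21, 1, 12, 12, 3, 15, 16, 22, 27, 2, 16, 10, 11, 12, 18],
    ![14, 30, 11, 11, 4, 3, 12, 0, 28, 22, 20, 23, 22, 10, 28, 16],
    ![12, 6, 20, 12, 21, 14, 3, 3, 11, 4, 10, 2, 30, 9, 8, 27],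
    ![15, 23, 20, 20, 9, 6, 8, 14, 16, 15, 27, 0, 12, 19, 21, 30],
    ![1, 11, 16, 28, 17, 22, 1, 8, 28, 17, 25, 12, 19, 6, 8, 18],
    ![7, 6, 9, 10, 13, 14, 24, 28, 22, 14, 30, 12, 3, 9, 30, 19],
    ![2, 24, 12, 20, 26, 21, 0, 4, 16, 14, 26, 0, 22, 16, 2, 29]]

set_option maxRecDepth 100000 in
lemma eq_zero_of_order_thirty (hξ : IsPrimitiveRoot ξ 30) (hf : f ∈ cuspSpace 124 1)
    (hv : f ∣[(1 : ℤ)] diamondGen = ξ • f) : f = 0 := by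
  refine eq_zero_of_modular_relations (by norm_num) (by norm_num) hξ (r := 3) (by decide)
    (H := relationExps) isAdmissible_relationExps
    (N := (fun c ↦ c + 1)) (by decide) (by decide)
    (B := relationInverse30) (D := relationMatrix30)
    (by decide +kernel) (by decide +kernel) hf hv fun n hn hc ↦ ?_
  rw [Finset.mem_Icc] at hn
  exact absurd (Nat.sub_add_cancel hn.1) (hc ⟨n - 1, by omega⟩)

/-- The matrix of residue relations for eigenvalues of order 2, modulo 31. -/
def relationMatrix2 : Fin 13 → Fin 13 → ℤ := ![
    ![30, 30, 0, 1, 1, 2, 0, 1, 1, 0, 29, 30, 30],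
    ![30, 0, 0, 1, 30, 2, 0, 1, 0, 0, 0, 1, 0],
    ![1, 3, 1, 29, 0, 0, 0, 0, 30, 0, 1, 30, 1],
    ![1, 1, 0, 0, 0, 1, 0, 30, 30, 0, 0, 0, 1],
    ![3, 29, 0, 2, 0, 1, 1, 0, 0, 30, 30, 0, 0],
    ![0, 0, 30, 0, 1, 0, 0, 0, 30, 0, 0, 0, 30],
    ![0, 1, 29, 30, 30, 30, 1, 1, 0, 0, 0, 0, 0],
    ![30, 0, 0, 0, 0, 0, 30, 30, 0, 1, 1, 0, 30],
    ![0, 2, 28, 29, 0, 1, 0, 1, 2, 0, 0, 29, 30],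
    ![0, 30, 1, 2, 0, 0, 0, 0, 2, 3, 30, 30, 0],
    ![0, 2, 29, 29, 0, 1, 30, 0, 0, 0, 1, 0, 2],
    ![1, 1, 0, 30, 0, 1, 0, 0, 0, 0, 0, 0, 0],
    ![1, 1, 0, 0, 0, 0, 0, 0, 29, 1, 30, 0, 0]]

/-- The inverse of `relationMatrix2` modulo 31. -/
def relationInverse2 : Fin 13 → Fin 13 → ℤ := ![
    ![14, 13, 18, 12, 11, 28, 29, 28, 15, 13, 12, 18, 6],
    ![0, 23, 14, 9, 29, 26, 3, 4, 18, 4, 28, 28, 13],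
    ![6, 6, 26, 21, 22, 26, 26, 1, 15, 6, 16, 21, 3],
    ![28, 19, 9, 9, 4, 2, 11, 9, 22, 0, 6, 0, 26],
    ![27, 8, 3, 27, 6, 26, 13, 9, 19, 2, 10, 5, 22],
    ![14, 14, 8, 19, 26, 10, 10, 8, 20, 14, 28, 17, 7],
    ![3, 3, 4, 7, 5, 20, 20, 6, 18, 22, 18, 22, 26],
    ![16, 27, 23, 19, 15, 13, 2, 18, 24, 2, 30, 14, 22],
    ![1, 28, 28, 13, 2, 25, 29, 15, 1, 28, 16, 1, 27],
    ![5, 3, 9, 18, 4, 0, 2, 22, 30, 22, 15, 12, 10],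
    ![17, 14, 16, 13, 9, 4, 7, 24, 30, 14, 23, 25, 5],
    ![0, 10, 4, 4, 8, 19, 9, 25, 10, 16, 23, 6, 28],
    ![20, 5, 11, 24, 13, 5, 20, 24, 3, 30, 9, 14, 23]]

set_option maxRecDepth 100000 in
lemma eq_zero_of_order_two (hξ : IsPrimitiveRoot ξ 2) (hf : f ∈ cuspSpace 124 1)
    (hv : f ∣[(1 : ℤ)] diamondGen = ξ • f) (h1 : qCoeff 1 f = 0)
    (h2 : qCoeff 2 f = 0) (h4 : qCoeff 4 f = 0) : f = 0 := by
  refine eq_zero_of_modular_relations (by norm_num) (by norm_num) hξ (r := 30) (by decide)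
    (H := (fun i : Fin 13 ↦ relationExps (i.castLE (by norm_num))))
    (fun i ↦ isAdmissible_relationExps _)
    (N := ![3, 5, 6, 7, 8, 9, 10, 11, 12, 13, 14, 15, 16]) (by decide) (by decide)
    (B := relationInverse2) (D := relationMatrix2)
    (by decide +kernel) (by decide +kernel) hf hv fun n hn hc ↦ ?_
  obtain rfl | rfl | rfl | ⟨c, hc'⟩ := (by decide : ∀ n ∈ Finset.Icc 1 16,
    n = 1 ∨ n = 2 ∨ n = 4 ∨ ∃ c, ![3, 5, 6, 7, 8, 9, 10, 11, 12, 13, 14, 15, 16] c = n) n hn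
  exacts [h1, h2, h4, absurd hc' (hc c)]

/-- The matrix of residue relations for eigenvalues of order 3, modulo 31. -/
def relationMatrix3 : Fin 14 → Fin 14 → ℤ := ![
    ![1, 1, 1, 0, 30, 26, 24, 11, 30, 5, 0, 24, 5, 26],
    ![5, 1, 0, 0, 30, 5, 29, 0, 26, 25, 0, 0, 25, 0],
    ![25, 0, 6, 26, 0, 26, 0, 0, 0, 6, 0, 1, 30, 26],
    ![1, 0, 26, 0, 0, 0, 5, 0, 10, 6, 0, 0, 0, 25],
    ![4, 0, 19, 6, 6, 25, 25, 26, 0, 0, 25, 6, 0, 0],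
    ![19, 12, 21, 6, 0, 1, 0, 0, 19, 30, 0, 0, 0, 26],
    ![21, 30, 1, 6, 4, 26, 30, 16, 25, 0, 0, 0, 0, 0],
    ![1, 6, 27, 0, 0, 0, 0, 5, 5, 0, 30, 30, 0, 30],
    ![0, 11, 27, 20, 11, 0, 27, 0, 25, 6, 0, 0, 5, 26],
    ![25, 0, 1, 6, 29, 0, 0, 0, 0, 7, 25, 25, 26, 0],
    ![9, 0, 0, 26, 20, 25, 5, 25, 10, 7, 7, 1, 0, 24],
    ![27, 5, 6, 30, 6, 26, 30, 0, 0, 0, 0, 0, 0, 0],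
    ![29, 24, 6, 0, 0, 24, 6, 0, 20, 0, 26, 5, 0, 0],
    ![11, 5, 1, 1, 1, 30, 0, 0, 4, 0, 30, 0, 25, 0]]

/-- The inverse of `relationMatrix3` modulo 31. -/
def relationInverse3 : Fin 14 → Fin 14 → ℤ := ![
    ![29, 0, 18, 18, 13, 24, 12, 22, 13, 6, 10, 12, 0, 27],
    ![23, 8, 17, 0, 29, 10, 24, 12, 11, 22, 30, 24, 23, 25],
    ![9, 8, 3, 26, 28, 8, 16, 3, 2, 9, 28, 22, 9, 19],
    ![14, 26, 13, 26, 30, 3, 5, 10, 13, 27, 12, 5, 13, 8],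
    ![27, 9, 15, 6, 13, 4, 30, 9, 5, 14, 28, 22, 26, 19],
    ![4, 27, 25, 7, 16, 23, 4, 9, 21, 11, 7, 22, 26, 27],
    ![26, 12, 14, 28, 12, 1, 13, 20, 20, 18, 27, 3, 27, 9],
    ![8, 14, 24, 0, 10, 1, 22, 21, 17, 10, 10, 4, 21, 10],
    ![26, 19, 16, 30, 23, 21, 5, 23, 28, 18, 30, 17, 1, 29],
    ![6, 28, 19, 0, 26, 24, 8, 22, 30, 1, 29, 30, 29, 29],
    ![21, 7, 17, 22, 11, 28, 3, 9, 28, 16, 19, 12, 30, 28],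
    ![5, 18, 11, 3, 26, 20, 17, 2, 14, 16, 19, 8, 2, 24],
    ![6, 26, 25, 1, 19, 19, 1, 25, 21, 9, 29, 30, 3, 26],
    ![27, 1, 1, 8, 17, 21, 21, 11, 6, 24, 23, 29, 25, 27]]

set_option maxRecDepth 100000 in
lemma eq_zero_of_order_three (hξ : IsPrimitiveRoot ξ 3) (hf : f ∈ cuspSpace 124 1)
    (hv : f ∣[(1 : ℤ)] diamondGen = ξ • f) (h1 : qCoeff 1 f = 0) (h2 : qCoeff 2 f = 0) : f = 0 := by
  refine eq_zero_of_modular_relations (by norm_num) (by norm_num) hξ (r := 25) (by decide)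
    (H := (fun i : Fin 14 ↦ relationExps (i.castLE (by norm_num))))
    (fun i ↦ isAdmissible_relationExps _)
    (N := ![3, 4, 5, 6, 7, 8, 9, 10, 11, 12, 13, 14, 15, 16]) (by decide) (by decide)
    (B := relationInverse3) (D := relationMatrix3)
    (by decide +kernel) (by decide +kernel) hf hv fun n hn hc ↦ ?_
  obtain rfl | rfl | ⟨c, hc'⟩ := (by decide : ∀ n ∈ Finset.Icc 1 16,
    n = 1 ∨ n = 2 ∨ ∃ c, ![3, 4, 5, 6, 7, 8, 9, 10, 11, 12, 13, 14, 15, 16] c = n) n hn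
  exacts [h1, h2, absurd hc' (hc c)]

end

lemma QApprox.of_nome_pow_mul {f : ℍ → ℂ} {R : ℂ[X]} {m L : ℕ}
    (h : QApprox (fun τ ↦ nome τ ^ m * f τ) (X ^ m * R) (m + L)) : QApprox f R L := by
  have h1 := (isBigO_refl (fun τ ↦ (nome τ ^ m)⁻¹) atImInfty).mul h
  refine (h1.congr_left fun τ ↦ ?_).congr_right fun τ ↦ ?_
  · rw [eval_mul, eval_pow, eval_X, ← mul_sub,
      inv_mul_cancel_left₀ (pow_ne_zero _ (nome_ne_zero τ))]
  · rw [pow_add, inv_mul_cancel_left₀ (pow_ne_zero _ (nome_ne_zero τ))]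

lemma QApprox.tendsto {f : ℍ → ℂ} {P : ℂ[X]} {L : ℕ} (hL : 0 < L) (h : QApprox f P L) :
    Tendsto f atImInfty (𝓝 (P.coeff 0)) := by
  have h1 := h.trans_tendsto (by simpa [hL.ne'] using tendsto_nome.pow L)
  have h2 : Tendsto (fun τ ↦ P.eval (nome τ)) atImInfty (𝓝 (P.eval 0)) :=
    (P.continuous.tendsto 0).comp tendsto_nome
  simpa [coeff_zero_eq_eval_zero] using h1.add h2

/-- A combination of projections of theta quotients without polar part is a cusp form. -/
lemma combination_mem_cuspSpace {ζ : ℂ} (hζ : ζ ^ 30 = 1) {s : ℕ} {h : Fin s → Fin 11 → ℕ}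
    (hh : ∀ i, IsStrictlyAdmissible (h i)) {c : Fin s → ℂ}
    (hc : ∀ k ≤ 16, ∑ i, c i * aeval ζ (coefPoly (h i) k) = 0) :
    ∃ F ∈ cuspSpace 124 1, F ∣[(1 : ℤ)] diamondGen = ζ⁻¹ • F ∧
      ∀ n < 5, qCoeff n F = ∑ i, c i * aeval ζ (coefPoly (h i) (16 + n)) := by
  set F : ℍ → ℂ := ∑ i, c i • eigenProj ζ (quotForm (h i)) with hF
  have hq (i : Fin s) (γ : SL(2, ℤ)) (hγ : γ ∈ Gamma1 124) :=
    quotForm_slash_of_mem_Gamma1 (hh i).1.1 hγ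
  have hslash (γ : SL(2, ℤ)) :
      F ∣[(1 : ℤ)] γ = ∑ i, c i • (eigenProj ζ (quotForm (h i)) ∣[(1 : ℤ)] γ) := by
    rw [hF, SlashAction.sum_slash]
    exact Finset.sum_congr rfl fun i _ ↦ SL_smul_slash _ _ _ _
  have hv : F ∣[(1 : ℤ)] diamondGen = ζ⁻¹ • F := by
    rw [hslash, hF, Finset.smul_sum]
    refine Finset.sum_congr rfl fun i _ ↦ ?_
    rw [eigenProj_slash_diamondGen hζ (hq i _ diamondGen_pow_mem_Gamma1), smul_comm]
  have h1 : ∀ γ ∈ Gamma1 124, F ∣[(1 : ℤ)] γ = F := fun γ hγ ↦ by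
    rw [hslash]
    exact Finset.sum_congr rfl fun i _ ↦ by rw [eigenProj_slash_of_mem_Gamma1 (hq i) ζ hγ]
  set P : ℂ[X] := ∑ i, C (c i) * eigenPoly ζ (h i) with hP
  have hPc (k : ℕ) : P.coeff k = ∑ i, c i * aeval ζ (coefPoly (h i) k) := by
    simp only [hP, finsetSum_coeff, coeff_C_mul, coeff_eigenPoly]
  obtain ⟨R, hR⟩ : X ^ 16 ∣ P := X_pow_dvd_iff.2 fun k hk ↦ by rw [hPc, hc k hk.le]
  have hRc (n : ℕ) : R.coeff n = ∑ i, c i * aeval ζ (coefPoly (h i) (16 + n)) := by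
    rw [← hPc, hR, add_comm, coeff_X_pow_mul]
  have hq' : QApprox F R 5 := by
    refine QApprox.of_nome_pow_mul (m := 16) ?_
    rw [← hR]
    convert QApprox.sum Finset.univ fun i _ ↦
      (qApprox_eigenProj_quotForm (hh i).1 ζ).const_mul (c i) using 1
    ext τ
    rw [hF, Finset.sum_apply, Finset.mul_sum]
    exact Finset.sum_congr rfl fun i _ ↦ by rw [Pi.smul_apply, smul_eq_mul]; ring
  have hmem : F ∈ cuspSpace 124 1 := by
    refine ⟨.sum fun i _ ↦
      (mdifferentiable_eigenProj mdifferentiable_quotForm ζ).const_smul (c i), h1, fun γ ↦ ?_⟩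
    by_cases hγ : γ ∈ Gamma0 124
    · obtain ⟨j, t, -, hj⟩ := exists_slash_eq_of_mem_Gamma0 hγ
      rw [hj F _ h1 hv]
      have h2 := hq'.tendsto (by norm_num)
      rw [hRc, hc 16 le_rfl] at h2
      have h3 := h2.const_smul (t * ζ⁻¹ ^ j)
      rw [smul_zero] at h3
      exact h3
    · rw [hslash]
      have h2 := tendsto_finsetSum Finset.univ fun i _ ↦
        (eigenProj_quotForm_slash_tendsto (hh i) ζ hγ).const_smul (c i)
      simp only [smul_zero, Finset.sum_const_zero] at h2
      refine h2.congr fun τ ↦ ?_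
      simp [Finset.sum_apply]
  exact ⟨F, hmem, hv, fun n hn ↦ by rw [qCoeff_eq hmem hq' hn, hRc]⟩

/-- Exponents of theta quotients from which the eigenforms with eigenvalue `-1` are built. -/
def quadraticExps : Fin 6 → List ℕ := ![
    [8, 10, 12, 18, 20, 22, 28, 32, 44, 48, 62],
    [4, 10, 12, 14, 16, 24, 38, 50, 52, 62, 62],
    [2, 10, 12, 20, 22, 32, 32, 34, 42, 52, 62],
    [10, 12, 24, 34, 36, 44, 44, 46, 56, 60, 62],
    [8, 12, 20, 28, 36, 46, 48, 54, 58, 60, 62],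
    [6, 12, 16, 32, 38, 40, 44, 44, 50, 56, 62]]

/-- Coefficients of the eigenforms with eigenvalue `-1` in terms of theta quotients. -/
def quadraticCoeffs : Fin 3 → Fin 6 → ℤ := ![
    ![0, -3, -4, 0, 0, 0],
    ![1, 0, 0, -1, -3, -11],
    ![-3, 0, 0, 3, -7, 1]]

/-- Exponents of theta quotients from which the eigenforms with eigenvalue of order three are
built. -/
def cubicExps : Fin 11 → List ℕ := ![
    [3, 13, 16, 44, 46, 48, 49, 52, 59, 62, 62],
    [4, 5, 9, 14, 24, 40, 53, 57, 60, 62, 62],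
    [2, 12, 29, 31, 31, 33, 40, 52, 60, 62, 62],
    [7, 16, 17, 28, 45, 46, 52, 55, 56, 62, 62],
    [5, 14, 16, 19, 20, 28, 43, 48, 57, 62, 62],
    [3, 7, 8, 12, 19, 20, 32, 49, 52, 56, 62],
    [8, 15, 16, 26, 31, 36, 39, 46, 47, 52, 62],
    [5, 8, 14, 15, 20, 22, 31, 36, 48, 51, 62],
    [4, 26, 29, 31, 33, 36, 45, 56, 60, 62, 62],
    [4, 19, 25, 31, 32, 36, 37, 56, 58, 62, 62],
    [11, 17, 28, 28, 34, 44, 45, 51, 52, 62, 62]]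

/-- Constant terms of the coefficients of the eigenforms with eigenvalue of order three in terms
of theta quotients. -/
def cubicCoeffs₀ : Fin 2 → Fin 11 → ℤ := ![
    ![342, 390, 165, -216, 156, 450, -116, -576, 216, -126, -114],
    ![36, 9, 31, -15, -30, -30, 46, -12, -6, 14, -12]]

/-- Linear terms of the coefficients of the eigenforms with eigenvalue of order three in terms of
theta quotients. -/
def cubicCoeffs₁ : Fin 2 → Fin 11 → ℤ := ![
    ![312, 183, -177, -81, 426, 426, 422, -216, -654, -378, 288],
    ![24, 27, 44, -3, -6, -48, 26, -36, -18, 28, 6]]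

set_option maxRecDepth 100000 in
lemma isStrictlyAdmissible_quadraticExps (i : Fin 6) :
    (quadraticExps i).length = 11 ∧ IsStrictlyAdmissible (exps (quadraticExps i)) := by
  revert i; decide +kernel

set_option maxRecDepth 100000 in
lemma isStrictlyAdmissible_cubicExps (i : Fin 11) :
    (cubicExps i).length = 11 ∧ IsStrictlyAdmissible (exps (cubicExps i)) := by
  revert i; decide +kernel

set_option maxRecDepth 100000 in
lemma sum_quadraticCoeffs (a : Fin 3) : ∀ k ∈ List.range 19 ++ [20],
    ∑ i, quadraticCoeffs a i * rowSum ((-1) ^ ·) (quadraticExps i) k =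
      if k = 16 + ![1, 2, 4] a then 32 else 0 := by
  revert a; decide +kernel

/-- The constant term of `X ^ j` modulo `X ^ 2 + X + 1`. -/
def cubicWeight₀ (j : ℕ) : ℤ := [1, 0, -1].getD (j % 3) 0

/-- The linear term of `X ^ j` modulo `X ^ 2 + X + 1`. -/
def cubicWeight₁ (j : ℕ) : ℤ := [0, 1, -1].getD (j % 3) 0

set_option maxRecDepth 100000 in
lemma sum_cubicCoeffs₀ (a : Fin 2) : ∀ k ∈ List.range 19,
    ∑ i, (cubicCoeffs₀ a i * rowSum cubicWeight₀ (cubicExps i) k -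
      cubicCoeffs₁ a i * rowSum cubicWeight₁ (cubicExps i) k) =
      if k = 16 + ![1, 2] a then ![1176, 168] a else 0 := by
  revert a; decide +kernel

set_option maxRecDepth 100000 in
lemma sum_cubicCoeffs₁ (a : Fin 2) : ∀ k ∈ List.range 19,
    ∑ i, (cubicCoeffs₀ a i * rowSum cubicWeight₁ (cubicExps i) k +
      cubicCoeffs₁ a i * rowSum cubicWeight₀ (cubicExps i) k -
      cubicCoeffs₁ a i * rowSum cubicWeight₁ (cubicExps i) k) = 0 := by
  revert a; decide +kernel

lemma exists_quadratic_form (a : Fin 3) : ∃ F ∈ cuspSpace 124 1,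
    F ∣[(1 : ℤ)] diamondGen = (-1 : ℂ)⁻¹ • F ∧
      ∀ b : Fin 3, qCoeff (![1, 2, 4] b) F = if b = a then 32 else 0 := by
  have h1 (k : ℕ) (hk : k ∈ List.range 19 ++ [20]) :
      ∑ i, (quadraticCoeffs a i : ℂ) * aeval (-1 : ℂ) (coefPoly (exps (quadraticExps i)) k) =
        if k = 16 + ![1, 2, 4] a then 32 else 0 := by
    have h2 := congrArg (Int.cast (R := ℂ)) (sum_quadraticCoeffs a k hk)
    push_cast at h2
    rw [← h2]
    refine Finset.sum_congr rfl fun i _ ↦ ?_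
    rw [rowSum_eq (isStrictlyAdmissible_quadraticExps i).1, aeval_coefPoly]
    push_cast
    simp only [mul_comm]
  obtain ⟨F, hF, hv, hc⟩ := combination_mem_cuspSpace (ζ := -1) (by norm_num)
    (fun i ↦ (isStrictlyAdmissible_quadraticExps i).2) (c := fun i ↦ quadraticCoeffs a i)
    (fun k hk ↦ by
      rw [h1 k (by simp; omega), if_neg]
      have : ∀ a, 0 < ![1, 2, 4] a := by decide
      have := this a
      omega)
  refine ⟨F, hF, hv, fun b ↦ ?_⟩
  rw [hc _ (by revert b; decide), h1 _ (by revert b; decide)]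
  have h2 : ∀ a b : Fin 3, 16 + ![1, 2, 4] b = 16 + ![1, 2, 4] a ↔ b = a := by decide
  exact if_congr (h2 a b) rfl rfl

lemma exists_cubic_form {ω : ℂ} (hω : ω ^ 2 + ω + 1 = 0) (a : Fin 2) : ∃ F ∈ cuspSpace 124 1,
    F ∣[(1 : ℤ)] diamondGen = ω⁻¹ • F ∧
      ∀ b : Fin 2, qCoeff (![1, 2] b) F = if b = a then ((![1176, 168] a : ℤ) : ℂ) else 0 := by
  have h3 : ω ^ 3 = 1 := by linear_combination (ω - 1) * hω
  have hw (j : ℕ) : ω ^ j = cubicWeight₀ j + cubicWeight₁ j * ω := by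
    rw [cubicWeight₀, cubicWeight₁, ← Nat.mod_add_div j 3, pow_add, pow_mul, h3, one_pow, mul_one]
    have := Nat.mod_lt j (show 3 > 0 by norm_num)
    generalize j % 3 = r at this
    interval_cases r
    · simp
    · simp
    · simp only [Nat.add_mul_mod_self_left]
      simp
      linear_combination hω
  have h1 (k : ℕ) (hk : k ∈ List.range 19) :
      ∑ i, ((cubicCoeffs₀ a i : ℂ) + cubicCoeffs₁ a i * ω) *
          aeval ω (coefPoly (exps (cubicExps i)) k) =
        if k = 16 + ![1, 2] a then ((![1176, 168] a : ℤ) : ℂ) else 0 := by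
    have h4 (i : Fin 11) : aeval ω (coefPoly (exps (cubicExps i)) k) =
        rowSum cubicWeight₀ (cubicExps i) k + rowSum cubicWeight₁ (cubicExps i) k * ω := by
      rw [rowSum_eq (isStrictlyAdmissible_cubicExps i).1,
        rowSum_eq (isStrictlyAdmissible_cubicExps i).1, aeval_coefPoly]
      push_cast
      rw [Finset.sum_mul, ← Finset.sum_add_distrib]
      refine Finset.sum_congr rfl fun j _ ↦ ?_
      rw [hw]
      ring
    have h5 := congrArg (Int.cast (R := ℂ)) (sum_cubicCoeffs₀ a k hk)
    have h6 := congrArg (Int.cast (R := ℂ)) (sum_cubicCoeffs₁ a k hk)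
    rw [Int.cast_ite, Int.cast_zero] at h5
    rw [Int.cast_zero] at h6
    rw [← h5, ← add_zero (Int.cast _), ← zero_mul ω, ← h6]
    push_cast
    rw [Finset.sum_mul, ← Finset.sum_add_distrib]
    refine Finset.sum_congr rfl fun i _ ↦ ?_
    rw [h4]
    linear_combination ((cubicCoeffs₁ a i : ℂ) * rowSum cubicWeight₁ (cubicExps i) k) * hω
  obtain ⟨F, hF, hv, hc⟩ := combination_mem_cuspSpace (ζ := ω)
    (by rw [show 30 = 3 * 10 from rfl, pow_mul, h3, one_pow])
    (fun i ↦ (isStrictlyAdmissible_cubicExps i).2)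
    (c := fun i ↦ (cubicCoeffs₀ a i : ℂ) + cubicCoeffs₁ a i * ω)
    (fun k hk ↦ by
      rw [h1 k (by simp; omega), if_neg]
      have : ∀ a, 0 < ![1, 2] a := by decide
      have := this a
      omega)
  refine ⟨F, hF, hv, fun b ↦ ?_⟩
  rw [hc _ (by revert b; decide), h1 _ (by revert b; decide)]
  have h2 : ∀ a b : Fin 2, 16 + ![1, 2] b = 16 + ![1, 2] a ↔ b = a := by decide
  exact if_congr (h2 a b) rfl rfl

section

lemma eigenProj_add (ζ : ℂ) (f g : ℍ → ℂ) :
    eigenProj ζ (f + g) = eigenProj ζ f + eigenProj ζ g := by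
  simp only [eigenProj, SlashAction.add_slash, smul_add, Finset.sum_add_distrib]

lemma eigenProj_smul (ζ c : ℂ) (f : ℍ → ℂ) : eigenProj ζ (c • f) = c • eigenProj ζ f := by
  simp only [eigenProj, SL_smul_slash, Finset.smul_sum, smul_comm c]

lemma eigenProj_of_eigen {ξ ζ : ℂ} (hξ : ξ ^ 30 = 1) (hζ : ζ ^ 30 = 1) {f : ℍ → ℂ}
    (hf : f ∣[(1 : ℤ)] diamondGen = ζ⁻¹ • f) :
    eigenProj ξ f = if ξ = ζ then (30 : ℂ) • f else 0 := by
  have hζ0 : ζ ≠ 0 := fun h ↦ by simp [h] at hζ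
  have h1 : eigenProj ξ f = (∑ j ∈ Finset.range 30, (ξ * ζ⁻¹) ^ j) • f := by
    rw [eigenProj, Finset.sum_smul]
    exact Finset.sum_congr rfl fun j _ ↦ by rw [slash_pow_of_eigen hf, smul_smul, mul_pow]
  rw [h1]
  split_ifs with h
  · simp [h, mul_inv_cancel₀ hζ0]
  · rw [geom_sum_eq (by rwa [Ne, mul_inv_eq_one₀ hζ0]), mul_pow, inv_pow, hξ, hζ]
    simp

/-- Labels of a basis of the space of cusp forms: three forms with a quadratic character, and two
for each of the cubic characters. -/
abbrev Label := Fin 3 ⊕ Fin 2 ⊕ Fin 2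

/-- A root of unity attached to the character of the basis element with a given label. -/
def Label.root (ω : ℂ) : Label → ℂ :=
  Sum.elim (fun _ ↦ -1) (Sum.elim (fun _ ↦ ω) fun _ ↦ ω ^ 2)

/-- The `q`-expansion coefficients which determine a cusp form. -/
def Label.coeffIndex : Label → ℕ := Sum.elim ![1, 2, 4] (Sum.elim ![1, 2] ![1, 2])

/-- The coordinates of a cusp form. -/
noncomputable def coordinates (ω : ℂ) : cuspSpace 124 1 →ₗ[ℂ] Label → ℂ where
  toFun f k := qCoeff k.coeffIndex (eigenProj (k.root ω) f)
  map_add' f g := by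
    ext k
    rw [Submodule.coe_add, eigenProj_add, qCoeff_add (eigenProj_mem f.2 _) (eigenProj_mem g.2 _),
      Pi.add_apply]
  map_smul' c f := by
    ext k
    rw [Submodule.coe_smul, eigenProj_smul, qCoeff_smul (eigenProj_mem f.2 _), Pi.smul_apply,
      smul_eq_mul, RingHom.id_apply]

variable {ω : ℂ}

lemma sq_add_self_add_one (hω : IsPrimitiveRoot ω 3) : ω ^ 2 + ω + 1 = 0 := by
  have h := hω.geom_sum_eq_zero (by norm_num)
  simp only [Finset.sum_range_succ, Finset.sum_range_zero, pow_zero, pow_one] at h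
  linear_combination h

lemma Label.root_pow (hω : IsPrimitiveRoot ω 3) (k : Label) : k.root ω ^ 30 = 1 := by
  have h : ω ^ 3 = 1 := hω.pow_eq_one
  obtain _ | _ | _ := k
  · simp [root]; norm_num
  · simp only [root, Sum.elim_inr, Sum.elim_inl]
    rw [show 30 = 3 * 10 from rfl, pow_mul, h, one_pow]
  · simp only [root, Sum.elim_inr]
    rw [← pow_mul, show 2 * 30 = 3 * 20 from rfl, pow_mul, h, one_pow]

lemma exists_coordinates_eq_single (hω : IsPrimitiveRoot ω 3) (k : Label) :
    ∃ f, ∃ d ≠ 0, coordinates ω f = Pi.single k d := by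
  have hω' : IsPrimitiveRoot (ω ^ 2) 3 := hω.pow_of_coprime 2 (by norm_num)
  have h1 : ω ≠ -1 := fun h ↦ by have := sq_add_self_add_one hω; norm_num [h] at this
  have h2 : ω ^ 2 ≠ -1 := fun h ↦ by have := sq_add_self_add_one hω'; norm_num [h] at this
  have h3 : ω ^ 2 ≠ ω := fun h ↦ by
    have h4 := hω.pow_inj (i := 2) (j := 1) (by norm_num) (by norm_num) (by rwa [pow_one])
    omega
  suffices ∃ F ∈ cuspSpace 124 1, F ∣[(1 : ℤ)] diamondGen = (k.root ω)⁻¹ • F ∧ ∃ d ≠ (0 : ℂ),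
      ∀ l : Label, l.root ω = k.root ω → qCoeff l.coeffIndex F = if l = k then d else 0 by
    obtain ⟨F, hF, hv, d, hd, hc⟩ := this
    refine ⟨⟨F, hF⟩, 30 * d, mul_ne_zero (by norm_num) hd, funext fun l ↦ ?_⟩
    change qCoeff _ (eigenProj _ F) = _
    rw [eigenProj_of_eigen (l.root_pow hω) (k.root_pow hω) hv, Pi.single_apply]
    split_ifs with h h' h'
    · rw [qCoeff_smul hF, hc l h, if_pos h']
    · rw [qCoeff_smul hF, hc l h, if_neg h', mul_zero]
    · exact absurd (congrArg _ h') h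
    · rw [← zero_smul ℂ F, qCoeff_smul hF, zero_mul]
  have h4 : ∀ a : Fin 2, ((![1176, 168] a : ℤ) : ℂ) ≠ 0 := by
    intro a
    fin_cases a <;> norm_num
  obtain a | a | a := k
  · obtain ⟨F, hF, hv, hc⟩ := exists_quadratic_form a
    refine ⟨F, hF, hv, 32, by norm_num, ?_⟩
    rintro (b | b | b) hb
    · simpa [Label.coeffIndex] using hc b
    · exact absurd hb h1
    · exact absurd hb h2
  · obtain ⟨F, hF, hv, hc⟩ := exists_cubic_form (sq_add_self_add_one hω) a
    refine ⟨F, hF, hv, _, h4 a, ?_⟩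
    rintro (b | b | b) hb
    · exact absurd hb.symm h1
    · simpa [Label.coeffIndex] using hc b
    · exact absurd hb h3
  · obtain ⟨F, hF, hv, hc⟩ := exists_cubic_form (sq_add_self_add_one hω') a
    refine ⟨F, hF, hv, _, h4 a, ?_⟩
    rintro (b | b | b) hb
    · exact absurd hb.symm h2
    · exact absurd hb.symm h3
    · simpa [Label.coeffIndex] using hc b

lemma coordinates_surjective (hω : IsPrimitiveRoot ω 3) :
    Function.Surjective (coordinates ω) := by
  choose F d hd hF using exists_coordinates_eq_single hω
  refine fun y ↦ ⟨∑ k, (y k / d k) • F k, ?_⟩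
  rw [map_sum]
  ext l
  simp [hF, Finset.sum_apply, Pi.single_apply, hd]

lemma coordinates_injective (hω : IsPrimitiveRoot ω 3) :
    Function.Injective (coordinates ω) := by
  rw [injective_iff_map_eq_zero]
  rintro ⟨f, hf⟩ h
  replace h (k : Label) : qCoeff k.coeffIndex (eigenProj (k.root ω) f) = 0 := congrFun h k
  refine Subtype.ext (eq_zero_of_eigenProj fun ζ hζ ↦ ?_)
  have hF := eigenProj_mem hf ζ
  have hv := eigenProj_slash_diamondGen hζ (hf.2.1 _ diamondGen_pow_mem_Gamma1)
  have hp := (IsPrimitiveRoot.orderOf ζ).inv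
  have hm : orderOf ζ ∈ Nat.divisors 30 := by simpa using orderOf_dvd_of_pow_eq_one hζ
  rw [show Nat.divisors 30 = {1, 2, 3, 5, 6, 10, 15, 30} from by decide +kernel] at hm
  simp only [Finset.mem_insert, Finset.mem_singleton] at hm
  generalize orderOf ζ = m at hp hm
  obtain rfl | rfl | rfl | rfl | rfl | rfl | rfl | rfl := hm
  · exact eq_zero_of_order_one hp hF hv
  · obtain rfl : ζ = -1 := (inv_inv ζ ▸ hp.inv).eq_neg_one_of_two_right
    exact eq_zero_of_order_two hp hF hv (h (.inl 0)) (h (.inl 1)) (h (.inl 2))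
  · obtain ⟨i, hi, rfl⟩ := hω.eq_pow_of_pow_eq_one (inv_inv ζ ▸ hp.inv).pow_eq_one
    interval_cases i
    · exact absurd hp.pow_eq_one (by simpa using hp.ne_one (by norm_num))
    · rw [pow_one] at *
      exact eq_zero_of_order_three hp hF hv (h (.inr (.inl 0))) (h (.inr (.inl 1)))
    · exact eq_zero_of_order_three hp hF hv (h (.inr (.inr 0))) (h (.inr (.inr 1)))
  · exact eq_zero_of_order_five hp hF hv
  · exact eq_zero_of_order_six hp hF hv
  · exact eq_zero_of_order_ten hp hF hv
  · exact eq_zero_of_order_fifteen hp hF hv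
  · exact eq_zero_of_order_thirty hp hF hv

end

end ThetaQuotient

theorem weight_one_cuspforms_level_124_rank_seven :
    Module.rank ℂ (CuspForm (CongruenceSubgroup.Gamma1 124) 1) = 7 := by
  have hω := Complex.isPrimitiveRoot_exp 3 (by norm_num)
  have e := ThetaQuotient.cuspFormEquiv 124 1 ≪≫ₗ
    .ofBijective (ThetaQuotient.coordinates _)
      ⟨ThetaQuotient.coordinates_injective hω, ThetaQuotient.coordinates_surjective hω⟩
  rw [e.rank_eq, rank_fun']
  simp
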